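/- Removability under Hausdorff measure conditions: Let Ω be an open set in ℝ^{2n} with a smooth almost complex structure J and let E ⊂ Ω be closed in Ω. (a) If the (2n−2)-dimensional Hausdorff measure of E is finite, then for every bounded continuous J-plurisubharmonic function u on Ω \ E, the function u* (equal to u off E and to limsup_{y→x, y∈Ω\E} u(y) at points x ∈ E) is J-plurisubharmonic on Ω. (b) If the (2n−3)-dimensional Hausdorff measure of E is zero, then the same conclusion holds for every (not necessarily bounded) continuous J-plurisubharmonic function u on Ω \ E. -/

import Mathlib

open Complex Metric Set MeasureTheory Filter Topology Bornology ENNReal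

noncomputable section

/-- We identify `ℝ^{2n}` with `ℂⁿ` (with the Euclidean norm). -/
abbrev Cn (n : ℕ) : Type := EuclideanSpace ℂ (Fin n)

/-- The standard complex structure on `ℂⁿ ≅ ℝ^{2n}`: multiplication by `i`,
viewed as an `ℝ`-linear map. -/
def Jstd (n : ℕ) : Cn n →L[ℝ] Cn n :=
  ContinuousLinearMap.restrictScalars ℝ (Complex.I • ContinuousLinearMap.id ℂ (Cn n))

/-- The standard complex structure on `ℂ ≅ ℝ²`. -/
def JstdC : ℂ →L[ℝ] ℂ :=
  ContinuousLinearMap.restrictScalars ℝ (Complex.I • ContinuousLinearMap.id ℂ ℂ)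

/-- `J` is a (smooth) almost complex structure on the set `Ω ⊆ ℂⁿ ≅ ℝ^{2n}`:
a `C^∞` field of linear automorphisms with `J(x) ∘ J(x) = -Id`. -/
def IsACS {n : ℕ} (Ω : Set (Cn n)) (J : Cn n → Cn n →L[ℝ] Cn n) : Prop :=
  ContDiffOn ℝ (⊤ : ℕ∞) J Ω ∧ ∀ x ∈ Ω, (J x).comp (J x) = -ContinuousLinearMap.id ℝ (Cn n)

/-- The open unit disc `Δ` in `ℂ`. -/
def unitDisc : Set ℂ := Metric.ball 0 1

/-- A map between (subsets of) almost complex spaces is `(J,J')`-holomorphic on `s` if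
`df_x ∘ J(x) = J'(f(x)) ∘ df_x` on `s`. -/
def PseudoHolOn {n m : ℕ} (J : Cn n → Cn n →L[ℝ] Cn n) (J' : Cn m → Cn m →L[ℝ] Cn m)
    (f : Cn n → Cn m) (s : Set (Cn n)) : Prop :=
  ∀ x ∈ s, DifferentiableAt ℝ f x ∧
    (fderiv ℝ f x).comp (J x) = (J' (f x)).comp (fderiv ℝ f x)

/-- A map from an open subset of `ℂ` is `J`-holomorphic on `s` if
`df_ζ ∘ J_st = J(f(ζ)) ∘ df_ζ` on `s`. -/
def JHolOn {n : ℕ} (J : Cn n → Cn n →L[ℝ] Cn n) (f : ℂ → Cn n) (s : Set ℂ) : Prop :=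
  ∀ ζ ∈ s, DifferentiableAt ℝ f ζ ∧
    (fderiv ℝ f ζ).comp JstdC = (J (f ζ)).comp (fderiv ℝ f ζ)

/-- A `J`-holomorphic disc in `D`. -/
def JDisc {n : ℕ} (J : Cn n → Cn n →L[ℝ] Cn n) (D : Set (Cn n)) (f : ℂ → Cn n) : Prop :=
  MapsTo f unitDisc D ∧ JHolOn J f unitDisc

/-- The nonnegative part of an extended real number, as an element of `ℝ≥0∞`. -/
def erealPos (x : EReal) : ℝ≥0∞ := if x = ⊤ then ⊤ else ENNReal.ofReal x.toReal

/-- The integral of an `EReal`-valued function: the (unsigned) integral of the positive part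
minus the integral of the negative part. -/
def erealIntegral {X : Type} [MeasurableSpace X] (μ : Measure X) (g : X → EReal) : EReal :=
  ((∫⁻ x, erealPos (g x) ∂μ : ℝ≥0∞) : EReal) - ((∫⁻ x, erealPos (-(g x)) ∂μ : ℝ≥0∞) : EReal)

/-- `h : ℂ → [-∞,∞)` is subharmonic on `s`: upper semicontinuous and satisfying the
sub-mean-value inequality `h(a) ≤ (2π)⁻¹ ∫₀^{2π} h(a + r e^{iθ}) dθ` whenever the closed disc
of center `a` and radius `r` is contained in `s`. -/
def SubharmonicOnE (h : ℂ → EReal) (s : Set ℂ) : Prop :=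
  UpperSemicontinuousOn h s ∧
  ∀ a : ℂ, ∀ r : ℝ, 0 < r → Metric.closedBall a r ⊆ s →
    h a ≤ (((2 * Real.pi)⁻¹ : ℝ) : EReal) *
      erealIntegral (volume.restrict (Set.Ioc (0 : ℝ) (2 * Real.pi)))
        (fun θ : ℝ => h (a + (r : ℂ) * Complex.exp ((θ : ℂ) * Complex.I)))

/-- `u : Ω → [-∞,∞)` is `J`-plurisubharmonic on `Ω`: upper semicontinuous, and `u ∘ f` is
subharmonic on `Δ` for every `J`-holomorphic disc `f : Δ → Ω`. -/
def JPshOn {n : ℕ} (J : Cn n → Cn n →L[ℝ] Cn n) (Ω : Set (Cn n)) (u : Cn n → EReal) : Prop :=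
  UpperSemicontinuousOn u Ω ∧
  ∀ f : ℂ → Cn n, JDisc J Ω f → SubharmonicOnE (fun ζ => u (f ζ)) unitDisc

/-- Real-valued `J`-plurisubharmonic functions. -/
def JPshOnR {n : ℕ} (J : Cn n → Cn n →L[ℝ] Cn n) (Ω : Set (Cn n)) (u : Cn n → ℝ) : Prop :=
  JPshOn J Ω (fun x => (u x : EReal))

/-- The `1`-form `J*dr : w ↦ dr_x(J(x)w)`. -/
def JStarDr {n : ℕ} (J : Cn n → Cn n →L[ℝ] Cn n) (r : Cn n → ℝ) (x : Cn n) : Cn n →L[ℝ] ℝ :=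
  (fderiv ℝ r x).comp (J x)

/-- The Levi form of a `C²` function `r`:
`L^J_r(p,v) = -d(J*dr)_p(v, J(p)v)` where `dα_p(u,w) = (∂_u α)_p(w) - (∂_w α)_p(u)`. -/
def LeviForm {n : ℕ} (J : Cn n → Cn n →L[ℝ] Cn n) (r : Cn n → ℝ) (p v : Cn n) : ℝ :=
  -((fderiv ℝ (JStarDr J r) p v) (J p v) - (fderiv ℝ (JStarDr J r) p (J p v)) v)

/-- `r` is strictly `J`-plurisubharmonic on `S`: its Levi form is positive definite there. -/
def StrictJPshOn {n : ℕ} (J : Cn n → Cn n →L[ℝ] Cn n) (r : Cn n → ℝ) (S : Set (Cn n)) : Prop :=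
  ∀ p ∈ S, ∀ v : Cn n, v ≠ 0 → 0 < LeviForm J r p v

/-- The Kobayashi–Royden infinitesimal pseudometric of `(D,J)`:
`K(p,v) = inf {α > 0 : ∃ J-holomorphic disc f : Δ → D, f(0) = p, df_0(∂/∂x) = v/α}`. -/
def kobMetric {n : ℕ} (J : Cn n → Cn n →L[ℝ] Cn n) (D : Set (Cn n)) (p v : Cn n) : ℝ :=
  sInf {α : ℝ | 0 < α ∧ ∃ f : ℂ → Cn n, JDisc J D f ∧ f 0 = p ∧ fderiv ℝ f 0 1 = α⁻¹ • v}

/-- A piecewise `C¹` path `γ : [0,1] → ℝ^{2n}`. -/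
def PiecewiseC1On {n : ℕ} (γ : ℝ → Cn n) : Prop :=
  ContinuousOn γ (Set.Icc 0 1) ∧
  ∃ (m : ℕ) (t : ℕ → ℝ), t 0 = 0 ∧ t m = 1 ∧ (∀ i < m, t i < t (i + 1)) ∧
    ∀ i < m, ContDiffOn ℝ 1 γ (Set.Icc (t i) (t (i + 1)))

/-- The (integrated) Kobayashi pseudodistance of `(D,J)`: the infimum of the Kobayashi–Royden
lengths of piecewise `C¹` paths in `D` joining `p` to `q`. -/
def kobDist {n : ℕ} (J : Cn n → Cn n →L[ℝ] Cn n) (D : Set (Cn n)) (p q : Cn n) : ℝ :=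
  sInf {L : ℝ | ∃ γ : ℝ → Cn n, PiecewiseC1On γ ∧ MapsTo γ (Set.Icc 0 1) D ∧
    γ 0 = p ∧ γ 1 = q ∧ L = ∫ t in (0 : ℝ)..1, kobMetric J D (γ t) (deriv γ t)}

/-- The cluster set of `f` (defined on `S`) along `A ⊆ closure S`: all limits of sequences
`f(s_k)` where `s_k ∈ S` converges to a point of `A`. -/
def clusterSet {X Y : Type*} [TopologicalSpace X] [TopologicalSpace Y]
    (f : X → Y) (S A : Set X) : Set Y :=
  {y | ∃ u : ℕ → X, (∀ k, u k ∈ S) ∧ (∃ a ∈ A, Tendsto u atTop (𝓝 a)) ∧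
    Tendsto (fun k => f (u k)) atTop (𝓝 y)}

/-- `N` is a `d`-dimensional `C^∞` submanifold of `ℂⁿ ≅ ℝ^{2n}`: near every point it can be
straightened, by a `C^∞` diffeomorphism onto an open subset of `ℝ^{2n}`, to the coordinate
subspace spanned by the first `d` coordinates. -/
def IsSmoothSubmanifold {n : ℕ} (d : ℕ) (N : Set (Cn n)) : Prop :=
  ∀ p ∈ N, ∃ (U : Set (Cn n)) (V : Set (EuclideanSpace ℝ (Fin (2 * n))))
    (φ : Cn n → EuclideanSpace ℝ (Fin (2 * n))) (ψ : EuclideanSpace ℝ (Fin (2 * n)) → Cn n),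
    IsOpen U ∧ p ∈ U ∧ IsOpen V ∧ ContDiffOn ℝ (⊤ : ℕ∞) φ U ∧ ContDiffOn ℝ (⊤ : ℕ∞) ψ V ∧
    (∀ x ∈ U, ψ (φ x) = x) ∧ (∀ y ∈ V, φ (ψ y) = y) ∧ MapsTo φ U V ∧
    φ '' (N ∩ U) = V ∩ {x | ∀ i : Fin (2 * n), d ≤ (i : ℕ) → x i = 0}

/-- The tangent set of `N ⊆ ℂⁿ` at `p`: velocities at `0` of differentiable curves through `p`
staying in `N` near time `0`. For a `C^∞` submanifold this is the tangent space `T_pN`. -/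
def TangentSet {n : ℕ} (N : Set (Cn n)) (p : Cn n) : Set (Cn n) :=
  {v | ∃ γ : ℝ → Cn n, γ 0 = p ∧ (∀ᶠ t in 𝓝 (0 : ℝ), γ t ∈ N) ∧
    DifferentiableAt ℝ γ 0 ∧ deriv γ 0 = v}

/-- `N` is totally real for `J`: `T_pN ∩ J(p)(T_pN) = {0}` at every `p ∈ N`. -/
def TotallyReal {n : ℕ} (J : Cn n → Cn n →L[ℝ] Cn n) (N : Set (Cn n)) : Prop :=
  ∀ p ∈ N, ∀ v ∈ TangentSet N p, J p v ∈ TangentSet N p → v = 0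

/-- `ρ` is a (global) `C^∞` defining function of `D`, defined on the neighborhood `Ω` of the
closure of `D`, with nonvanishing differential on `∂D`.  (This encodes that `D` has
`C^∞` boundary.) -/
def DefiningFunction {n : ℕ} (D Ω : Set (Cn n)) (ρ : Cn n → ℝ) : Prop :=
  IsOpen Ω ∧ closure D ⊆ Ω ∧ ContDiffOn ℝ (⊤ : ℕ∞) ρ Ω ∧
  D = {x ∈ Ω | ρ x < 0} ∧ ∀ x ∈ frontier D, fderiv ℝ ρ x ≠ 0

/-- `D` is a bounded strictly `J`-pseudoconvex domain with `C^∞` boundary: it admits a smooth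
defining function which is `J`-plurisubharmonic on `D` and strictly `J`-plurisubharmonic on a
neighborhood of `∂D`. -/
def StrictlyPseudoconvexDomain {n : ℕ} (J : Cn n → Cn n →L[ℝ] Cn n) (D : Set (Cn n)) : Prop :=
  IsOpen D ∧ IsConnected D ∧ IsBounded D ∧
  ∃ (Ω : Set (Cn n)) (ρ : Cn n → ℝ), DefiningFunction D Ω ρ ∧
    JPshOnR J D ρ ∧ ∃ W : Set (Cn n), IsOpen W ∧ frontier D ⊆ W ∧ StrictJPshOn J ρ W

end

noncomputable instance (n : ℕ) : MeasurableSpace (Cn n) := borel _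
instance (n : ℕ) : BorelSpace (Cn n) := ⟨rfl⟩

set_option linter.unusedSectionVars false
set_option linter.unusedSimpArgs false
set_option linter.unusedVariables false
namespace RH

/-- Cauchy kernel -/
noncomputable def kern (w : ℂ) : ℂ := ((Real.pi : ℂ) * w)⁻¹

/-- regularised Cauchy kernel; `kern` is the case `c = ∞`. -/
noncomputable def kernR (c : ℝ) (w : ℂ) : ℂ :=
  ((c ^ 2 / (Real.pi * (1 + c ^ 2 * ‖w‖ ^ 2)) : ℝ) : ℂ) * (starRingEnd ℂ) w

lemma norm_kern (w : ℂ) : ‖kern w‖ = (Real.pi * ‖w‖)⁻¹ := by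
  rw [kern, norm_inv, norm_mul, Complex.norm_real, Real.norm_of_nonneg Real.pi_pos.le]

lemma measurable_kern : Measurable kern := by
  unfold kern; fun_prop

lemma kern_neg (w : ℂ) : kern (-w) = - kern w := by
  simp [kern, inv_neg]

lemma integrableOn_kern_ball (r : ℝ) : IntegrableOn kern (ball 0 r) := by
  have h := (integrableOn_fun_norm_addHaar (volume : Measure ℂ) (f := fun y : ℝ => (Real.pi * y)⁻¹) (r := r)).2
    (by
      have : IntegrableOn (fun _ : ℝ => Real.pi⁻¹) (Ioo 0 r) := by
        exact integrableOn_const (by simp) (by simp)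
      refine this.congr_fun ?_ measurableSet_Ioo
      intro y hy
      simp only [Complex.finrank_real_complex, smul_eq_mul]
      have : y ≠ 0 := hy.1.ne'
      simp
      field_simp)
  refine (integrable_norm_iff measurable_kern.aestronglyMeasurable).1 ?_
  refine h.congr (ae_of_all _ fun w => ?_)
  simp [norm_kern]

lemma locallyIntegrable_kern : LocallyIntegrable kern := by
  intro x
  refine ⟨ball 0 (‖x‖ + 1), isOpen_ball.mem_nhds ?_, integrableOn_kern_ball _⟩
  simp

lemma kernR_bound (c : ℝ) (w : ℂ) : ‖kernR c w‖ ≤ ‖kern w‖ := by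
  have hp := Real.pi_pos
  rw [norm_kern, kernR, norm_mul, Complex.norm_real, RCLike.norm_conj, Real.norm_of_nonneg (by positivity)]
  rcases eq_or_ne w 0 with rfl | hw
  · simp
  have : 0 < ‖w‖ := norm_pos_iff.2 hw
  rw [div_mul_eq_mul_div, ← one_div, div_le_div_iff₀ (by positivity) (by positivity)]
  nlinarith [sq_nonneg c, mul_pos hp this]

lemma kern_eq (w : ℂ) : kern w = ((Real.pi * ‖w‖^2 : ℝ) : ℂ)⁻¹ * (starRingEnd ℂ) w := by
  rcases eq_or_ne w 0 with rfl | hw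
  · simp [kern]
  have h : (starRingEnd ℂ) w ≠ 0 := by simpa using hw
  have h2 : ((‖w‖^2 : ℝ) : ℂ) = (starRingEnd ℂ) w * w := by
    rw [Complex.conj_mul', Complex.ofReal_pow]
  have hp : (Real.pi : ℂ) ≠ 0 := by exact_mod_cast Real.pi_ne_zero
  rw [kern, Complex.ofReal_mul, h2]
  field_simp

lemma kernR_tendsto (w : ℂ) : Tendsto (fun c => kernR c w) atTop (𝓝 (kern w)) := by
  rcases eq_or_ne w 0 with rfl | hw
  · simp [kernR, kern]
  have hw' : 0 < ‖w‖ := norm_pos_iff.2 hw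
  rw [kern_eq]
  unfold kernR
  refine Tendsto.mul_const _ ?_
  rw [← Complex.ofReal_inv]
  refine (Complex.continuous_ofReal.tendsto _).comp ?_
  have h1 : Tendsto (fun c : ℝ => (Real.pi * (c⁻¹ ^ 2 + ‖w‖ ^ 2))⁻¹) atTop (𝓝 ((Real.pi * ‖w‖ ^ 2)⁻¹)) := by
    have : Tendsto (fun c : ℝ => c⁻¹ ^ 2) atTop (𝓝 (0^2)) := tendsto_inv_atTop_zero.pow 2
    have h2 := (this.add_const (‖w‖^2)).const_mul Real.pi
    have h3 := h2.inv₀ (by simp; exact hw)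
    simpa using h3
  refine h1.congr' ?_
  filter_upwards [eventually_gt_atTop 0] with c hc
  have : 0 < Real.pi := Real.pi_pos
  field_simp

lemma kernR_continuous (c : ℝ) : Continuous (kernR c) := by
  unfold kernR
  refine Continuous.mul ?_ Complex.continuous_conj
  refine Complex.continuous_ofReal.comp ?_
  refine Continuous.div continuous_const (by fun_prop) fun w => ?_
  have : 0 < Real.pi := Real.pi_pos
  positivity

lemma kernR_contDiff (c : ℝ) : ContDiff ℝ 1 (kernR c) := by
  unfold kernR
  refine ContDiff.mul ?_ Complex.conjCLE.contDiff
  refine Complex.ofRealCLM.contDiff.comp ?_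
  refine ContDiff.div contDiff_const (contDiff_const.mul (contDiff_const.add (contDiff_const.mul (contDiff_norm_sq ℝ)))) fun w => ?_
  have : 0 < Real.pi := Real.pi_pos
  positivity

lemma kernR_bdd (c : ℝ) : ∃ B, ∀ w, ‖kernR c w‖ ≤ B := by
  obtain ⟨B, hB⟩ := (isCompact_closedBall (0:ℂ) 1).exists_bound_of_continuousOn (kernR_continuous c).continuousOn
  refine ⟨max B Real.pi⁻¹, fun w => ?_⟩
  rcases le_or_gt ‖w‖ 1 with hw | hw
  · exact (hB w (by simpa using hw)).trans (le_max_left _ _)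
  · refine (kernR_bound c w).trans (le_trans ?_ (le_max_right _ _))
    rw [norm_kern]
    apply inv_anti₀ Real.pi_pos
    nlinarith [Real.pi_pos]

lemma kernR_neg (c : ℝ) (w : ℂ) : kernR c (-w) = - kernR c w := by
  simp [kernR]

/-- the approximate identity -/
noncomputable def rho (w : ℂ) : ℝ := (Real.pi * (1 + ‖w‖ ^ 2) ^ 2)⁻¹

lemma integral_rho : ∫ w, rho w = 1 := by
  have h := integral_fun_norm_addHaar (volume : Measure ℂ) (fun y : ℝ => (Real.pi * (1 + y ^ 2) ^ 2)⁻¹)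
  unfold rho
  rw [h]
  have hp := Real.pi_pos
  have hd : ∀ x ∈ Ici (0:ℝ), HasDerivAt (fun y : ℝ => - (2 * Real.pi * (1 + y^2))⁻¹)
      (x * (Real.pi * (1 + x ^ 2) ^ 2)⁻¹) x := by
    intro x _
    have h1 : HasDerivAt (fun y : ℝ => 2 * Real.pi * (1 + y^2)) (2 * Real.pi * (2 * x)) x := by
      have := ((hasDerivAt_pow 2 x).const_add 1).const_mul (2 * Real.pi)
      simpa using this
    have h2 := (h1.inv (by positivity)).neg
    refine h2.congr_deriv ?_
    field_simp
  have ht : Tendsto (fun y : ℝ => - (2 * Real.pi * (1 + y^2))⁻¹) atTop (𝓝 0) := by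
    have : Tendsto (fun y : ℝ => (2 * Real.pi * (1 + y^2))) atTop atTop := by
      refine Tendsto.const_mul_atTop (by positivity) ?_
      exact tendsto_atTop_add_const_left _ _ (tendsto_pow_atTop two_ne_zero)
    simpa using this.inv_tendsto_atTop.neg
  have hi := integral_Ioi_of_hasDerivAt_of_nonneg' (a := 0) hd (fun x hx => by
    have : (0:ℝ) < x := hx
    positivity) ht
  simp only [Complex.finrank_real_complex, smul_eq_mul, pow_one,
    show 2 - 1 = 1 from rfl]
  rw [hi]
  have hb : (volume : Measure ℂ).real (ball 0 1) = Real.pi := by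
    rw [Measure.real, Complex.volume_ball]; simp
  rw [hb]
  simp

lemma kernR_hasFDerivAt (c : ℝ) (w : ℂ) : ∃ D : ℂ →L[ℝ] ℂ, HasFDerivAt (kernR c) D w ∧
    (1/2 : ℂ) * (D 1 + I * D I) = ((c ^ 2 * rho (c • w) : ℝ) : ℂ) := by
  have hp := Real.pi_pos
  have h1 : HasFDerivAt (fun w : ℂ => Real.pi * (1 + c ^ 2 * ‖w‖ ^ 2))
      (Real.pi • (c ^ 2 • (2 • (innerSL ℝ w)))) w := by
    have := (((hasStrictFDerivAt_norm_sq w).hasFDerivAt.const_mul (c^2)).const_add 1).const_mul Real.pi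
    exact this
  have h0 : Real.pi * (1 + c ^ 2 * ‖w‖ ^ 2) ≠ 0 := by positivity
  have h2 := (hasDerivAt_inv h0).comp_hasFDerivAt w h1
  have h3 := h2.const_mul (c^2)
  have hn : (‖c • w‖) ^ 2 = c ^ 2 * ‖w‖ ^ 2 := by
    rw [norm_smul, mul_pow, Real.norm_eq_abs, sq_abs]
  have hn2 : ‖w‖ ^ 2 = w.re ^ 2 + w.im ^ 2 := by
    rw [← Complex.normSq_eq_norm_sq, Complex.normSq_apply]; ring
  obtain ⟨α, hα⟩ : ∃ α : ℝ, α = -(2 * c ^ 4 / (Real.pi * (1 + c ^ 2 * ‖w‖ ^ 2) ^ 2)) := ⟨_, rfl⟩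
  obtain ⟨a, ha⟩ : ∃ a : ℝ, a = c ^ 2 / (Real.pi * (1 + c ^ 2 * ‖w‖ ^ 2)) := ⟨_, rfl⟩
  have hfin : ∃ d : ℂ →L[ℝ] ℝ, HasFDerivAt (fun w : ℂ => c ^ 2 / (Real.pi * (1 + c ^ 2 * ‖w‖ ^ 2))) d w
      ∧ d 1 = α * w.re ∧ d I = α * w.im := by
    refine ⟨_, h3, ?_, ?_⟩
    · simp [Complex.inner, hα]; field_simp
    · simp [Complex.inner, hα]; field_simp
  obtain ⟨d, hd, hd1, hdI⟩ := hfin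
  have h4 := (Complex.ofRealCLM.hasFDerivAt).comp w hd
  have h5 := h4.mul (Complex.conjCLE.toContinuousLinearMap.hasFDerivAt (x := w))
  refine ⟨_, h5, ?_⟩
  have key : c ^ 2 * rho (c • w) = a + α / 2 * ‖w‖ ^ 2 := by
    rw [rho, hn, ha, hα]; field_simp; ring
  rw [key, hn2]
  generalize hR : a + α / 2 * (w.re ^ 2 + w.im ^ 2) = R
  simp only [Function.comp_apply, ← ha, add_apply, smul_apply, ContinuousLinearMap.comp_apply, hd1,
    hdI, smul_eq_mul, ofRealCLM_apply, ContinuousLinearEquiv.coe_coe, conjCLE_apply, map_one, conj_I]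
  apply Complex.ext
  · simp
    rw [← hR]; ring
  · simp
    ring

section T
variable {V : Type*} [NormedAddCommGroup V] [NormedSpace ℂ V] [NormedSpace ℝ V] [IsScalarTower ℝ ℂ V]

lemma coe_smul_tower (r : ℝ) (v : V) : (r : ℂ) • v = r • v := algebraMap_smul ℂ r v

/-- the Cauchy–Riemann operator -/
noncomputable def dbar (g : ℂ → V) (z : ℂ) : V := (1/2 : ℂ) • (fderiv ℝ g z 1 + I • fderiv ℝ g z I)

/-- Cauchy transform -/
noncomputable def CT (g : ℂ → V) (z : ℂ) : V := ∫ w, kern w • g (z - w)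

/-- bounded by m and supported in the closed unit ball. -/
def Adm (g : ℂ → V) (m : ℝ) : Prop :=
  AEStronglyMeasurable g ∧ (∀ w, ‖g w‖ ≤ m) ∧ ∀ w, 1 < ‖w‖ → g w = 0

lemma Adm.nonneg {g : ℂ → V} {m : ℝ} (h : Adm g m) : 0 ≤ m := (norm_nonneg _).trans (h.2.1 0)

/-- constant of the Cauchy transform -/
noncomputable def cT : ℝ := (∫ w in ball (0:ℂ) 1, ‖kern w‖) + 1

lemma cT_pos : 0 < cT := by
  have : 0 ≤ ∫ w in ball (0:ℂ) 1, ‖kern w‖ := integral_nonneg fun _ => norm_nonneg _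
  unfold cT; linarith

lemma integrableOn_kern_closedBall (z : ℂ) : IntegrableOn kern (closedBall z 1) :=
  locallyIntegrable_kern.integrableOn_isCompact (isCompact_closedBall _ _)

lemma kern_bound (z : ℂ) : ∫ w in closedBall z 1, ‖kern w‖ ≤ cT := by
  have hp := Real.pi_pos
  have h1 : ∀ w, ‖kern w‖ ≤ (ball (0:ℂ) 1).indicator (fun w => ‖kern w‖) w + Real.pi⁻¹ := by
    intro w
    by_cases hw : w ∈ ball (0:ℂ) 1
    · rw [indicator_of_mem hw]
      have : 0 ≤ Real.pi⁻¹ := by positivity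
      linarith
    · rw [indicator_of_notMem hw, norm_kern, zero_add]
      have : 1 ≤ ‖w‖ := by simpa using hw
      apply inv_anti₀ hp
      nlinarith
  have hI : Integrable ((ball (0:ℂ) 1).indicator (fun w => ‖kern w‖)) :=
    IntegrableOn.integrable_indicator (integrableOn_kern_ball 1).norm measurableSet_ball
  have hC : IntegrableOn (fun _ : ℂ => Real.pi⁻¹) (closedBall z 1) :=
    integrableOn_const (isCompact_closedBall _ _).measure_lt_top.ne (by simp)
  calc ∫ w in closedBall z 1, ‖kern w‖
      ≤ ∫ w in closedBall z 1, ((ball (0:ℂ) 1).indicator (fun w => ‖kern w‖) w + Real.pi⁻¹) :=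
        integral_mono (integrableOn_kern_closedBall z).norm (hI.integrableOn.add hC) h1
    _ = (∫ w in closedBall z 1, (ball (0:ℂ) 1).indicator (fun w => ‖kern w‖) w) + 1 := by
        rw [integral_add hI.integrableOn hC]
        congr 1
        rw [setIntegral_const, Measure.real, Complex.volume_closedBall]
        simp [hp.ne']
    _ ≤ (∫ w, (ball (0:ℂ) 1).indicator (fun w => ‖kern w‖) w) + 1 := by
        refine add_le_add_left ?_ _
        exact setIntegral_le_integral hI (ae_of_all _ fun w => indicator_nonneg (fun _ _ => norm_nonneg _) _)
    _ = cT := by rw [integral_indicator measurableSet_ball, cT]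

lemma aesm_comp_sub {g : ℂ → V} (h : AEStronglyMeasurable g) (z : ℂ) :
    AEStronglyMeasurable (fun w => g (z - w)) :=
  h.comp_measurePreserving (Measure.measurePreserving_sub_left volume z)

lemma Adm.integrable_gen {g : ℂ → V} {m : ℝ} (h : Adm g m) (z : ℂ) {k : ℂ → ℂ} (hk : Measurable k)
    (hkk : ∀ w, ‖k w‖ ≤ ‖kern w‖) :
    Integrable (fun w => k w • g (z - w)) ∧ (∀ w, ‖k w • g (z - w)‖ ≤
      (closedBall z 1).indicator (fun w => m * ‖kern w‖) w) ∧
      Integrable ((closedBall z 1).indicator (fun w => m * ‖kern w‖)) := by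
  have hI : Integrable ((closedBall z 1).indicator (fun w => m * ‖kern w‖)) :=
    IntegrableOn.integrable_indicator ((integrableOn_kern_closedBall z).norm.const_mul m) measurableSet_closedBall
  have hb : ∀ w, ‖k w • g (z - w)‖ ≤
      (closedBall z 1).indicator (fun w => m * ‖kern w‖) w := by
    intro w
    by_cases hw : w ∈ closedBall z 1
    · rw [indicator_of_mem hw, norm_smul, mul_comm m]
      exact mul_le_mul (hkk w) (h.2.1 _) (norm_nonneg _) (norm_nonneg _)
    · rw [indicator_of_notMem hw, h.2.2, smul_zero, norm_zero]
      rw [mem_closedBall, dist_eq_norm, not_le] at hw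
      rwa [norm_sub_rev]
  refine ⟨hI.mono' (hk.aestronglyMeasurable.smul (aesm_comp_sub h.1 z)) (ae_of_all _ hb), hb, hI⟩

lemma Adm.integrable {g : ℂ → V} {m : ℝ} (h : Adm g m) (z : ℂ) :
    Integrable (fun w => kern w • g (z - w)) :=
  (h.integrable_gen z measurable_kern fun _ => le_rfl).1

lemma Adm.CT_le {g : ℂ → V} {m : ℝ} (h : Adm g m) (z : ℂ) : ‖CT g z‖ ≤ cT * m := by
  obtain ⟨_, h2, h3⟩ := h.integrable_gen z measurable_kern fun _ => le_rfl
  calc ‖CT g z‖ ≤ ∫ w, (closedBall z 1).indicator (fun w => m * ‖kern w‖) w :=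
        norm_integral_le_of_norm_le h3 (ae_of_all _ h2)
    _ = m * ∫ w in closedBall z 1, ‖kern w‖ := by
        rw [integral_indicator measurableSet_closedBall, integral_const_mul]
    _ ≤ m * cT := mul_le_mul_of_nonneg_left (kern_bound z) h.nonneg
    _ = _ := mul_comm _ _

lemma CT_sub {g₁ g₂ : ℂ → V} {m₁ m₂ : ℝ} (h₁ : Adm g₁ m₁) (h₂ : Adm g₂ m₂) (z : ℂ) :
    CT (fun w => g₁ w - g₂ w) z = CT g₁ z - CT g₂ z := by
  simp only [CT, smul_sub]
  exact integral_sub (h₁.integrable z) (h₂.integrable z)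

lemma CT_add {g₁ g₂ : ℂ → V} {m₁ m₂ : ℝ} (h₁ : Adm g₁ m₁) (h₂ : Adm g₂ m₂) (z : ℂ) :
    CT (fun w => g₁ w + g₂ w) z = CT g₁ z + CT g₂ z := by
  simp only [CT, smul_add]
  exact integral_add (h₁.integrable z) (h₂.integrable z)

/-- C¹ functions supported in the closed unit ball -/
lemma CT_eq_conv (g : ℂ → V) :
    CT g = convolution kern g (ContinuousLinearMap.lsmul ℝ ℂ) volume := by
  ext z; rfl

lemma hcs_of_zero {E : Type*} [Zero E] {g : ℂ → E} (h : ∀ w, 1 < ‖w‖ → g w = 0) : HasCompactSupport g :=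
  HasCompactSupport.intro (isCompact_closedBall (0:ℂ) 1) fun x hx => h x (by simpa using hx)

lemma fderiv_zero_of_zero {g : ℂ → V} (h : ∀ w, 1 < ‖w‖ → g w = 0) : ∀ w, 1 < ‖w‖ → fderiv ℝ g w = 0 := by
  intro w hw
  have : g =ᶠ[𝓝 w] fun _ => 0 := by
    filter_upwards [(isOpen_lt continuous_const continuous_norm).mem_nhds hw] with y hy using h y hy
  rw [this.fderiv_eq]; simp

lemma CT_contDiff {g : ℂ → V} (hg : ContDiff ℝ 1 g) (h0 : ∀ w, 1 < ‖w‖ → g w = 0) :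
    ContDiff ℝ 1 (CT g) := by
  rw [CT_eq_conv]
  exact (hcs_of_zero h0).contDiff_convolution_right _ locallyIntegrable_kern hg

lemma fderiv_CT {g : ℂ → V} (hg : ContDiff ℝ 1 g) (h0 : ∀ w, 1 < ‖w‖ → g w = 0) (z h : ℂ) :
    fderiv ℝ (CT g) z h = CT (fun w => fderiv ℝ g w h) z := by
  rw [CT_eq_conv, ((hcs_of_zero h0).hasFDerivAt_convolution_right _ locallyIntegrable_kern hg z).fderiv,
    convolution_precompR_apply _ locallyIntegrable_kern ((hcs_of_zero h0).fderiv ℝ)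
      (hg.continuous_fderiv one_ne_zero)]
  rfl

lemma adm_of_cont {g : ℂ → V} (hg : Continuous g) (h0 : ∀ w, 1 < ‖w‖ → g w = 0) : ∃ m, Adm g m := by
  obtain ⟨m, hm⟩ := (hcs_of_zero h0).exists_bound_of_continuous hg
  exact ⟨m, hg.aestronglyMeasurable, hm, h0⟩

lemma fderiv_CT_le {g : ℂ → V} (hg : ContDiff ℝ 1 g) (h0 : ∀ w, 1 < ‖w‖ → g w = 0) {m : ℝ}
    (hm : ∀ w, ‖fderiv ℝ g w‖ ≤ m) (z : ℂ) :
    ‖fderiv ℝ (CT g) z‖ ≤ cT * m := by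
  have hm0 : 0 ≤ m := (norm_nonneg _).trans (hm 0)
  refine ContinuousLinearMap.opNorm_le_bound _ (mul_nonneg cT_pos.le hm0) fun h => ?_
  rw [fderiv_CT hg h0, mul_assoc]
  refine Adm.CT_le ⟨?_, ?_, ?_⟩ z
  · exact ((hg.continuous_fderiv one_ne_zero).clm_apply continuous_const).aestronglyMeasurable
  · intro w
    exact (fderiv ℝ g w).le_of_opNorm_le (hm w) h
  · intro w hw
    rw [fderiv_zero_of_zero h0 w hw]; simp

lemma rho_nonneg (w : ℂ) : 0 ≤ rho w := by unfold rho; have := Real.pi_pos; positivity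

lemma rho_decay : Tendsto (fun x : ℂ ↦ ‖x‖ ^ Module.finrank ℝ ℂ * rho x) (cobounded ℂ) (𝓝 0) := by
  have hp := Real.pi_pos
  have h1 : Tendsto (fun x : ℂ => (‖x‖^2)⁻¹) (cobounded ℂ) (𝓝 0) :=
    ((tendsto_pow_atTop two_ne_zero).comp tendsto_norm_cobounded_atTop).inv_tendsto_atTop
  refine squeeze_zero (fun x => mul_nonneg (by positivity) (rho_nonneg x)) (fun x => ?_) h1
  rw [Complex.finrank_real_complex, rho]
  rcases eq_or_ne x 0 with rfl | hx
  · simp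
  have : 0 < ‖x‖ := norm_pos_iff.2 hx
  have h3 := Real.pi_gt_three
  rw [← div_eq_mul_inv, ← one_div, div_le_div_iff₀ (by positivity) (by positivity)]
  have h4 : 0 ≤ (1 + ‖x‖^2)^2 - ‖x‖^2*‖x‖^2 := by nlinarith [sq_nonneg ‖x‖]
  nlinarith [sq_nonneg (1 + ‖x‖^2)]

variable [CompleteSpace V]

lemma dbar_comp_sub {g : ℂ → V} (hg : ContDiff ℝ 1 g) (z : ℂ) : ∀ w h,
    fderiv ℝ (fun w => g (z - w)) w h = - fderiv ℝ g (z - w) h := by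
  intro w h
  have h1 : HasFDerivAt (fun w : ℂ => z - w) (-ContinuousLinearMap.id ℝ ℂ) w := (hasFDerivAt_id w).const_sub z
  have h2 := ((hg.differentiable one_ne_zero (z - w)).hasFDerivAt).comp w h1
  rw [show (fun w => g (z - w)) = g ∘ (fun w => z - w) from rfl, h2.fderiv]
  simp

lemma int_comb {a b : ℂ → V} (ha : Integrable a) (hb : Integrable b) :
    (1/2 : ℂ) • ((∫ w, a w) + I • ∫ w, b w) = ∫ w, (1/2 : ℂ) • (a w + I • b w) := by
  rw [integral_smul]
  congr 1
  rw [integral_add ha (hb.smul I : Integrable fun w => I • b w), integral_smul]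

/-- Cauchy–Pompeiu -/
lemma CT_dbar {g : ℂ → V} (hg : ContDiff ℝ 1 g) (h0 : ∀ w, 1 < ‖w‖ → g w = 0) (z : ℂ) :
    CT (dbar g) z = g z := by
  have hgc := hg.continuous_fderiv one_ne_zero
  have hdc : Continuous (dbar g) := by
    unfold dbar; 
    exact ((hgc.clm_apply continuous_const).add ((hgc.clm_apply continuous_const).const_smul I)).const_smul (1/2 : ℂ)
  have hd0 : ∀ w, 1 < ‖w‖ → dbar g w = 0 := by
    intro w hw; simp [dbar, fderiv_zero_of_zero h0 w hw]
  obtain ⟨m, hm⟩ := adm_of_cont hdc hd0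
  have hlim1 : Tendsto (fun c => ∫ w, kernR c w • dbar g (z - w)) atTop (𝓝 (CT (dbar g) z)) := by
    obtain ⟨_, h2, h3⟩ := hm.integrable_gen z measurable_kern fun _ => le_rfl
    refine tendsto_integral_filter_of_dominated_convergence _ ?_ ?_ h3 ?_
    · exact Eventually.of_forall fun c =>
        (hm.integrable_gen z (kernR_continuous c).measurable (kernR_bound c)).1.aestronglyMeasurable
    · exact Eventually.of_forall fun c => ae_of_all _ fun w =>
        (hm.integrable_gen z (kernR_continuous c).measurable (kernR_bound c)).2.1 w
    · exact ae_of_all _ fun w => (kernR_tendsto w).smul_const _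
  have hgz : ContDiff ℝ 1 (fun w => g (z - w)) := hg.comp (contDiff_const.sub contDiff_id)
  have hcs : HasCompactSupport (fun w => g (z - w)) :=
    HasCompactSupport.intro (isCompact_closedBall z 1) fun x hx => h0 _ (by
      rw [mem_closedBall, dist_eq_norm, not_le] at hx
      rwa [norm_sub_rev])
  have hlim2 : Tendsto (fun c : ℝ => ∫ w, (c ^ 2 * rho (c • w)) • g (z - w)) atTop (𝓝 (g z)) := by
    have := tendsto_integral_comp_smul_smul_of_integrable (μ := (volume : Measure ℂ)) rho_nonneg integral_rho rho_decay
      (hgz.continuous.integrable_of_hasCompactSupport hcs) hgz.continuous.continuousAt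
    simpa using this
  refine tendsto_nhds_unique hlim1 (hlim2.congr fun c => ?_)
  choose D hD1 hD2 using kernR_hasFDerivAt c
  have hDc : ∀ h, Continuous fun w => D w h := by
    intro h
    have : D = fderiv ℝ (kernR c) := by ext1 w; exact (hD1 w).fderiv.symm
    rw [this]
    exact ((kernR_contDiff c).continuous_fderiv one_ne_zero).clm_apply continuous_const
  have hI1 : ∀ h, Integrable (fun w => D w h • g (z - w)) := fun h =>
    ((hDc h).smul hgz.continuous).integrable_of_hasCompactSupport hcs.smul_left
  have hI2 : ∀ h, Integrable (fun w => kernR c w • fderiv ℝ (fun w => g (z - w)) w h) := fun h =>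
    ((kernR_continuous c).smul ((hgz.continuous_fderiv one_ne_zero).clm_apply
      continuous_const)).integrable_of_hasCompactSupport (hcs.fderiv_apply ℝ h).smul_left
  have ibp : ∀ h : ℂ, ∫ w, kernR c w • fderiv ℝ (fun w => g (z - w)) w h
      = - ∫ w, D w h • g (z - w) := by
    intro h
    refine integral_bilinear_hasFDerivAt_right_eq_neg_left_of_integrable
      (B := ContinuousLinearMap.lsmul ℝ ℂ) (f := kernR c) (f' := D) (g := fun w => g (z - w)) ?_ ?_ ?_
      (fun x _ => hD1 x) (fun x _ => (hgz.differentiable one_ne_zero x).hasFDerivAt)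
    · exact hI1 h
    · exact hI2 h
    · exact ((kernR_continuous c).smul hgz.continuous).integrable_of_hasCompactSupport hcs.smul_left
  have e1 : ∫ w, (c ^ 2 * rho (c • w)) • g (z - w) =
      (1/2 : ℂ) • ((∫ w, D w 1 • g (z - w)) + I • ∫ w, D w I • g (z - w)) := by
    rw [int_comb (hI1 1) (hI1 I)]
    refine integral_congr_ae (ae_of_all _ fun w => ?_)
    simp only
    rw [← smul_assoc I, ← add_smul, ← smul_assoc, smul_eq_mul, smul_eq_mul, hD2, coe_smul_tower]
  have e2 : ∫ w, kernR c w • dbar g (z - w) = -((1/2 : ℂ) •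
      ((∫ w, kernR c w • fderiv ℝ (fun w => g (z - w)) w 1) +
        I • ∫ w, kernR c w • fderiv ℝ (fun w => g (z - w)) w I)) := by
    rw [int_comb (hI2 1) (hI2 I), ← integral_neg]
    refine integral_congr_ae (ae_of_all _ fun w => ?_)
    simp only [dbar_comp_sub hg z, dbar]
    module
  rw [e1, e2, ibp, ibp]
  module

lemma dbar_continuous {g : ℂ → V} (hg : ContDiff ℝ 1 g) : Continuous (dbar g) := by
  have hgc := hg.continuous_fderiv one_ne_zero
  exact ((hgc.clm_apply continuous_const).add
    ((hgc.clm_apply continuous_const).const_smul I)).const_smul (1/2 : ℂ)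

lemma dbar_CT {g : ℂ → V} (hg : ContDiff ℝ 1 g) (h0 : ∀ w, 1 < ‖w‖ → g w = 0) (z : ℂ) :
    dbar (CT g) z = g z := by
  rw [← CT_dbar hg h0 z]
  have hgc := hg.continuous_fderiv one_ne_zero
  have hc : ∀ h, Continuous fun w => fderiv ℝ g w h := fun h => hgc.clm_apply continuous_const
  obtain ⟨m1, hm1⟩ := adm_of_cont (hc 1) (fun w hw => by rw [fderiv_zero_of_zero h0 w hw]; rfl)
  obtain ⟨m2, hm2⟩ := adm_of_cont (hc I) (fun w hw => by rw [fderiv_zero_of_zero h0 w hw]; rfl)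
  rw [dbar, fderiv_CT hg h0, fderiv_CT hg h0]
  simp only [CT]
  rw [int_comb (hm1.integrable z) (hm2.integrable z)]
  refine integral_congr_ae (ae_of_all _ fun w => ?_)
  simp only [dbar]
  module

/-- continuity of the Cauchy transform -/
lemma Adm.CT_continuous {g : ℂ → V} {m : ℝ} (h : Adm g m) : Continuous (CT g) := by
  have hswap : ∀ (k : ℂ → ℂ) z, ∫ w, k w • g (z - w) = ∫ w, k (z - w) • g w := by
    intro k z
    rw [← integral_sub_left_eq_self _ volume z]
    simp
  have hgi : Integrable g := by
    have : IntegrableOn (fun _ : ℂ => m) (closedBall 0 1) :=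
      integrableOn_const (isCompact_closedBall _ _).measure_lt_top.ne (by simp)
    refine (this.integrable_indicator measurableSet_closedBall).mono' h.1 (ae_of_all _ fun w => ?_)
    by_cases hw : w ∈ closedBall (0:ℂ) 1
    · rw [indicator_of_mem hw]; exact h.2.1 w
    · rw [indicator_of_notMem hw, h.2.2 w (by simpa using hw), norm_zero]
  have hcont : ∀ c, Continuous fun z => ∫ w, kernR c w • g (z - w) := by
    intro c
    simp_rw [hswap (kernR c)]
    obtain ⟨B, hB⟩ : ∃ B, ∀ w, ‖kernR c w‖ ≤ B := kernR_bdd c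
    refine continuous_of_dominated (bound := fun w => B * ‖g w‖) ?_ ?_ (hgi.norm.const_mul B) ?_
    · intro z
      exact (((kernR_continuous c).comp (continuous_const.sub continuous_id)).aestronglyMeasurable).smul h.1
    · intro z
      refine ae_of_all _ fun w => ?_
      rw [norm_smul]
      exact mul_le_mul_of_nonneg_right (hB _) (norm_nonneg _)
    · refine ae_of_all _ fun w => ?_
      exact ((kernR_continuous c).comp (continuous_id.sub continuous_const)).smul continuous_const
  have hloc : TendstoLocallyUniformly (fun c z => ∫ w, kernR c w • g (z - w)) (CT g) atTop := by
    rw [Metric.tendstoLocallyUniformly_iff]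
    intro ε hε z0
    have hK : Tendsto (fun c => ∫ w in closedBall z0 2, m * ‖kern w - kernR c w‖) atTop (𝓝 0) := by
      have hz : (0:ℝ) = ∫ w in closedBall z0 2, (0:ℝ) := by simp
      rw [hz]
      refine tendsto_integral_filter_of_dominated_convergence (fun w => m * (2 * ‖kern w‖)) ?_ ?_ ?_ ?_
      · exact Eventually.of_forall fun c => ((measurable_kern.sub (kernR_continuous c).measurable).norm.const_mul m).aestronglyMeasurable
      · refine Eventually.of_forall fun c => ae_of_all _ fun w => ?_
        rw [norm_mul, norm_norm, Real.norm_of_nonneg h.nonneg]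
        refine mul_le_mul_of_nonneg_left ?_ h.nonneg
        have := norm_sub_le (kern w) (kernR c w)
        have := kernR_bound c w
        linarith
      · exact ((locallyIntegrable_kern.integrableOn_isCompact (isCompact_closedBall _ _)).norm.const_mul 2).const_mul m
      · refine ae_of_all _ fun w => ?_
        have h1 : Tendsto (fun c => kern w - kernR c w) atTop (𝓝 (kern w - kern w)) :=
          tendsto_const_nhds.sub (kernR_tendsto w)
        simpa using h1.norm.const_mul m
    refine ⟨ball z0 1, ball_mem_nhds _ one_pos, ?_⟩
    filter_upwards [hK.eventually (gt_mem_nhds hε)] with c hc z hz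
    refine lt_of_le_of_lt ?_ hc
    have hk' := h.integrable_gen z (kernR_continuous c).measurable (kernR_bound c)
    rw [dist_eq_norm, CT, ← integral_sub (h.integrable z) hk'.1,
      ← integral_indicator measurableSet_closedBall]
    refine norm_integral_le_of_norm_le ?_ (ae_of_all _ fun w => ?_)
    · refine IntegrableOn.integrable_indicator (Integrable.const_mul (Integrable.norm (Integrable.sub ?_ ?_)) m) measurableSet_closedBall
      · exact (locallyIntegrable_kern.integrableOn_isCompact (isCompact_closedBall _ _))
      · exact (kernR_continuous c).continuousOn.integrableOn_compact (isCompact_closedBall _ _)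
    · rw [← sub_smul]
      by_cases hw : w ∈ closedBall z0 2
      · rw [indicator_of_mem hw, norm_smul, mul_comm m]
        exact mul_le_mul_of_nonneg_left (h.2.1 _) (norm_nonneg _)
      · rw [indicator_of_notMem hw, h.2.2 (z - w), smul_zero, norm_zero]
        rw [mem_closedBall, not_le] at hw
        rw [mem_ball] at hz
        have := dist_triangle w z z0
        rw [← dist_eq_norm, dist_comm]
        linarith
  exact hloc.continuous (Frequently.of_forall hcont)

end T
end RH

namespace RH
section Weak
variable {V : Type*} [NormedAddCommGroup V] [NormedSpace ℂ V] [NormedSpace ℝ V] [IsScalarTower ℝ ℂ V]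
variable {E F : Type*} [NormedAddCommGroup E] [NormedSpace ℝ E] [NormedAddCommGroup F] [NormedSpace ℝ F]

lemma slope_tendsto {f : ℂ → E} {f' : ℂ →L[ℝ] E} {w : ℂ} (hf : HasFDerivAt f f' w) (v : ℂ) :
    Tendsto (fun t : ℝ => t⁻¹ • (f (w + t • v) - f w)) (𝓝[≠] 0) (𝓝 (f' v)) :=
  (hf.hasLineDerivAt v).tendsto_slope_zero

lemma aesm_dir {f : ℂ → E} {f' : ℂ → ℂ →L[ℝ] E} (hf : ∀ w, HasFDerivAt f (f' w) w) (v : ℂ) :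
    StronglyMeasurable (fun w => f' w v) := by
  have hc : Continuous f := continuous_iff_continuousAt.2 fun w => (hf w).continuousAt
  refine stronglyMeasurable_of_tendsto (u := 𝓝[≠] (0:ℝ)) (f := fun t : ℝ => fun w => t⁻¹ • (f (w + t • v) - f w)) ?_ ?_
  · intro t
    exact (Continuous.const_smul ((hc.comp (continuous_id.add continuous_const)).sub hc) t⁻¹).stronglyMeasurable
  · rw [tendsto_pi_nhds]
    intro w
    exact slope_tendsto (hf w) v

lemma lip_of {f : ℂ → E} {f' : ℂ → ℂ →L[ℝ] E} (hf : ∀ w, HasFDerivAt f (f' w) w) {L : ℝ}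
    (hL : ∀ w, ‖f' w‖ ≤ L) (x y : ℂ) : ‖f y - f x‖ ≤ L * ‖y - x‖ :=
  convex_univ.norm_image_sub_le_of_norm_hasFDerivWithin_le (fun w _ => (hf w).hasFDerivWithinAt)
    (fun w _ => hL w) (mem_univ _) (mem_univ _)

lemma slope_bound {f : ℂ → E} {f' : ℂ → ℂ →L[ℝ] E} (hf : ∀ w, HasFDerivAt f (f' w) w) {L : ℝ}
    (hL : ∀ w, ‖f' w‖ ≤ L) (w v : ℂ) (t : ℝ) : ‖t⁻¹ • (f (w + t • v) - f w)‖ ≤ L * ‖v‖ := by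
  have hL0 : 0 ≤ L := (norm_nonneg _).trans (hL 0)
  rcases eq_or_ne t 0 with rfl | ht
  · simp; positivity
  rw [norm_smul, norm_inv]
  have h := lip_of hf hL w (w + t • v)
  rw [add_sub_cancel_left, norm_smul] at h
  have : 0 < ‖t‖ := norm_pos_iff.2 ht
  rw [inv_mul_le_iff₀ this]
  linarith

/-- weak symmetry of second derivatives -/
lemma weak_symm {f : ℂ → E} {f' : ℂ → ℂ →L[ℝ] E} (hf : ∀ w, HasFDerivAt f (f' w) w) {L : ℝ}
    (hL : ∀ w, ‖f' w‖ ≤ L) {Φ : ℂ → E →L[ℝ] F} {Φ' : ℂ → ℂ →L[ℝ] E →L[ℝ] F}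
    (hΦ : ∀ w, HasFDerivAt Φ (Φ' w) w) {M : ℝ} (hM : ∀ w, ‖Φ' w‖ ≤ M) {R : ℝ}
    (hs : ∀ w, R < ‖w‖ → Φ w = 0) :
    ∫ w, Φ' w I (f' w 1) = ∫ w, Φ' w 1 (f' w I) := by
  have hL0 : 0 ≤ L := (norm_nonneg _).trans (hL 0)
  have hM0 : 0 ≤ M := le_trans (norm_nonneg (Φ' 0)) (hM 0)
  have hfc : Continuous f := continuous_iff_continuousAt.2 fun w => (hf w).continuousAt
  have hΦc : Continuous Φ := continuous_iff_continuousAt.2 fun w => (hΦ w).continuousAt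
  -- the two difference quotient families
  let A : ℂ → ℂ → ℝ → ℂ → F := fun u v t w =>
    (t⁻¹ • (Φ (w + t • u) - Φ w)) (t⁻¹ • (f (w + t • v) - f w))
  have hlim : ∀ u v : ℂ, ‖u‖ ≤ 1 → ‖v‖ ≤ 1 → Tendsto (fun t => ∫ w, A u v t w) (𝓝[≠] 0) (𝓝 (∫ w, Φ' w u (f' w v))) := by
    intro u v hu hv
    refine tendsto_integral_filter_of_dominated_convergence
      ((closedBall (0:ℂ) (R + 1)).indicator fun _ => M * L) ?_ ?_ ?_ ?_
    · refine Eventually.of_forall fun t => Continuous.aestronglyMeasurable ?_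
      have h1 : Continuous fun w => t⁻¹ • (Φ (w + t • u) - Φ w) := by
        have h0 : Continuous fun w => Φ (w + t • u) := hΦc.comp (continuous_id.add continuous_const)
        exact (h0.sub hΦc).const_smul t⁻¹
      have h2 : Continuous fun w => t⁻¹ • (f (w + t • v) - f w) :=
        ((hfc.comp (continuous_id.add continuous_const)).sub hfc).const_smul _
      exact h1.clm_apply h2
    · have h1 : ∀ᶠ t : ℝ in 𝓝[≠] 0, |t| ≤ 1 := by
        refine nhdsWithin_le_nhds ?_
        filter_upwards [closedBall_mem_nhds (0:ℝ) one_pos] with t ht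
        simpa using ht
      filter_upwards [h1] with t ht
      refine ae_of_all _ fun w => ?_
      by_cases hw : w ∈ closedBall (0:ℂ) (R+1)
      · rw [indicator_of_mem hw]
        refine (ContinuousLinearMap.le_opNorm _ _).trans ?_
        have h2 := slope_bound hΦ hM w u t
        have h3 := slope_bound hf hL w v t
        refine mul_le_mul (h2.trans ?_) (h3.trans ?_) (norm_nonneg _) hM0
        · nlinarith
        · nlinarith
      · rw [indicator_of_notMem hw]
        have hw' : R + 1 < ‖w‖ := by simpa using hw
        have h4 : ‖t • u‖ ≤ 1 := by
          rw [norm_smul, Real.norm_eq_abs]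
          exact mul_le_one₀ ht (norm_nonneg _) hu
        have h5 : R < ‖w + t • u‖ := by
          have := norm_sub_le_norm_add w (t • u)
          linarith
        simp only [A, hs _ h5, hs w (by linarith)]
        simp
    · exact (integrableOn_const (isCompact_closedBall _ _).measure_lt_top.ne enorm_ne_top).integrable_indicator
        measurableSet_closedBall
    · refine ae_of_all _ fun w => ?_
      have h1 := slope_tendsto (hΦ w) u
      have h2 := slope_tendsto (hf w) v
      exact ((isBoundedBilinearMap_apply (𝕜 := ℝ) (E := E) (F := F)).continuous.tendsto
        (Φ' w u, f' w v)).comp (h1.prodMk_nhds h2)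
  have heq : ∀ t, ∫ w, A I 1 t w = ∫ w, A 1 I (-t) w := by
    intro t
    have hcs : HasCompactSupport Φ :=
      HasCompactSupport.intro (isCompact_closedBall (0:ℂ) R) fun x hx => hs x (by simpa using hx)
    have hinteg0 : ∀ b, Integrable fun w => Φ w (f (w + b)) := by
      intro b
      refine (hΦc.clm_apply (hfc.comp (continuous_id.add continuous_const))).integrable_of_hasCompactSupport ?_
      refine hcs.mono ?_
      intro w hw hw'
      apply hw
      simp [hw']
    have hinteg : ∀ a b, Integrable fun w => Φ (w + a) (f (w + b)) := by
      intro a b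
      have := (hinteg0 (b - a)).comp_add_right a
      refine this.congr (ae_of_all _ fun w => ?_)
      simp only
      congr 2
      ring
    have hval : ∀ a b, ∫ w, Φ (w + a) (f (w + b)) = ∫ w, Φ w (f (w + (b - a))) := by
      intro a b
      rw [← integral_add_right_eq_self (fun w => Φ w (f (w + (b - a)))) a]
      congr 1; ext w
      congr 2; ring
    have hexp : ∀ u v (t : ℝ), ∫ w, A u v t w = (t⁻¹ * t⁻¹) •
        ((∫ w, Φ w (f (w + (t • v - t • u)))) - (∫ w, Φ w (f (w + (0 - t • u)))) - (∫ w, Φ w (f (w + (t • v - 0))))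
          + ∫ w, Φ w (f (w + (0 - 0)))) := by
      intro u v t
      rw [← hval, ← hval, ← hval, ← hval, ← integral_sub (hinteg _ _) (hinteg _ _), ← integral_sub _ (hinteg _ _),
        ← integral_add _ (hinteg _ _), ← integral_smul]
      · congr 1; ext w
        simp only [A, smul_apply, map_smul, map_sub, sub_apply, add_zero]
        module
      · exact ((hinteg _ _).sub (hinteg _ _)).sub (hinteg _ _)
      · exact (hinteg _ _).sub (hinteg _ _)
    rw [hexp, hexp]
    have e1 : t • (1:ℂ) - t • I = -t • I - -t • 1 := by simp; ring
    have e2 : (0:ℂ) - t • I = -t • I - 0 := by simp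
    have e3 : t • (1:ℂ) - 0 = 0 - -t • 1 := by simp
    rw [e1, e2, e3]
    have e4 : t⁻¹ * t⁻¹ = (-t)⁻¹ * (-t)⁻¹ := by rw [inv_neg]; ring
    rw [e4]
    congr 1
    abel
  have hneg : Tendsto (fun t : ℝ => -t) (𝓝[≠] 0) (𝓝[≠] 0) := by
    refine tendsto_nhdsWithin_iff.2 ⟨?_, ?_⟩
    · have : Tendsto (fun t : ℝ => -t) (𝓝 0) (𝓝 (-0)) := tendsto_id.neg
      rw [neg_zero] at this
      exact this.mono_left nhdsWithin_le_nhds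
    · filter_upwards [self_mem_nhdsWithin] with t ht
      simpa using ht
  have h1 := hlim I 1 (by simp) (by simp)
  have h2 := (hlim 1 I (by simp) (by simp)).comp hneg
  exact tendsto_nhds_unique h1 (h2.congr fun t => (heq t).symm)

end Weak
end RH

namespace RH
section Adj
variable {V : Type*} [NormedAddCommGroup V] [NormedSpace ℂ V] [NormedSpace ℝ V] [IsScalarTower ℝ ℂ V]

lemma Adm.integrable_self {g : ℂ → V} {m : ℝ} (h : Adm g m) : Integrable g := by
  have h1 : g = (closedBall (0:ℂ) 1).indicator g := by
    ext w
    by_cases hw : w ∈ closedBall (0:ℂ) 1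
    · rw [indicator_of_mem hw]
    · rw [indicator_of_notMem hw, h.2.2 w (by simpa using hw)]
  rw [h1]
  refine IntegrableOn.integrable_indicator ?_ measurableSet_closedBall
  exact Measure.integrableOn_of_bounded (M := m) (isCompact_closedBall _ _).measure_lt_top.ne h.1
    (ae_of_all _ h.2.1)

lemma CT_adj [CompleteSpace V] {φ : ℂ → ℂ} {g : ℂ → V} {a b : ℝ} (hφ : Adm φ a) (hg : Adm g b) :
    ∫ z, CT φ z • g z = - ∫ z, φ z • CT g z := by
  let k2 : ℂ → ℂ := (closedBall (0:ℂ) 2).indicator kern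
  have hk2 : Integrable k2 := IntegrableOn.integrable_indicator
    (locallyIntegrable_kern.integrableOn_isCompact (isCompact_closedBall _ _)) measurableSet_closedBall
  have hI := Integrable.convolution_integrand (ContinuousLinearMap.mul ℂ ℂ) hφ.integrable_self hk2
  have hF : Integrable (fun p : ℂ × ℂ => (φ p.2 * kern (p.1 - p.2)) • g p.1) (volume.prod volume) := by
    have h1 : Integrable (fun p : ℂ × ℂ => (φ p.2 * k2 (p.1 - p.2)) • g p.1) (volume.prod volume) := by
      refine Integrable.mono (g := fun p : ℂ × ℂ => b * ‖φ p.2 * k2 (p.1 - p.2)‖) ((hI.norm).const_mul b) ?_ ?_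
      · exact hI.1.smul (hg.1.comp_fst)
      · refine ae_of_all _ fun p => ?_
        have h0 := hg.nonneg
        rw [norm_smul, Real.norm_of_nonneg (by positivity), mul_comm]
        exact mul_le_mul_of_nonneg_right (hg.2.1 _) (norm_nonneg _)
    refine h1.congr (ae_of_all _ fun p => ?_)
    simp only
    by_cases h2 : 1 < ‖p.1‖
    · rw [hg.2.2 _ h2]; simp
    by_cases h3 : 1 < ‖p.2‖
    · rw [hφ.2.2 _ h3]; simp
    have h4 : p.1 - p.2 ∈ closedBall (0:ℂ) 2 := by
      rw [mem_closedBall_zero_iff]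
      have := norm_sub_le p.1 p.2
      linarith
    simp only [k2, indicator_of_mem h4]
  have e1 : ∀ z, CT φ z • g z = ∫ y, (φ y * kern (z - y)) • g z := by
    intro z
    rw [integral_smul_const]
    congr 1
    unfold CT
    rw [← integral_sub_left_eq_self _ volume z]
    congr 1; ext y; simp [mul_comm]
  have e2 : ∀ y, φ y • CT g y = - ∫ z, (φ y * kern (z - y)) • g z := by
    intro y
    unfold CT
    rw [← integral_sub_left_eq_self (fun w => kern w • g (y - w)) volume y, ← integral_smul, ← integral_neg]
    congr 1; ext w
    rw [_root_.sub_sub_cancel]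
    rw [show y - w = -(w - y) by ring, kern_neg, smul_smul, mul_neg, neg_smul]
  simp_rw [e1, e2]
  rw [integral_neg, neg_neg]
  exact integral_integral_swap hF

end Adj
end RH

namespace RH
section AE
variable {E : Type*} [NormedAddCommGroup E] [NormedSpace ℝ E] [CompleteSpace E]

lemma ae_deriv {f : ℂ → E} {f' : ℂ → ℂ →L[ℝ] E} (hf : ∀ w, HasFDerivAt f (f' w) w) {L : ℝ}
    (hL : ∀ w, ‖f' w‖ ≤ L) {A : ℂ → E} {z0 v : ℂ} {r : ℝ} (hr : 0 < r)
    (hA : ∀ᵐ w, w ∈ ball z0 r → f' w v = A w) (hAc : ContinuousAt A z0) : f' z0 v = A z0 := by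
  have hL0 : 0 ≤ L := (norm_nonneg _).trans (hL 0)
  have hfc : Continuous f := continuous_iff_continuousAt.2 fun w => (hf w).continuousAt
  -- key estimate
  have key : ∀ ε > 0, ∃ ρ > 0, ∀ t : ℝ, |t| < ρ → ‖f (z0 + t • v) - f z0 - t • A z0‖ ≤ ε * |t| := by
    intro ε hε
    obtain ⟨ρ, hρ, hρA⟩ := Metric.continuousAt_iff.1 hAc ε hε
    set R := min ρ r with hR
    have hR0 : 0 < R := lt_min hρ hr
    have hv1 : 0 < ‖v‖ + 1 := by positivity
    refine ⟨R / 2 / (‖v‖ + 1), by positivity, fun t ht => ?_⟩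
    have hsv : ∀ s : ℝ, |s| ≤ |t| → ‖s • v‖ < R / 2 := by
      intro s hs
      rw [norm_smul, Real.norm_eq_abs]
      have : |s| < R / 2 / (‖v‖ + 1) := hs.trans_lt ht
      rw [lt_div_iff₀ hv1] at this
      nlinarith [abs_nonneg s]
    -- mollified estimate
    have moll : ∀ δ > 0, δ < R / 2 → ‖f (z0 + t • v) - f z0 - t • A z0‖ ≤ ε * |t| + 2 * L * δ := by
      intro δ hδ hδR
      let μ : Measure ℂ := volume.restrict (ball 0 δ)
      have : IsFiniteMeasure μ := ⟨by simp only [μ, Measure.restrict_apply_univ]; exact measure_ball_lt_top⟩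
      have hc : 0 < μ.real univ := by
        rw [measureReal_def, ENNReal.toReal_pos_iff]
        simp only [μ, Measure.restrict_apply_univ]
        exact ⟨measure_ball_pos _ _ hδ, measure_ball_lt_top⟩
      have hbm : ∀ g : ℂ → E, AEStronglyMeasurable g μ → ∀ B, (∀ w ∈ ball (0:ℂ) δ, ‖g w‖ ≤ B) → Integrable g μ := by
        intro g hg B hB
        refine Integrable.mono' (integrable_const B) hg ?_
        exact (ae_restrict_iff' measurableSet_ball).2 (ae_of_all _ hB)
      have hInt : ∀ s : ℝ, Integrable (fun w => f (z0 + s • v + w)) μ := by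
        intro s
        have h1 : Continuous fun w => f (z0 + s • v + w) := hfc.comp (continuous_const.add continuous_id)
        exact (h1.continuousOn.integrableOn_compact (isCompact_closedBall (0:ℂ) δ)).mono_set ball_subset_closedBall
      have hmeas : ∀ s : ℝ, StronglyMeasurable (fun w => f' (z0 + s • v + w) v) := fun s =>
        (aesm_dir hf v).comp_measurable (measurable_const.add measurable_id)
      let F : ℝ → E := fun s => ∫ w, f (z0 + s • v + w) ∂μ
      have hF : ∀ s, HasDerivAt F (∫ w, f' (z0 + s • v + w) v ∂μ) s := by
        intro s
        refine (hasDerivAt_integral_of_dominated_loc_of_deriv_le (μ := μ) (bound := fun _ => L * ‖v‖)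
          (F := fun s w => f (z0 + s • v + w)) (F' := fun s w => f' (z0 + s • v + w) v)
          (s := univ) Filter.univ_mem ?_ (hInt s) (hmeas s).aestronglyMeasurable ?_ (integrable_const _) ?_).2
        · exact Eventually.of_forall fun s => (hInt s).1
        · exact ae_of_all _ fun w s _ => ((f' _).le_opNorm v).trans (by gcongr; exact hL _)
        · refine ae_of_all _ fun w s _ => ?_
          have h1 : HasDerivAt (fun s : ℝ => z0 + s • v + w) v s := by
            have := (((hasDerivAt_id s).smul_const v).const_add z0).add_const w
            simpa using this
          exact (hf _).comp_hasDerivAt s h1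
      have hAe : ∀ s : ℝ, |s| ≤ |t| → ∀ᵐ w ∂μ, ‖f' (z0 + s • v + w) v - A z0‖ ≤ ε := by
        intro s hs
        have h1 : ∀ᵐ w, z0 + s • v + w ∈ ball z0 r → f' (z0 + s • v + w) v = A (z0 + s • v + w) :=
          (quasiMeasurePreserving_add_left volume (z0 + s • v)).ae hA
        refine (ae_restrict_iff' measurableSet_ball).2 ?_
        filter_upwards [h1] with w hw hwδ
        have h2 : dist (z0 + s • v + w) z0 < R := by
          rw [dist_eq_norm, show z0 + s • v + w - z0 = s • v + w by ring]
          have := hsv s hs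
          have h3 : ‖w‖ < δ := by simpa using hwδ
          linarith [norm_add_le (s • v) w]
        rw [hw (h2.trans_le (min_le_right _ _)), ← dist_eq_norm]
        exact (hρA (h2.trans_le (min_le_left _ _))).le
      have hder : ∀ s : ℝ, |s| ≤ |t| → ‖(∫ w, f' (z0 + s • v + w) v ∂μ) - μ.real univ • A z0‖ ≤ ε * μ.real univ := by
        intro s hs
        have h1 : Integrable (fun w => f' (z0 + s • v + w) v) μ :=
          hbm _ (hmeas s).aestronglyMeasurable (L * ‖v‖) fun w _ => ((f' _).le_opNorm v).trans (by gcongr; exact hL _)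
        rw [← integral_const, ← integral_sub h1 (integrable_const _)]
        exact norm_integral_le_of_norm_le_const (hAe s hs)
      have hG : ‖(F t - t • (μ.real univ • A z0)) - (F 0 - (0:ℝ) • (μ.real univ • A z0))‖ ≤ ε * μ.real univ * ‖t - 0‖ := by
        refine Convex.norm_image_sub_le_of_norm_hasDerivWithin_le (s := closedBall (0:ℝ) |t|)
          (f := fun s => F s - s • (μ.real univ • A z0))
          (f' := fun s => (∫ w, f' (z0 + s • v + w) v ∂μ) - μ.real univ • A z0) ?_ ?_ (convex_closedBall _ _) ?_ ?_
        · intro s _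
          refine HasDerivAt.hasDerivWithinAt ?_
          have := (hF s).fun_sub ((hasDerivAt_id s).smul_const (μ.real univ • A z0))
          simpa using this
        · intro s hs
          exact hder s (by simpa using hs)
        · simp
        · simp
      have hap : ∀ s : ℝ, ‖F s - μ.real univ • f (z0 + s • v)‖ ≤ L * δ * μ.real univ := by
        intro s
        rw [← integral_const, ← integral_sub (hInt s) (integrable_const _)]
        refine norm_integral_le_of_norm_le_const ?_
        refine (ae_restrict_iff' measurableSet_ball).2 (ae_of_all _ fun w hw => ?_)
        refine (lip_of hf hL (z0 + s • v) (z0 + s • v + w)).trans ?_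
        rw [add_sub_cancel_left]
        have h3 : ‖w‖ < δ := by simpa using hw
        gcongr
      have h1 := hap t
      have h2 := hap 0
      rw [zero_smul, add_zero] at h2
      rw [zero_smul, sub_zero, sub_zero, Real.norm_eq_abs] at hG
      set c := μ.real univ
      have h3 : c * ‖f (z0 + t • v) - f z0 - t • A z0‖ ≤ c * (ε * |t| + 2 * L * δ) := by
        calc c * ‖f (z0 + t • v) - f z0 - t • A z0‖ = ‖c • (f (z0 + t • v) - f z0 - t • A z0)‖ := by
              rw [norm_smul, Real.norm_of_nonneg hc.le]
          _ = ‖(F t - t • c • A z0 - F 0) - (F t - c • f (z0 + t • v)) + (F 0 - c • f z0)‖ := by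
              congr 1; module
          _ ≤ ‖F t - t • c • A z0 - F 0‖ + ‖F t - c • f (z0 + t • v)‖ + ‖F 0 - c • f z0‖ :=
              (norm_add_le _ _).trans (add_le_add (norm_sub_le _ _) le_rfl)
          _ ≤ ε * c * |t| + L * δ * c + L * δ * c := by gcongr
          _ = _ := by ring
      exact le_of_mul_le_mul_left h3 hc
    have hlim : Tendsto (fun δ : ℝ => ε * |t| + 2 * L * δ) (𝓝[>] 0) (𝓝 (ε * |t| + 2 * L * 0)) := by
      refine Tendsto.mono_left ?_ nhdsWithin_le_nhds
      exact Continuous.tendsto (by fun_prop) 0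
    rw [mul_zero, add_zero] at hlim
    refine ge_of_tendsto hlim ?_
    filter_upwards [Ioo_mem_nhdsGT (show (0:ℝ) < R / 2 by positivity)] with δ hδ using moll δ hδ.1 hδ.2
  -- conclude
  have hT := slope_tendsto (hf z0) v
  refine tendsto_nhds_unique hT ?_
  rw [Metric.tendsto_nhdsWithin_nhds]
  intro ε hε
  obtain ⟨ρ, hρ, h⟩ := key (ε / 2) (by positivity)
  refine ⟨ρ, hρ, fun {t} ht htd => ?_⟩
  have ht0 : t ≠ 0 := ht
  have h1 := h t (by simpa using htd)
  rw [dist_eq_norm]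
  have h2 : t⁻¹ • (f (z0 + t • v) - f z0) - A z0 = t⁻¹ • (f (z0 + t • v) - f z0 - t • A z0) := by
    rw [smul_sub t⁻¹ _ (t • A z0), smul_smul, inv_mul_cancel₀ ht0, one_smul]
  rw [h2, norm_smul, norm_inv, Real.norm_eq_abs, inv_mul_lt_iff₀ (abs_pos.2 ht0)]
  have := abs_pos.2 ht0
  nlinarith

end AE
end RH

open scoped ContDiff
namespace RH
section Chart
variable {V : Type*} [NormedAddCommGroup V] [NormedSpace ℂ V] [NormedSpace ℝ V] [IsScalarTower ℝ ℂ V]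

/-- `h ↦ h • w` -/
noncomputable def mw (w : V) : ℂ →L[ℝ] V := (ContinuousLinearMap.lsmul ℝ ℂ).flip w

@[simp] lemma mw_apply (w : V) (h : ℂ) : mw w h = h • w := rfl

lemma norm_mw_le (w : V) : ‖mw w‖ ≤ ‖w‖ :=
  ContinuousLinearMap.opNorm_le_bound _ (norm_nonneg _) fun h => by
    rw [mw_apply, norm_smul, mul_comm]

/-- charts with a frame trivialising the complex structure -/
structure IsChart (p : V) (δ C : ℝ) (P Q : V → V →L[ℝ] V) : Prop where
  pos : 0 < δ
  Cpos : 1 ≤ C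
  smP : ContDiffOn ℝ ∞ P (ball p δ)
  smQ : ContDiffOn ℝ ∞ Q (ball p δ)
  PQ : ∀ x ∈ ball p δ, ∀ w, P x (Q x w) = w
  QP : ∀ x ∈ ball p δ, ∀ w, Q x (P x w) = w
  bP : ∀ x ∈ ball p δ, ‖P x‖ ≤ C
  bQ : ∀ x ∈ ball p δ, ‖Q x‖ ≤ C
  bP' : ∀ x ∈ ball p δ, ‖fderiv ℝ P x‖ ≤ C
  bQ' : ∀ x ∈ ball p δ, ‖fderiv ℝ Q x‖ ≤ C

/-- the quadratic nonlinearity -/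
noncomputable def NN (P Q : V → V →L[ℝ] V) (x w : V) : V :=
  (I / 2 : ℂ) • ((fderiv ℝ Q x (P x (I • w))) (P x w) - (fderiv ℝ Q x (P x w)) (P x (I • w)))

/-- pseudoholomorphic, in the frame -/
def PHol (P : V → V →L[ℝ] V) (f W : ℂ → V) (s : Set ℂ) : Prop :=
  ∀ ζ ∈ s, HasFDerivAt f ((P (f ζ)).comp (mw (W ζ))) ζ

variable {p : V} {δ C : ℝ} {P Q : V → V →L[ℝ] V}

lemma IsChart.hasP (h : IsChart p δ C P Q) {x : V} (hx : x ∈ ball p δ) : HasFDerivAt P (fderiv ℝ P x) x :=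
  ((h.smP.contDiffAt (isOpen_ball.mem_nhds hx)).differentiableAt (by simp)).hasFDerivAt

lemma IsChart.hasQ (h : IsChart p δ C P Q) {x : V} (hx : x ∈ ball p δ) : HasFDerivAt Q (fderiv ℝ Q x) x :=
  ((h.smQ.contDiffAt (isOpen_ball.mem_nhds hx)).differentiableAt (by simp)).hasFDerivAt

lemma IsChart.NN_le (h : IsChart p δ C P Q) {x : V} (hx : x ∈ ball p δ) (w : V) :
    ‖NN P Q x w‖ ≤ C ^ 3 * ‖w‖ ^ 2 := by
  have hC : 0 ≤ C := by linarith [h.Cpos]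
  have hw : ∀ w, ‖P x w‖ ≤ C * ‖w‖ := fun w => ((P x).le_opNorm w).trans (by gcongr; exact h.bP x hx)
  have hb : ∀ a b : V, ‖a‖ ≤ C * ‖w‖ → ‖b‖ ≤ C * ‖w‖ → ‖(fderiv ℝ Q x a) b‖ ≤ C ^ 3 * ‖w‖^2 := by
    intro a b ha hb
    calc ‖(fderiv ℝ Q x a) b‖ ≤ ‖fderiv ℝ Q x a‖ * ‖b‖ := ContinuousLinearMap.le_opNorm _ _
      _ ≤ (‖fderiv ℝ Q x‖ * ‖a‖) * ‖b‖ := by gcongr; exact ContinuousLinearMap.le_opNorm _ _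
      _ ≤ (C * (C * ‖w‖)) * (C * ‖w‖) := by gcongr; exact h.bQ' x hx
      _ = _ := by ring
  have hI : ‖P x (I • w)‖ ≤ C * ‖w‖ := by simpa [norm_smul] using hw (I • w)
  rw [NN, norm_smul]
  have h1 := hb _ _ hI (hw w)
  have h2 := hb _ _ (hw w) hI
  have h3 := norm_sub_le ((fderiv ℝ Q x (P x (I • w))) (P x w)) ((fderiv ℝ Q x (P x w)) (P x (I • w)))
  have h4 : ‖(I / 2 : ℂ)‖ = 1/2 := by simp
  rw [h4]; linarith

noncomputable def bmp (a b : ℝ) (ha : 0 < a) (hab : a < b) : ContDiffBump (0:ℂ) := ⟨a, b, ha, hab⟩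

/-- the weak identity together with measurability -/
lemma wk (h : IsChart p δ C P Q) {f W : ℂ → V} (hf : PHol P f W (ball 0 1))
    (hfm : ∀ z ∈ ball (0:ℂ) 1, f z ∈ ball p δ) {M : ℝ} (hM : ∀ z ∈ ball (0:ℂ) 1, ‖W z‖ ≤ M)
    {c : ℂ → ℂ} (hc : ContDiff ℝ 1 c) (hc0 : ∀ w, 3/4 < ‖w‖ → c w = 0) :
    AEStronglyMeasurable (fun w => dbar c w • W w + c w • NN P Q (f w) (W w)) ∧
    ∫ w, (dbar c w • W w + c w • NN P Q (f w) (W w)) = 0 := by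
  have hC0 : 0 ≤ C := by linarith [h.Cpos]
  have hM0 : 0 ≤ M := (norm_nonneg _).trans (hM 0 (by simp))
  let χ : ContDiffBump (0:ℂ) := ⟨4/5, 9/10, by norm_num, by norm_num⟩
  let ft : ℂ → V := fun w => χ w • f w
  -- derivative of ft
  let ft' : ℂ → ℂ →L[ℝ] V := fun w => fderiv ℝ ft w
  have hχd : ∀ w, HasFDerivAt (⇑χ) (fderiv ℝ (⇑χ) w) w := fun w =>
    ((χ.contDiff (n := 1)).differentiable one_ne_zero w).hasFDerivAt
  have hft1 : ∀ w ∈ ball (0:ℂ) 1, HasFDerivAt ft ((χ w : ℝ) • ((P (f w)).comp (mw (W w))) + (fderiv ℝ (⇑χ) w).smulRight (f w)) w :=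
    fun w hw => HasFDerivAt.fun_smul (hχd w) (hf w hw)
  have hft2 : ∀ w, 9/10 < ‖w‖ → HasFDerivAt ft (0 : ℂ →L[ℝ] V) w := by
    intro w hw
    refine (hasFDerivAt_const (0:V) w).congr_of_eventuallyEq ?_
    filter_upwards [(isOpen_lt continuous_const continuous_norm).mem_nhds hw] with y hy
    simp only [ft]
    rw [χ.zero_of_le_dist (by simpa using (show (9/10:ℝ) < ‖y‖ from hy).le), zero_smul]
  have hftd : ∀ w, HasFDerivAt ft (ft' w) w := by
    intro w
    rcases lt_or_ge ‖w‖ 1 with hw | hw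
    · exact (hft1 w (by simpa using hw)).differentiableAt.hasFDerivAt
    · exact (hft2 w (by linarith)).differentiableAt.hasFDerivAt
  obtain ⟨K, hK⟩ : ∃ K, ∀ w, ‖fderiv ℝ (⇑χ) w‖ ≤ K :=
    (χ.hasCompactSupport.fderiv ℝ).exists_bound_of_continuous ((χ.contDiff (n := 1)).continuous_fderiv one_ne_zero)
  have hPW : ∀ w ∈ ball (0:ℂ) 1, ‖(P (f w)).comp (mw (W w))‖ ≤ C * M := fun w hw =>
    (ContinuousLinearMap.opNorm_comp_le _ _).trans
      (mul_le_mul (h.bP _ (hfm w hw)) ((norm_mw_le _).trans (hM w hw)) (norm_nonneg _) hC0)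
  have hft'b : ∀ w, ‖ft' w‖ ≤ C * M + K * (‖p‖ + δ) := by
    intro w
    have hK0 : 0 ≤ K := (norm_nonneg _).trans (hK 0)
    have hp : 0 ≤ ‖p‖ + δ := by linarith [norm_nonneg p, h.pos]
    rcases lt_or_ge ‖w‖ 1 with hw | hw
    · have hw' : w ∈ ball (0:ℂ) 1 := by simpa using hw
      simp only [ft', (hft1 w hw').fderiv]
      refine (norm_add_le _ _).trans (add_le_add ?_ ?_)
      · rw [norm_smul, Real.norm_of_nonneg χ.nonneg]
        exact (mul_le_of_le_one_left (norm_nonneg _) χ.le_one).trans (hPW w hw')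
      · rw [ContinuousLinearMap.norm_smulRight_apply]
        have : ‖f w‖ ≤ ‖p‖ + δ := by
          have h1 := hfm w hw'
          rw [mem_ball, dist_eq_norm] at h1
          have := norm_add_le p (f w - p)
          rw [add_sub_cancel] at this
          linarith
        exact mul_le_mul (hK w) this (norm_nonneg _) hK0
    · simp only [ft', (hft2 w (by linarith)).fderiv, norm_zero]
      positivity
  -- Φ
  let Φ : ℂ → V →L[ℝ] V := fun w => c w • Q (f w)
  have hcd : ∀ w, HasFDerivAt c (fderiv ℝ c w) w := fun w => (hc.differentiable one_ne_zero w).hasFDerivAt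
  have hQf : ∀ w ∈ ball (0:ℂ) 1, HasFDerivAt (fun w => Q (f w)) ((fderiv ℝ Q (f w)).comp ((P (f w)).comp (mw (W w)))) w :=
    fun w hw => (h.hasQ (hfm w hw)).comp w (hf w hw)
  have hΦ1 : ∀ w ∈ ball (0:ℂ) 1, HasFDerivAt Φ (c w • ((fderiv ℝ Q (f w)).comp ((P (f w)).comp (mw (W w))))
      + (fderiv ℝ c w).smulRight (Q (f w))) w := fun w hw => HasFDerivAt.fun_smul (𝕜' := ℂ) (hcd w) (hQf w hw)
  have hΦ2 : ∀ w, 3/4 < ‖w‖ → HasFDerivAt Φ (0 : ℂ →L[ℝ] V →L[ℝ] V) w := by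
    intro w hw
    refine (hasFDerivAt_const (0:V →L[ℝ] V) w).congr_of_eventuallyEq ?_
    filter_upwards [(isOpen_lt continuous_const continuous_norm).mem_nhds hw] with y hy
    simp only [Φ]
    rw [hc0 y hy, zero_smul]
  let Φ' : ℂ → ℂ →L[ℝ] V →L[ℝ] V := fun w => fderiv ℝ Φ w
  have hΦd : ∀ w, HasFDerivAt Φ (Φ' w) w := by
    intro w
    rcases lt_or_ge ‖w‖ 1 with hw | hw
    · exact (hΦ1 w (by simpa using hw)).differentiableAt.hasFDerivAt
    · exact (hΦ2 w (by linarith)).differentiableAt.hasFDerivAt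
  have hcs : HasCompactSupport c := hcs_of_zero fun w hw => hc0 w (by linarith)
  obtain ⟨K1, hK1⟩ : ∃ K, ∀ w, ‖c w‖ ≤ K := hcs.exists_bound_of_continuous hc.continuous
  obtain ⟨K2, hK2⟩ : ∃ K, ∀ w, ‖fderiv ℝ c w‖ ≤ K :=
    (hcs.fderiv ℝ).exists_bound_of_continuous (hc.continuous_fderiv one_ne_zero)
  have hK10 : 0 ≤ K1 := (norm_nonneg _).trans (hK1 0)
  have hK20 : 0 ≤ K2 := (norm_nonneg _).trans (hK2 0)
  have hΦb : ∀ w, ‖Φ' w‖ ≤ K1 * (C * (C * M)) + K2 * C := by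
    intro w
    rcases lt_or_ge ‖w‖ 1 with hw | hw
    · have hw' : w ∈ ball (0:ℂ) 1 := by simpa using hw
      have e2 : Φ' w = _ := (hΦ1 w hw').fderiv
      rw [e2]
      refine ContinuousLinearMap.opNorm_add_le _ _ |>.trans (add_le_add ?_ ?_)
      · rw [norm_smul]
        refine mul_le_mul (hK1 w) ?_ (norm_nonneg _) hK10
        exact (ContinuousLinearMap.opNorm_comp_le _ _).trans
          (mul_le_mul (h.bQ' _ (hfm w hw')) (hPW w hw') (norm_nonneg _) hC0)
      · refine ContinuousLinearMap.opNorm_le_bound _ (by positivity) fun u => ?_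
        rw [ContinuousLinearMap.smulRight_apply, norm_smul]
        calc ‖fderiv ℝ c w u‖ * ‖Q (f w)‖ ≤ (K2 * ‖u‖) * C := by
              gcongr
              · exact (ContinuousLinearMap.le_opNorm _ _).trans (by gcongr; exact hK2 w)
              · exact h.bQ _ (hfm w hw')
          _ = _ := by ring
    · have e2 : Φ' w = 0 := (hΦ2 w (by linarith)).fderiv
      have e3 : ‖(0 : ℂ →L[ℝ] V →L[ℝ] V)‖ = 0 := ContinuousLinearMap.opNorm_zero
      rw [e2, e3]; positivity
  -- pointwise identity
  have hpt : ∀ w, dbar c w • W w + c w • NN P Q (f w) (W w) =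
      (I / 2 : ℂ) • (Φ' w I (ft' w 1) - Φ' w 1 (ft' w I)) := by
    intro w
    rcases le_or_gt ‖w‖ (3/4) with hw | hw
    · have hw' : w ∈ ball (0:ℂ) 1 := by simp; linarith
      have e1 : ft' w = (P (f w)).comp (mw (W w)) := by
        have : ft =ᶠ[𝓝 w] f := by
          have : ball (0:ℂ) (4/5) ∈ 𝓝 w := isOpen_ball.mem_nhds (by simp; linarith)
          filter_upwards [this] with y hy
          simp only [ft]
          rw [χ.one_of_mem_closedBall (ball_subset_closedBall hy), one_smul]
        exact ((hf w hw').congr_of_eventuallyEq this).fderiv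
      have e2 : Φ' w = _ := (hΦ1 w hw').fderiv
      rw [e1, e2]
      simp only [add_apply, smul_apply, ContinuousLinearMap.smulRight_apply, ContinuousLinearMap.comp_apply,
        mw_apply, h.QP _ (hfm w hw'), NN, dbar, one_smul, smul_eq_mul]
      linear_combination (norm := module) (((1/2 : ℂ) * fderiv ℝ c w 1)) • I_mul_I • W w
    · have e2 : Φ' w = 0 := (hΦ2 w hw).fderiv
      have e3 : fderiv ℝ c w = 0 := by
        have : c =ᶠ[𝓝 w] fun _ => 0 := by
          filter_upwards [(isOpen_lt continuous_const continuous_norm).mem_nhds hw] with y hy using hc0 y hy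
        rw [this.fderiv_eq]; simp
      rw [e2, hc0 w hw]
      simp [dbar, e3]
  simp_rw [hpt]
  have hm : ∀ u v, AEStronglyMeasurable (fun w => Φ' w u (ft' w v)) := fun u v =>
    (isBoundedBilinearMap_apply (𝕜 := ℝ) (E := V) (F := V)).continuous.comp_aestronglyMeasurable
      ((aesm_dir hΦd u).aestronglyMeasurable.prodMk (aesm_dir hftd v).aestronglyMeasurable)
  have hi : ∀ u v, Integrable (fun w => Φ' w u (ft' w v)) := by
    intro u v
    have h1 : (fun w => Φ' w u (ft' w v)) = (closedBall (0:ℂ) 1).indicator (fun w => Φ' w u (ft' w v)) := by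
      ext w
      by_cases hw : w ∈ closedBall (0:ℂ) 1
      · rw [indicator_of_mem hw]
      · rw [indicator_of_notMem hw]
        have hw1 : 1 < ‖w‖ := by simpa using hw
        have e2 : Φ' w = 0 := (hΦ2 w (by linarith)).fderiv
        rw [e2]; simp
    rw [h1]
    refine IntegrableOn.integrable_indicator ?_ measurableSet_closedBall
    refine Measure.integrableOn_of_bounded (M := ((K1 * (C * (C * M)) + K2 * C) * ‖u‖) * ((C * M + K * (‖p‖ + δ)) * ‖v‖))
      (isCompact_closedBall _ _).measure_lt_top.ne (hm u v) (ae_of_all _ fun w => ?_)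
    have hb0 : 0 ≤ K1 * (C * (C * M)) + K2 * C := by positivity
    refine (ContinuousLinearMap.le_opNorm _ _).trans (mul_le_mul ?_ ?_ (norm_nonneg _) (by positivity))
    · exact (ContinuousLinearMap.le_opNorm _ _).trans (mul_le_mul_of_nonneg_right (hΦb w) (norm_nonneg _))
    · exact (ContinuousLinearMap.le_opNorm _ _).trans (mul_le_mul_of_nonneg_right (hft'b w) (norm_nonneg _))
  refine ⟨((hm I 1).sub (hm 1 I)).const_smul (I/2 : ℂ), ?_⟩
  rw [integral_smul, integral_sub (hi _ _) (hi _ _),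
    weak_symm hftd hft'b hΦd hΦb (R := 3/4) (fun w hw => by simp only [Φ]; rw [hc0 w hw, zero_smul]), sub_self, smul_zero]

end Chart
end RH

open scoped ContDiff
namespace RH
section Rep

noncomputable def chiB : ContDiffBump (0:ℂ) := ⟨1/2, 3/4, by norm_num, by norm_num⟩
/-- cutoff -/
noncomputable def chi (w : ℂ) : ℂ := ((chiB w : ℝ) : ℂ)

lemma chi_contDiff : ContDiff ℝ 1 chi := Complex.ofRealCLM.contDiff.comp chiB.contDiff
lemma chi_one {w : ℂ} (hw : ‖w‖ ≤ 1/2) : chi w = 1 := by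
  rw [chi, chiB.one_of_mem_closedBall (by simpa [chiB] using hw)]; simp
lemma chi_zero {w : ℂ} (hw : 3/4 ≤ ‖w‖) : chi w = 0 := by
  rw [chi, chiB.zero_of_le_dist (by simpa [chiB] using hw)]; simp
lemma chi_le (w : ℂ) : ‖chi w‖ ≤ 1 := by
  rw [chi, Complex.norm_real, Real.norm_of_nonneg chiB.nonneg]; exact chiB.le_one
lemma dbar_chi_zero {w : ℂ} (hw : 3/4 < ‖w‖) : dbar chi w = 0 := by
  have : chi =ᶠ[𝓝 w] fun _ => 0 := by
    filter_upwards [(isOpen_lt continuous_const continuous_norm).mem_nhds hw] with y hy using chi_zero (le_of_lt hy)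
  rw [dbar, this.fderiv_eq]; simp
lemma chi_K : ∃ K, 0 ≤ K ∧ ∀ w, ‖dbar chi w‖ ≤ K := by
  have hcs : HasCompactSupport (dbar chi) := hcs_of_zero fun w hw => dbar_chi_zero (by linarith)
  obtain ⟨K, hK⟩ := hcs.exists_bound_of_continuous (dbar_continuous chi_contDiff)
  exact ⟨K, (norm_nonneg _).trans (hK 0), hK⟩
noncomputable def Kchi : ℝ := chi_K.choose
lemma Kchi_nonneg : 0 ≤ Kchi := chi_K.choose_spec.1
lemma dbar_chi_le (w : ℂ) : ‖dbar chi w‖ ≤ Kchi := chi_K.choose_spec.2 w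

lemma dbar_mul {a b : ℂ → ℂ} (ha : ContDiff ℝ 1 a) (hb : ContDiff ℝ 1 b) (w : ℂ) :
    dbar (fun w => a w * b w) w = b w * dbar a w + a w * dbar b w := by
  have h := ((ha.differentiable one_ne_zero w).hasFDerivAt.fun_mul (hb.differentiable one_ne_zero w).hasFDerivAt).fderiv
  simp only [dbar, h, add_apply, smul_apply, smul_eq_mul]
  ring

lemma dbar_conj (w : ℂ) : dbar (fun w => (starRingEnd ℂ) w) w = 1 := by
  have : fderiv ℝ (fun w => (starRingEnd ℂ) w) w = (Complex.conjCLE : ℂ →L[ℝ] ℂ) := Complex.conjCLE.hasFDerivAt.fderiv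
  rw [dbar, this]
  simp
  norm_num

variable {V : Type*} [NormedAddCommGroup V] [NormedSpace ℂ V] [NormedSpace ℝ V] [IsScalarTower ℝ ℂ V]
variable {p : V} {δ C : ℝ} {P Q : V → V →L[ℝ] V}

noncomputable def g1 (P Q : V → V →L[ℝ] V) (f W : ℂ → V) (w : ℂ) : V :=
  dbar chi w • W w + chi w • NN P Q (f w) (W w)

lemma g1_bound (h : IsChart p δ C P Q) {f W : ℂ → V} 
    (hfm : ∀ z ∈ ball (0:ℂ) 1, f z ∈ ball p δ) {M : ℝ} (hM : ∀ z ∈ ball (0:ℂ) 1, ‖W z‖ ≤ M) (w : ℂ) :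
    ‖g1 P Q f W w‖ ≤ Kchi * M + C ^ 3 * M ^ 2 := by
  have hM0 : 0 ≤ M := (norm_nonneg _).trans (hM 0 (by simp))
  have hC0 : 0 ≤ C := by linarith [h.Cpos]
  have hK := Kchi_nonneg
  rcases lt_or_ge ‖w‖ 1 with hw | hw
  · have hw' : w ∈ ball (0:ℂ) 1 := by simpa using hw
    refine (norm_add_le _ _).trans (add_le_add ?_ ?_)
    · rw [norm_smul]
      exact mul_le_mul (dbar_chi_le w) (hM w hw') (norm_nonneg _) hK
    · rw [norm_smul]
      refine (mul_le_of_le_one_left (norm_nonneg _) (chi_le w)).trans ((h.NN_le (hfm w hw') _).trans ?_)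
      gcongr
      exact hM w hw'
  · rw [g1, dbar_chi_zero (by linarith), chi_zero (by linarith)]
    simp; positivity

lemma g1_zero (P Q : V → V →L[ℝ] V) (f W : ℂ → V) {w : ℂ} (hw : 3/4 < ‖w‖) : g1 P Q f W w = 0 := by
  rw [g1, dbar_chi_zero hw, chi_zero hw.le]; simp

lemma g1_adm (h : IsChart p δ C P Q) {f W : ℂ → V} (hf : PHol P f W (ball 0 1))
    (hfm : ∀ z ∈ ball (0:ℂ) 1, f z ∈ ball p δ) {M : ℝ} (hM : ∀ z ∈ ball (0:ℂ) 1, ‖W z‖ ≤ M) :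
    Adm (g1 P Q f W) (Kchi * M + C ^ 3 * M ^ 2) :=
  ⟨(wk h hf hfm hM chi_contDiff fun w hw => chi_zero hw.le).1, g1_bound h hfm hM,
    fun w hw => g1_zero P Q f W (by linarith)⟩

lemma chiW_adm (h : IsChart p δ C P Q) {f W : ℂ → V} (hf : PHol P f W (ball 0 1))
    (hfm : ∀ z ∈ ball (0:ℂ) 1, f z ∈ ball p δ) {M : ℝ} (hM : ∀ z ∈ ball (0:ℂ) 1, ‖W z‖ ≤ M) :
    Adm (fun w => chi w • W w) M := by
  have hM0 : 0 ≤ M := (norm_nonneg _).trans (hM 0 (by simp))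
  have hcj : ContDiff ℝ 1 (fun w : ℂ => (starRingEnd ℂ) w) := Complex.conjCLE.contDiff
  have h1 := (wk h hf hfm hM (chi_contDiff.mul hcj) fun w hw => by simp [chi_zero hw.le]).1
  have h2 := (g1_adm h hf hfm hM).1
  refine ⟨?_, ?_, ?_⟩
  · have h3 := h1.sub ((Complex.continuous_conj.aestronglyMeasurable (μ := volume)).smul h2)
    refine h3.congr (ae_of_all _ fun w => ?_)
    simp only [g1, Pi.sub_apply, Pi.smul_apply', dbar_mul chi_contDiff hcj, dbar_conj]
    module
  · intro w
    rcases lt_or_ge ‖w‖ 1 with hw | hw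
    · rw [norm_smul]
      exact (mul_le_of_le_one_left (norm_nonneg _) (chi_le w)).trans (hM w (by simpa using hw))
    · beta_reduce
      rw [chi_zero (by linarith)]; simpa using hM0
  · intro w hw
    beta_reduce
    rw [chi_zero (by linarith), zero_smul]

lemma rep_ae [CompleteSpace V] (h : IsChart p δ C P Q) {f W : ℂ → V} (hf : PHol P f W (ball 0 1))
    (hfm : ∀ z ∈ ball (0:ℂ) 1, f z ∈ ball p δ) {M : ℝ} (hM : ∀ z ∈ ball (0:ℂ) 1, ‖W z‖ ≤ M) :
    ∀ᵐ z, z ∈ ball (0:ℂ) 1 → chi z • W z - CT (g1 P Q f W) z = 0 := by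
  have hg := g1_adm h hf hfm hM
  have hcw := chiW_adm h hf hfm hM
  refine IsOpen.ae_eq_zero_of_integral_contDiff_smul_eq_zero isOpen_ball ?_ ?_
  · exact (hcw.integrable_self.locallyIntegrable.locallyIntegrableOn _).sub
      (hg.CT_continuous.locallyIntegrable.locallyIntegrableOn _)
  intro φ hφ hφc hφs
  let ψ : ℂ → ℂ := fun w => (φ w : ℂ)
  have hψ : ContDiff ℝ 1 ψ := Complex.ofRealCLM.contDiff.comp (hφ.of_le (by simp))
  have hψ0 : ∀ w, 1 < ‖w‖ → ψ w = 0 := by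
    intro w hw
    have : w ∉ tsupport φ := fun h => by
      have := hφs h
      simp at this
      linarith
    simp only [ψ, image_eq_zero_of_notMem_tsupport this, Complex.ofReal_zero]
  obtain ⟨m, hm⟩ := adm_of_cont hψ.continuous hψ0
  have hT := CT_contDiff hψ hψ0
  have h2 := (wk h hf hfm hM (chi_contDiff.mul hT) fun w hw => by simp [chi_zero hw.le]).2
  have e1 : ∀ w, dbar (fun w => chi w * CT ψ w) w • W w + (chi w * CT ψ w) • NN P Q (f w) (W w) =
      CT ψ w • g1 P Q f W w + ψ w • (chi w • W w) := by
    intro w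
    rw [dbar_mul chi_contDiff hT, dbar_CT hψ hψ0, g1]
    module
  simp_rw [e1] at h2
  have hI1 : Integrable fun w => CT ψ w • g1 P Q f W w := by
    refine Integrable.mono (g := fun w => (cT * m) * ‖g1 P Q f W w‖) (hg.integrable_self.norm.const_mul _)
      (hT.continuous.aestronglyMeasurable.smul hg.1) (ae_of_all _ fun w => ?_)
    have := mul_nonneg cT_pos.le hm.nonneg
    rw [norm_smul, Real.norm_of_nonneg (by positivity)]
    gcongr
    exact hm.CT_le w
  have hI2 : Integrable fun w => ψ w • (chi w • W w) := by
    refine Integrable.mono (g := fun w => m * ‖chi w • W w‖) (hcw.integrable_self.norm.const_mul _)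
      (hψ.continuous.aestronglyMeasurable.smul hcw.1) (ae_of_all _ fun w => ?_)
    have := hm.nonneg
    rw [norm_smul, Real.norm_of_nonneg (by positivity)]
    gcongr
    exact hm.2.1 w
  have hI3 : Integrable fun w => ψ w • CT (g1 P Q f W) w :=
    (hψ.continuous.smul hg.CT_continuous).integrable_of_hasCompactSupport
      ((hcs_of_zero hψ0).smul_right)
  rw [integral_add hI1 hI2, CT_adj hm hg] at h2
  have e2 : ∀ w, φ w • (chi w • W w - CT (g1 P Q f W) w) = ψ w • (chi w • W w) - ψ w • CT (g1 P Q f W) w := by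
    intro w
    rw [← coe_smul_tower, smul_sub]
  simp_rw [e2]
  rw [integral_sub hI2 hI3, ← h2]; abel

lemma rep [CompleteSpace V] (h : IsChart p δ C P Q) {f W : ℂ → V} (hf : PHol P f W (ball 0 1))
    (hfm : ∀ z ∈ ball (0:ℂ) 1, f z ∈ ball p δ) {M : ℝ} (hM : ∀ z ∈ ball (0:ℂ) 1, ‖W z‖ ≤ M) :
    ∀ z ∈ ball (0:ℂ) (1/2), W z = CT (g1 P Q f W) z := by
  have hC0 : 0 ≤ C := by linarith [h.Cpos]
  have hM0 : 0 ≤ M := (norm_nonneg _).trans (hM 0 (by simp))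
  have hae := rep_ae h hf hfm hM
  have hg := g1_adm h hf hfm hM
  -- globalise f
  let χ : ContDiffBump (0:ℂ) := ⟨1/2, 9/10, by norm_num, by norm_num⟩
  let ft : ℂ → V := fun w => χ w • f w
  have hχd : ∀ w, HasFDerivAt (⇑χ) (fderiv ℝ (⇑χ) w) w := fun w =>
    ((χ.contDiff (n := 1)).differentiable one_ne_zero w).hasFDerivAt
  have hft1 : ∀ w ∈ ball (0:ℂ) 1, HasFDerivAt ft ((χ w : ℝ) • ((P (f w)).comp (mw (W w))) + (fderiv ℝ (⇑χ) w).smulRight (f w)) w :=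
    fun w hw => HasFDerivAt.fun_smul (hχd w) (hf w hw)
  have hft2 : ∀ w, 9/10 < ‖w‖ → HasFDerivAt ft (0 : ℂ →L[ℝ] V) w := by
    intro w hw
    refine (hasFDerivAt_const (0:V) w).congr_of_eventuallyEq ?_
    filter_upwards [(isOpen_lt continuous_const continuous_norm).mem_nhds hw] with y hy
    simp only [ft]
    rw [χ.zero_of_le_dist (by simpa using (show (9/10:ℝ) < ‖y‖ from hy).le), zero_smul]
  have hftd : ∀ w, HasFDerivAt ft (fderiv ℝ ft w) w := by
    intro w
    rcases lt_or_ge ‖w‖ 1 with hw | hw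
    · exact (hft1 w (by simpa using hw)).differentiableAt.hasFDerivAt
    · exact (hft2 w (by linarith)).differentiableAt.hasFDerivAt
  obtain ⟨K, hK⟩ : ∃ K, ∀ w, ‖fderiv ℝ (⇑χ) w‖ ≤ K :=
    (χ.hasCompactSupport.fderiv ℝ).exists_bound_of_continuous ((χ.contDiff (n := 1)).continuous_fderiv one_ne_zero)
  have hPW : ∀ w ∈ ball (0:ℂ) 1, ‖(P (f w)).comp (mw (W w))‖ ≤ C * M := fun w hw =>
    (ContinuousLinearMap.opNorm_comp_le _ _).trans
      (mul_le_mul (h.bP _ (hfm w hw)) ((norm_mw_le _).trans (hM w hw)) (norm_nonneg _) hC0)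
  have hft'b : ∀ w, ‖fderiv ℝ ft w‖ ≤ C * M + K * (‖p‖ + δ) := by
    intro w
    have hK0 : 0 ≤ K := (norm_nonneg _).trans (hK 0)
    have hp : 0 ≤ ‖p‖ + δ := by linarith [norm_nonneg p, h.pos]
    rcases lt_or_ge ‖w‖ 1 with hw | hw
    · have hw' : w ∈ ball (0:ℂ) 1 := by simpa using hw
      rw [(hft1 w hw').fderiv]
      refine (norm_add_le _ _).trans (add_le_add ?_ ?_)
      · rw [norm_smul, Real.norm_of_nonneg χ.nonneg]
        exact (mul_le_of_le_one_left (norm_nonneg _) χ.le_one).trans (hPW w hw')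
      · rw [ContinuousLinearMap.norm_smulRight_apply]
        have : ‖f w‖ ≤ ‖p‖ + δ := by
          have h1 := hfm w hw'
          rw [mem_ball, dist_eq_norm] at h1
          have := norm_add_le p (f w - p)
          rw [add_sub_cancel] at this
          linarith
        exact mul_le_mul (hK w) this (norm_nonneg _) hK0
    · rw [(hft2 w (by linarith)).fderiv, norm_zero]
      positivity
  have hloc : ∀ w ∈ ball (0:ℂ) (1/2), fderiv ℝ ft w = (P (f w)).comp (mw (W w)) := by
    intro w hw
    have hw' : w ∈ ball (0:ℂ) 1 := ball_subset_ball (by norm_num) hw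
    have : ft =ᶠ[𝓝 w] f := by
      filter_upwards [isOpen_ball.mem_nhds hw] with y hy
      simp only [ft]
      rw [χ.one_of_mem_closedBall (ball_subset_closedBall hy), one_smul]
    exact ((hf w hw').congr_of_eventuallyEq this).fderiv
  intro z hz
  obtain ⟨r, hr, hrz⟩ := Metric.isOpen_iff.1 isOpen_ball z hz
  have hz1 : z ∈ ball (0:ℂ) 1 := ball_subset_ball (by norm_num) hz
  have key := ae_deriv hftd hft'b (A := fun w => P (f w) (CT (g1 P Q f W) w)) (z0 := z) (v := 1) hr ?_ ?_
  · rw [hloc z hz] at key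
    simp only [ContinuousLinearMap.comp_apply, mw_apply, one_smul] at key
    rw [← h.QP _ (hfm z hz1) (W z), key, h.QP _ (hfm z hz1)]
  · filter_upwards [hae] with w hw hwr
    have hw2 := hrz hwr
    have hw1 : w ∈ ball (0:ℂ) 1 := ball_subset_ball (by norm_num) hw2
    have h3 := hw hw1
    rw [chi_one (by simpa using (mem_ball.1 hw2).le), one_smul, sub_eq_zero] at h3
    rw [hloc w hw2]
    simp [h3]
  · have h1 : ContinuousAt (fun w => P (f w)) z := ((h.hasP (hfm z hz1)).continuousAt).comp (hf z hz1).continuousAt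
    exact h1.clm_apply hg.CT_continuous.continuousAt

end Rep
end RH

open scoped ContDiff
namespace RH
section Grad

lemma chi_contDiff2 : ContDiff ℝ 2 chi := Complex.ofRealCLM.contDiff.comp chiB.contDiff

lemma chi_ne {w : ℂ} (hw : ‖w‖ < 3/4) : chi w ≠ 0 := by
  rw [chi, Complex.ofReal_ne_zero]
  exact (chiB.pos_of_mem_ball (by simpa [chiB] using hw)).ne'

lemma dbar_chi_zero' {w : ℂ} (hw : 3/4 ≤ ‖w‖) : dbar chi w = 0 := by
  have h0 : chiB w = 0 := chiB.zero_of_le_dist (by simpa [chiB] using hw)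
  have h1 : IsLocalMin (⇑chiB) w := Eventually.of_forall fun y => by rw [h0]; exact chiB.nonneg
  have h2 : HasFDerivAt (⇑chiB) (0 : ℂ →L[ℝ] ℝ) w := by
    rw [← h1.fderiv_eq_zero]
    exact ((chiB.contDiff (n := 1)).differentiable one_ne_zero w).hasFDerivAt
  have h3 : HasFDerivAt chi (Complex.ofRealCLM.comp (0 : ℂ →L[ℝ] ℝ)) w := Complex.ofRealCLM.hasFDerivAt.comp w h2
  rw [dbar, h3.fderiv]; simp

lemma dbar_chi_in {w : ℂ} (hw : ‖w‖ < 1/2) : dbar chi w = 0 := by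
  have : chi =ᶠ[𝓝 w] fun _ => 1 := by
    filter_upwards [(isOpen_lt continuous_norm continuous_const).mem_nhds hw] with y hy using chi_one (le_of_lt hy)
  rw [dbar, this.fderiv_eq]; simp

noncomputable def kap (w : ℂ) : ℂ := kern (-w) * dbar chi w

lemma kap_contDiff : ContDiff ℝ 1 kap := by
  rw [contDiff_iff_contDiffAt]
  intro w
  rcases lt_or_ge ‖w‖ (1/2) with hw | hw
  · have : kap =ᶠ[𝓝 w] fun _ => 0 := by
      filter_upwards [(isOpen_lt continuous_norm continuous_const).mem_nhds hw] with y hy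
      rw [kap, dbar_chi_in hy, mul_zero]
    exact contDiffAt_const.congr_of_eventuallyEq this
  · have hw0 : w ≠ 0 := by rintro rfl; simp at hw; linarith
    unfold kap kern
    refine ContDiffAt.mul ?_ ?_
    · refine ContDiffAt.inv (by fun_prop) ?_
      simp [hw0, Real.pi_ne_zero]
    · unfold dbar
      have h1 : ContDiff ℝ 1 (fderiv ℝ chi) := chi_contDiff2.fderiv_right (by norm_num)
      have h2 : ∀ v, ContDiff ℝ 1 fun w => fderiv ℝ chi w v := fun v => h1.clm_apply contDiff_const
      exact (((h2 1).add ((h2 I).const_smul I)).const_smul (1/2 : ℂ)).contDiffAt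

lemma kap_zero {w : ℂ} (hw : 3/4 ≤ ‖w‖) : kap w = 0 := by rw [kap, dbar_chi_zero' hw, mul_zero]

variable {V : Type*} [NormedAddCommGroup V] [NormedSpace ℂ V] [NormedSpace ℝ V] [IsScalarTower ℝ ℂ V]
variable {p : V} {δ C : ℝ} {P Q : V → V →L[ℝ] V}

/-- multiples of W are measurable -/
lemma mulW_adm (h : IsChart p δ C P Q) {f W : ℂ → V} (hf : PHol P f W (ball 0 1))
    (hfm : ∀ z ∈ ball (0:ℂ) 1, f z ∈ ball p δ) {M : ℝ} (hM : ∀ z ∈ ball (0:ℂ) 1, ‖W z‖ ≤ M)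
    {a : ℂ → ℂ} (ha : Continuous a) (ha0 : ∀ w, 3/4 ≤ ‖w‖ → a w = 0) {A : ℝ} (hA : ∀ w, ‖a w‖ ≤ A) :
    Adm (fun w => a w • W w) (A * M) := by
  have hM0 : 0 ≤ M := (norm_nonneg _).trans (hM 0 (by simp))
  have hA0 : 0 ≤ A := (norm_nonneg _).trans (hA 0)
  refine ⟨?_, ?_, ?_⟩
  · have h1 := (chiW_adm h hf hfm hM).1
    have h2 : AEStronglyMeasurable (fun w => a w / chi w) :=
      (ha.measurable.div chi_contDiff.continuous.measurable).aestronglyMeasurable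
    refine (h2.smul h1).congr (ae_of_all _ fun w => ?_)
    simp only [Pi.smul_apply', smul_smul]
    rcases lt_or_ge ‖w‖ (3/4) with hw | hw
    · rw [div_mul_cancel₀ _ (chi_ne hw)]
    · rw [ha0 w hw]; simp
  · intro w
    beta_reduce
    rcases lt_or_ge ‖w‖ 1 with hw | hw
    · rw [norm_smul]
      exact mul_le_mul (hA w) (hM w (by simpa using hw)) (norm_nonneg _) hA0
    · rw [ha0 w (by linarith)]; simp; positivity
  · intro w hw
    beta_reduce
    rw [ha0 w (by linarith), zero_smul]

lemma int_dir_zero {H : ℂ → V} {H' : ℂ → ℂ →L[ℝ] V} (hH : ∀ w, HasFDerivAt H (H' w) w) {B : ℝ}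
    (hB : ∀ w, ‖H' w‖ ≤ B) (h0 : ∀ w, 1 < ‖w‖ → H w = 0) (v : ℂ) :
    Integrable (fun w => H' w v) ∧ ∫ w, H' w v = 0 := by
  have hB0 : 0 ≤ B := (norm_nonneg _).trans (hB 0)
  have hHc : Continuous H := continuous_iff_continuousAt.2 fun w => (hH w).continuousAt
  have hadm : Adm (fun w => H' w v) (B * ‖v‖) := by
    refine ⟨(aesm_dir hH v).aestronglyMeasurable, fun w => ((H' w).le_opNorm v).trans (by gcongr; exact hB w), fun w hw => ?_⟩
    have := fderiv_zero_of_zero h0 w hw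
    rw [(hH w).fderiv] at this
    simp [this]
  have hi := hadm.integrable_self
  refine ⟨hi, ?_⟩
  have hHi : Integrable H := hHc.integrable_of_hasCompactSupport (hcs_of_zero h0)
  have := integral_bilinear_hasLineDerivAt_right_eq_neg_left_of_integrable (μ := (volume : Measure ℂ))
    (B := ContinuousLinearMap.lsmul ℝ ℝ) (f := fun _ : ℂ => (1:ℝ)) (f' := fun _ => 0) (g := H) (g' := fun w => H' w v) (v := v)
    (by simp) (by simpa using hi) (by simpa using hHi) (fun w _ => by simpa using (hasFDerivAt_const (1:ℝ) w).hasLineDerivAt (𝕜 := ℝ) v) (fun w _ => (hH w).hasLineDerivAt v)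
  simpa using this

/-- unit gradient estimate -/
lemma grad_unit [CompleteSpace V] : ∃ K : ℝ, 1 ≤ K ∧ ∀ (p : V) (δ C : ℝ) (P Q : V → V →L[ℝ] V), IsChart p δ C P Q →
    ∀ f W : ℂ → V, PHol P f W (ball 0 1) → (∀ z ∈ ball (0:ℂ) 1, f z ∈ ball p δ) →
    ∀ M, (∀ z ∈ ball (0:ℂ) 1, ‖W z‖ ≤ M) → ∀ (c0 : V) (ε : ℝ), (∀ z ∈ ball (0:ℂ) 1, ‖f z - c0‖ ≤ ε) →
    ‖W 0‖ ≤ K * C ^ 3 * (ε + ε * M + M ^ 2) := by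
  have hkcs : HasCompactSupport kap := hcs_of_zero fun w hw => kap_zero (by linarith)
  obtain ⟨K1, hK1⟩ : ∃ K, ∀ w, ‖kap w‖ ≤ K := hkcs.exists_bound_of_continuous kap_contDiff.continuous
  obtain ⟨K2, hK2⟩ : ∃ K, ∀ w, ‖fderiv ℝ kap w‖ ≤ K :=
    (hkcs.fderiv ℝ).exists_bound_of_continuous (kap_contDiff.continuous_fderiv one_ne_zero)
  have hK10 : 0 ≤ K1 := (norm_nonneg _).trans (hK1 0)
  have hK20 : 0 ≤ K2 := (norm_nonneg _).trans (hK2 0)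
  set vb := (volume : Measure ℂ).real (closedBall (0:ℂ) 1) with hvb
  have hvb0 : 0 ≤ vb := measureReal_nonneg
  refine ⟨1 + cT + (K1 + K2) * vb, by have := cT_pos; nlinarith [mul_nonneg (add_nonneg hK10 hK20) hvb0], ?_⟩
  intro p δ C P Q h f W hf hfm M hM c0 ε hε
  have hM0 : 0 ≤ M := (norm_nonneg _).trans (hM 0 (by simp))
  have hε0 : 0 ≤ ε := (norm_nonneg _).trans (hε 0 (by simp))
  have hC1 := h.Cpos
  have hC0 : 0 ≤ C := by linarith
  -- splitting of g1
  have ha := mulW_adm h hf hfm hM (dbar_continuous chi_contDiff) (fun w hw => dbar_chi_zero' hw) dbar_chi_le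
  have hb : Adm (fun w => chi w • NN P Q (f w) (W w)) (C ^ 3 * M ^ 2) := by
    refine ⟨?_, ?_, ?_⟩
    · refine ((g1_adm h hf hfm hM).1.sub ha.1).congr (ae_of_all _ fun w => ?_)
      simp [g1]
    · intro w
      beta_reduce
      rcases lt_or_ge ‖w‖ 1 with hw | hw
      · rw [norm_smul]
        have hw' : w ∈ ball (0:ℂ) 1 := by simpa using hw
        refine (mul_le_of_le_one_left (norm_nonneg _) (chi_le w)).trans ((h.NN_le (hfm w hw') _).trans ?_)
        gcongr
        exact hM w hw'
      · rw [chi_zero (by linarith)]; simp; positivity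
    · intro w hw
      beta_reduce
      rw [chi_zero (by linarith), zero_smul]
  have hrep : W 0 = CT (fun w => dbar chi w • W w) 0 + CT (fun w => chi w • NN P Q (f w) (W w)) 0 := by
    rw [← CT_add ha hb]
    exact rep h hf hfm hM 0 (by simp)
  have hbb := hb.CT_le 0
  -- the main term
  have hkW := mulW_adm h hf hfm hM kap_contDiff.continuous (fun w hw => kap_zero hw) hK1
  have hmain : CT (fun w => dbar chi w • W w) 0 = ∫ w, kap w • W w := by
    unfold CT
    rw [← integral_neg_eq_self]
    congr 1; ext w
    simp [kap, smul_smul]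
  let H : ℂ → V := fun w => kap w • (Q (f w) (f w - c0))
  have hkd : ∀ w, HasFDerivAt kap (fderiv ℝ kap w) w := fun w => (kap_contDiff.differentiable one_ne_zero w).hasFDerivAt
  have hQf : ∀ w ∈ ball (0:ℂ) 1, HasFDerivAt (fun w => Q (f w)) ((fderiv ℝ Q (f w)).comp ((P (f w)).comp (mw (W w)))) w :=
    fun w hw => (h.hasQ (hfm w hw)).comp w (hf w hw)
  have hH1 : ∀ w ∈ ball (0:ℂ) 1, HasFDerivAt H _ w := fun w hw =>
    HasFDerivAt.fun_smul (𝕜' := ℂ) (hkd w) ((hQf w hw).clm_apply ((hf w hw).sub_const c0))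
  have hH2 : ∀ w, 3/4 < ‖w‖ → HasFDerivAt H (0 : ℂ →L[ℝ] V) w := by
    intro w hw
    refine (hasFDerivAt_const (0:V) w).congr_of_eventuallyEq ?_
    filter_upwards [(isOpen_lt continuous_const continuous_norm).mem_nhds hw] with y hy
    simp only [H]
    rw [kap_zero (le_of_lt hy), zero_smul]
  have hHd : ∀ w, HasFDerivAt H (fderiv ℝ H w) w := by
    intro w
    rcases lt_or_ge ‖w‖ 1 with hw | hw
    · exact (hH1 w (by simpa using hw)).differentiableAt.hasFDerivAt
    · exact (hH2 w (by linarith)).differentiableAt.hasFDerivAt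
  have hform : ∀ w ∈ ball (0:ℂ) 1, ∀ v, fderiv ℝ H w v = kap w • v • W w +
      (kap w • (fderiv ℝ Q (f w) (P (f w) (v • W w))) (f w - c0) + fderiv ℝ kap w v • Q (f w) (f w - c0)) := by
    intro w hw v
    rw [(hH1 w hw).fderiv]
    simp only [add_apply, smul_apply, ContinuousLinearMap.smulRight_apply, ContinuousLinearMap.comp_apply,
      ContinuousLinearMap.flip_apply, mw_apply, h.QP _ (hfm w hw)]
    module
  have hR : ∀ w ∈ ball (0:ℂ) 1, ∀ v, ‖kap w • (fderiv ℝ Q (f w) (P (f w) (v • W w))) (f w - c0) + fderiv ℝ kap w v • Q (f w) (f w - c0)‖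
      ≤ ((K1 + K2) * (C ^ 3 * (ε + ε * M))) * ‖v‖ := by
    intro w hw v
    have hx := hfm w hw
    have h1 : ‖(fderiv ℝ Q (f w) (P (f w) (v • W w))) (f w - c0)‖ ≤ C ^ 2 * (‖v‖ * M) * ε := by
      calc _ ≤ ‖fderiv ℝ Q (f w) (P (f w) (v • W w))‖ * ‖f w - c0‖ := ContinuousLinearMap.le_opNorm _ _
        _ ≤ (‖fderiv ℝ Q (f w)‖ * ‖P (f w) (v • W w)‖) * ‖f w - c0‖ := by gcongr; exact ContinuousLinearMap.le_opNorm _ _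
        _ ≤ (‖fderiv ℝ Q (f w)‖ * (‖P (f w)‖ * ‖v • W w‖)) * ‖f w - c0‖ := by gcongr; exact ContinuousLinearMap.le_opNorm _ _
        _ ≤ (C * (C * (‖v‖ * M))) * ε := by
            rw [norm_smul]
            gcongr
            · exact h.bQ' _ hx
            · exact h.bP _ hx
            · exact hM w hw
            · exact hε w hw
        _ = _ := by ring
    have h2 : ‖Q (f w) (f w - c0)‖ ≤ C * ε :=
      (ContinuousLinearMap.le_opNorm _ _).trans (mul_le_mul (h.bQ _ hx) (hε w hw) (norm_nonneg _) hC0)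
    have h3 : ‖fderiv ℝ kap w v‖ ≤ K2 * ‖v‖ := (ContinuousLinearMap.le_opNorm _ _).trans (by gcongr; exact hK2 w)
    have hCC : C ^ 2 ≤ C ^ 3 := pow_le_pow_right₀ hC1 (by norm_num)
    have hCC' : C ≤ C ^ 3 := le_self_pow₀ hC1 (by norm_num)
    calc _ ≤ K1 * (C ^ 2 * (‖v‖ * M) * ε) + (K2 * ‖v‖) * (C * ε) := by
          refine (norm_add_le _ _).trans (add_le_add ?_ ?_)
          · rw [norm_smul]; exact mul_le_mul (hK1 w) h1 (norm_nonneg _) hK10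
          · rw [norm_smul]; exact mul_le_mul h3 h2 (norm_nonneg _) (by positivity)
      _ ≤ K1 * (C ^ 3 * (‖v‖ * M) * ε) + (K2 * ‖v‖) * (C ^ 3 * ε) := by gcongr
      _ ≤ _ := by
          have e1 : 0 ≤ K1 * (C ^ 3 * ε * ‖v‖) := by positivity
          have e2 : 0 ≤ K2 * (C ^ 3 * (ε * M) * ‖v‖) := by positivity
          nlinarith
  have hHb : ∀ w, ‖fderiv ℝ H w‖ ≤ K1 * M + (K1 + K2) * (C ^ 3 * (ε + ε * M)) := by
    intro w
    rcases lt_or_ge ‖w‖ 1 with hw | hw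
    · have hw' : w ∈ ball (0:ℂ) 1 := by simpa using hw
      refine ContinuousLinearMap.opNorm_le_bound _ (by positivity) fun v => ?_
      rw [hform w hw' v, add_mul]
      refine (norm_add_le _ _).trans (add_le_add ?_ (hR w hw' v))
      rw [norm_smul, norm_smul, mul_assoc, mul_comm M]
      gcongr
      · exact hK1 w
      · exact hM w hw'
    · rw [(hH2 w (by linarith)).fderiv, norm_zero]; positivity
  obtain ⟨hHi, hH0⟩ := int_dir_zero hHd hHb (fun w hw => by simp only [H]; rw [kap_zero (by linarith), zero_smul]) 1
  have hmb : ‖∫ w, kap w • W w‖ ≤ (K1 + K2) * (C ^ 3 * (ε + ε * M)) * vb := by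
    have e1 : ∫ w, kap w • W w = ∫ w, (kap w • W w - fderiv ℝ H w 1) := by
      rw [integral_sub hkW.integrable_self hHi, hH0, sub_zero]
    rw [e1]
    have e2 : ∀ w, ‖kap w • W w - fderiv ℝ H w 1‖ ≤
        (closedBall (0:ℂ) 1).indicator (fun _ => (K1 + K2) * (C ^ 3 * (ε + ε * M))) w := by
      intro w
      rcases lt_or_ge ‖w‖ 1 with hw | hw
      · have hw' : w ∈ ball (0:ℂ) 1 := by simpa using hw
        rw [indicator_of_mem (ball_subset_closedBall hw'), hform w hw', one_smul]
        have := hR w hw' 1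
        rw [norm_one, mul_one, one_smul] at this
        rw [sub_add_cancel_left, norm_neg]
        exact this
      · rw [kap_zero (by linarith), (hH2 w (by linarith)).fderiv]
        simp only [zero_smul, zero_apply, sub_self, norm_zero]
        refine indicator_nonneg (fun _ _ => by positivity) _
    refine (norm_integral_le_of_norm_le ?_ (ae_of_all _ e2)).trans ?_
    · exact (integrableOn_const (isCompact_closedBall _ _).measure_lt_top.ne enorm_ne_top).integrable_indicator
        measurableSet_closedBall
    · rw [integral_indicator measurableSet_closedBall, setIntegral_const, smul_eq_mul, mul_comm]
  rw [hrep, hmain]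
  refine (norm_add_le _ _).trans ((add_le_add hmb hbb).trans ?_)
  have e1 : 0 ≤ C ^ 3 * (ε + ε * M + M ^ 2) := by positivity
  have e2 : 0 ≤ C ^ 3 * (ε + ε * M) := by positivity
  have e3 := mul_nonneg cT_pos.le e2
  have e4 : 0 ≤ (K1 + K2) * vb * (C ^ 3 * M ^ 2) := by positivity
  nlinarith

end Grad
end RH

open scoped ContDiff
namespace RH
section Reg
variable {V : Type*} [NormedAddCommGroup V] [NormedSpace ℂ V] [NormedSpace ℝ V] [IsScalarTower ℝ ℂ V]
variable {p : V} {δ C : ℝ} {P Q : V → V →L[ℝ] V}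

lemma aff_mem {b ζ : ℂ} {r R : ℝ} (hr : 0 < r) (hrR : r ≤ R) (hζ : ζ ∈ ball (0:ℂ) 1) :
    b + (r:ℂ) * ζ ∈ ball b R := by
  simp only [mem_ball, dist_zero_right, dist_self_add_left, norm_mul, norm_real, Real.norm_of_nonneg hr.le] at *
  nlinarith

lemma PHol.scale {f W : ℂ → V} {b : ℂ} {r R : ℝ} (hr : 0 < r) (hrR : r ≤ R) (hf : PHol P f W (ball b R)) :
    PHol P (fun ζ => f (b + (r:ℂ) * ζ)) (fun ζ => (r:ℂ) • W (b + (r:ℂ) * ζ)) (ball 0 1) := by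
  intro ζ hζ
  have h1 : HasFDerivAt (fun ζ : ℂ => b + (r:ℂ) * ζ) (r • ContinuousLinearMap.id ℝ ℂ) ζ := by
    have := ((hasFDerivAt_id (𝕜 := ℝ) ζ).const_mul (r:ℂ)).const_add b
    refine this.congr_fderiv ?_
    ext <;> simp
  have h2 := (hf _ (aff_mem hr hrR hζ)).comp ζ h1
  refine h2.congr_fderiv ?_
  ext x
  simp only [ContinuousLinearMap.comp_apply, smul_apply, mw_apply, ContinuousLinearMap.id_apply, real_smul]
  congr 1
  module

lemma PHol.mono {f W : ℂ → V} {s t : Set ℂ} (hf : PHol P f W t) (h : s ⊆ t) : PHol P f W s :=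
  fun z hz => hf z (h hz)

lemma grad [CompleteSpace V] : ∃ K : ℝ, 1 ≤ K ∧ ∀ (p : V) (δ C : ℝ) (P Q : V → V →L[ℝ] V), IsChart p δ C P Q →
    ∀ f W : ℂ → V, PHol P f W (ball 0 1) → (∀ z ∈ ball (0:ℂ) 1, f z ∈ ball p δ) →
    ∀ M, (∀ z ∈ ball (0:ℂ) 1, ‖W z‖ ≤ M) → ∀ (c0 : V) (ε : ℝ), (∀ z ∈ ball (0:ℂ) 1, ‖f z - c0‖ ≤ ε) →
    ε * (256 * (K * C ^ 3) ^ 2) ≤ 1 → ‖W 0‖ ≤ 256 * (K * C ^ 3) ^ 2 * ε := by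
  obtain ⟨K, hK1, hK⟩ := grad_unit (V := V)
  refine ⟨K, hK1, ?_⟩
  intro p δ C P Q h f W hf hfm M hM c0 ε hε hs
  set D := K * C ^ 3 with hD
  have hD1 : 1 ≤ D := by
    have : 1 ≤ C ^ 3 := one_le_pow₀ h.Cpos
    nlinarith
  have hε0 : 0 ≤ ε := (norm_nonneg _).trans (hε 0 (by simp))
  let A : ℂ → ℝ := fun ζ => (1 - ‖ζ‖) * ‖W ζ‖
  have hM0 : 0 ≤ M := (norm_nonneg _).trans (hM 0 (by simp))
  have hAb : BddAbove (A '' ball 0 1) := by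
    refine ⟨M, ?_⟩
    rintro _ ⟨z, hz, rfl⟩
    have := hM z hz
    have hz' : ‖z‖ < 1 := by simpa using hz
    simp only [A]
    nlinarith [norm_nonneg z, norm_nonneg (W z)]
  set m := sSup (A '' ball 0 1) with hm
  have hle : ∀ z ∈ ball (0:ℂ) 1, A z ≤ m := fun z hz => le_csSup hAb ⟨z, hz, rfl⟩
  have hW0 : ‖W 0‖ ≤ m := by simpa [A] using hle 0 (by simp)
  refine hW0.trans ?_
  rcases le_or_gt m 0 with hm0 | hm0
  · exact hm0.trans (by positivity)
  obtain ⟨_, ⟨ζ0, hζ0, rfl⟩, hA0⟩ := exists_lt_of_lt_csSup (s := A '' ball 0 1) ⟨_, 0, by simp, rfl⟩ (show m / 2 < m by linarith)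
  have hζ0' : ‖ζ0‖ < 1 := by simpa using hζ0
  set d := 1 - ‖ζ0‖ with hd
  have hd0 : 0 < d := by linarith
  have key : ∀ σ, 0 < σ → σ ≤ 1/2 → σ * m ≤ 1 / (32 * D) → σ * m ≤ 4 * D * ε := by
    intro σ hσ hσ2 hσm
    have hsub : ball ζ0 (σ * d) ⊆ ball 0 1 := by
      refine ball_subset_ball' ?_
      rw [dist_zero_right]; nlinarith
    have hf' := (hf.mono hsub).scale (by positivity) le_rfl
    have hmem : ∀ z ∈ ball (0:ℂ) 1, ζ0 + ((σ * d : ℝ):ℂ) * z ∈ ball ζ0 (σ * d) := fun z hz =>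
      aff_mem (by positivity) le_rfl hz
    have h1 := hK p δ C P Q h _ _ hf' (fun z hz => hfm _ (hsub (hmem z hz))) (2 * (σ * m)) (by
      intro z hz
      rw [norm_smul, norm_real, Real.norm_of_nonneg (by positivity)]
      have h2 := hmem z hz
      have h3 := hle _ (hsub h2)
      simp only [A] at h3
      set y := ζ0 + ((σ * d : ℝ):ℂ) * z
      have h4 : ‖y‖ ≤ ‖ζ0‖ + σ * d := by
        have := norm_le_norm_add_norm_sub' y ζ0
        rw [mem_ball, dist_eq_norm] at h2
        linarith
      have h5 : d / 2 ≤ 1 - ‖y‖ := by nlinarith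
      have h6 : d / 2 * ‖W y‖ ≤ m := (mul_le_mul_of_nonneg_right h5 (norm_nonneg _)).trans h3
      nlinarith [norm_nonneg (W y)]) c0 ε (fun z hz => hε _ (hsub (hmem z hz)))
    simp only [mul_zero, add_zero] at h1
    rw [norm_smul, norm_real, Real.norm_of_nonneg (by positivity), ← hD] at h1
    have h2 : σ * (m / 2) ≤ σ * d * ‖W ζ0‖ := by
      rw [mul_assoc]; exact mul_le_mul_of_nonneg_left hA0.le hσ.le
    have h3 : D * (σ * m) ≤ 1 / 32 := by
      rw [le_div_iff₀ (by positivity)] at hσm; linarith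
    have h4 : D * ε ≤ 1/256 := by nlinarith
    have h5 : 0 < σ * m := by positivity
    have h6 := mul_le_mul_of_nonneg_left h3 h5.le
    have h7 := mul_le_mul_of_nonneg_left h4 h5.le
    nlinarith
  have e1 : (1:ℝ) / (32 * D) ≤ 1/2 := by
    rw [div_le_div_iff₀ (by positivity) (by norm_num)]; nlinarith
  rcases le_or_gt m 1 with h1 | h1
  · have h2 := key (1 / (32 * D)) (by positivity) e1 (mul_le_of_le_one_right (by positivity) h1)
    rw [div_mul_eq_mul_div, div_le_iff₀ (by positivity)] at h2
    nlinarith [mul_nonneg (mul_nonneg (by linarith : 0 ≤ D) (by linarith : 0 ≤ D)) hε0]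
  · exfalso
    have h2 := key (1 / (32 * D) / m) (by positivity) ((div_le_self (by positivity) h1.le).trans e1) (by
      rw [div_mul_cancel₀ _ hm0.ne'])
    rw [div_mul_cancel₀ _ hm0.ne', div_le_iff₀ (by positivity)] at h2
    nlinarith [mul_nonneg (mul_nonneg (by linarith : 0 ≤ D) (by linarith : 0 ≤ D)) hε0]

/-- `W` is recovered from `f` -/
lemma PHol.W_eq (h : IsChart p δ C P Q) {f W : ℂ → V} {s : Set ℂ} (hf : PHol P f W s) {z : ℂ} (hz : z ∈ s)
    (hfz : f z ∈ ball p δ) : W z = Q (f z) (fderiv ℝ f z 1) := by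
  rw [(hf z hz).fderiv]; simp [h.QP _ hfz]

/-- continuity where bounded -/
lemma PHol.cont [CompleteSpace V] (h : IsChart p δ C P Q) {f W : ℂ → V} {b : ℂ} {R : ℝ} (hR : 0 < R) (hf : PHol P f W (ball b R))
    (hfm : ∀ z ∈ ball b R, f z ∈ ball p δ) {M : ℝ} (hM : ∀ z ∈ ball b R, ‖W z‖ ≤ M) : ContinuousAt W b := by
  have hf' := hf.scale hR le_rfl
  have hm : ∀ z ∈ ball (0:ℂ) 1, b + (R:ℂ) * z ∈ ball b R := fun z hz => aff_mem hR le_rfl hz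
  have hM' : ∀ z ∈ ball (0:ℂ) 1, ‖(R:ℂ) • W (b + (R:ℂ) * z)‖ ≤ R * M := fun z hz => by
    rw [norm_smul, norm_real, Real.norm_of_nonneg hR.le]
    exact mul_le_mul_of_nonneg_left (hM _ (hm z hz)) hR.le
  have h1 := rep h hf' (fun z hz => hfm _ (hm z hz)) hM'
  have h2 := (g1_adm h hf' (fun z hz => hfm _ (hm z hz)) hM').CT_continuous
  have h3 : ContinuousAt (fun z => ((R:ℂ)⁻¹) • CT (g1 P Q (fun ζ => f (b + (R:ℂ) * ζ)) (fun ζ => (R:ℂ) • W (b + (R:ℂ) * ζ))) ((z - b) / R)) b := by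
    refine ContinuousAt.const_smul ?_ _
    exact (h2.comp (by fun_prop : Continuous fun z : ℂ => (z - b) / R)).continuousAt
  refine h3.congr ?_
  filter_upwards [ball_mem_nhds b (show 0 < R/2 by positivity)] with z hz
  have hz' : (z - b) / R ∈ ball (0:ℂ) (1/2) := by
    rw [mem_ball, dist_eq_norm] at hz
    rw [mem_ball, dist_zero_right, norm_div, norm_real, Real.norm_of_nonneg hR.le, div_lt_iff₀ hR]
    linarith
  have hR' : (R:ℂ) ≠ 0 := by exact_mod_cast hR.ne'
  rw [← h1 _ hz', mul_div_cancel₀ _ hR', add_sub_cancel, inv_smul_smul₀ hR']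

end Reg
end RH

open scoped ContDiff
namespace RH
section Reg
variable {V : Type*} [NormedAddCommGroup V] [NormedSpace ℂ V] [NormedSpace ℝ V] [IsScalarTower ℝ ℂ V]
variable {p : V} {δ C : ℝ} {P Q : V → V →L[ℝ] V}

/-- bounded near a point -/
def BddNear (W : ℂ → V) (z : ℂ) : Prop := ∃ M r : ℝ, 0 < r ∧ ∀ y ∈ ball z r, ‖W y‖ ≤ M

lemma isOpen_bddNear (W : ℂ → V) : IsOpen {z | BddNear W z} := by
  rw [Metric.isOpen_iff]
  rintro z ⟨M, r, hr, h⟩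
  refine ⟨r, hr, fun y hy => ⟨M, r - dist y z, by rw [mem_ball] at hy; linarith, fun x hx => h x ?_⟩⟩
  rw [mem_ball] at *
  linarith [dist_triangle x y z]

lemma bdd_compact {W : ℂ → V} {K : Set ℂ} (hK : IsCompact K) (h : ∀ z ∈ K, BddNear W z) : ∃ M, ∀ z ∈ K, ‖W z‖ ≤ M := by
  refine hK.induction_on (p := fun s => ∃ M, ∀ z ∈ s, ‖W z‖ ≤ M) ⟨0, by simp⟩ ?_ ?_ ?_
  · rintro s t hst ⟨M, hM⟩; exact ⟨M, fun z hz => hM z (hst hz)⟩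
  · rintro s t ⟨M, hM⟩ ⟨M', hM'⟩
    refine ⟨max M M', ?_⟩
    rintro z (hz | hz)
    · exact (hM z hz).trans (le_max_left _ _)
    · exact (hM' z hz).trans (le_max_right _ _)
  · intro z hz
    obtain ⟨M, r, hr, h⟩ := h z hz
    exact ⟨ball z r, mem_nhdsWithin_of_mem_nhds (ball_mem_nhds z hr), M, h⟩

/-- every pseudoholomorphic map is locally Lipschitz -/
lemma PHol.bddNear [CompleteSpace V] (h : IsChart p δ C P Q) {f W : ℂ → V} {U : Set ℂ} (hU : IsOpen U) (hf : PHol P f W U)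
    (hfm : ∀ z ∈ U, f z ∈ ball p δ) : ∀ z ∈ U, BddNear W z := by
  obtain ⟨K, hK1, hK⟩ := grad (V := V)
  by_contra hcon
  push Not at hcon
  obtain ⟨z0, hz0U, hz0⟩ := hcon
  have hC0 : 0 ≤ C := by linarith [h.Cpos]
  set D := 256 * (K * C ^ 3) ^ 2 with hD
  have hD0 : 0 < D := by
    have : 0 < C := by linarith [h.Cpos]
    positivity
  let B : Set ℂ := U ∩ {z | BddNear W z}ᶜ
  have hBl : IsLocallyClosed B := hU.isLocallyClosed.inter (isOpen_bddNear W).isClosed_compl.isLocallyClosed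
  have : LocallyCompactSpace B := hBl.locallyCompactSpace
  have : Nonempty B := ⟨⟨z0, hz0U, hz0⟩⟩
  let Bk : ℕ → Set B := fun k => {ζ | ∀ z ∈ U, ‖z - ζ.1‖ * (k + 1) < 1 → ‖f z - f ζ.1‖ ≤ (k + 1) * ‖z - ζ.1‖}
  have hfc : Continuous fun ζ : B => f ζ.1 := by
    refine continuous_iff_continuousAt.2 fun ζ => ?_
    exact ((hf ζ.1 ζ.2.1).continuousAt).comp continuous_subtype_val.continuousAt
  have hcl : ∀ k, IsClosed (Bk k) := by
    intro k
    have : Bk k = ⋂ z ∈ U, ({ζ : B | ‖z - ζ.1‖ * (k + 1) < 1}ᶜ ∪ {ζ : B | ‖f z - f ζ.1‖ ≤ (k + 1) * ‖z - ζ.1‖}) := by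
      ext ζ
      simp only [Bk, mem_setOf_eq, mem_iInter, mem_union, mem_compl_iff]
      exact forall₂_congr fun z hz => by tauto
    rw [this]
    refine isClosed_biInter fun z hz => IsClosed.union ?_ ?_
    · exact (isOpen_lt (by fun_prop) continuous_const).isClosed_compl
    · exact isClosed_le (continuous_const.sub hfc).norm (by fun_prop)
  have hun : ⋃ k, Bk k = univ := by
    refine eq_univ_of_forall fun ζ => ?_
    rw [mem_iUnion]
    have hd := (hf ζ.1 ζ.2.1).isBigO_sub
    obtain ⟨c, hc⟩ := hd.bound
    obtain ⟨ε, hε, hb⟩ := Metric.eventually_nhds_iff.1 hc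
    obtain ⟨k, hk⟩ := exists_nat_gt (max c (1/ε))
    have hk1 : c ≤ k + 1 := by have := (le_max_left _ _).trans_lt hk; linarith
    have hk2 : 1/ε < k + 1 := by have := (le_max_right _ _).trans_lt hk; linarith
    refine ⟨k, fun z hz hzk => (hb ?_).trans (mul_le_mul_of_nonneg_right hk1 (norm_nonneg _))⟩
    rw [dist_eq_norm]
    rw [div_lt_iff₀ hε] at hk2
    by_contra hcc
    push Not at hcc
    nlinarith [norm_nonneg (z - ζ.1)]
  obtain ⟨k, ⟨ζ0, hζ0⟩⟩ := nonempty_interior_of_iUnion_of_closed hcl hun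
  rw [mem_interior_iff_mem_nhds, Metric.mem_nhds_iff] at hζ0
  obtain ⟨r1, hr1, hsub1⟩ := hζ0
  obtain ⟨r2, hr2, hsub2⟩ := Metric.isOpen_iff.1 hU ζ0.1 ζ0.2.1
  set k' : ℝ := (k:ℝ) + 1 with hk'
  have hk'0 : 0 < k' := by positivity
  set r := min (min r1 r2) (min (1 / k') (1 / (3 * k' * D))) with hr
  have hr0 : 0 < r := by positivity
  have hrr1 : r ≤ r1 := (min_le_left _ _).trans (min_le_left _ _)
  have hrr2 : r ≤ r2 := (min_le_left _ _).trans (min_le_right _ _)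
  have hrr3 : r * k' ≤ 1 := (le_div_iff₀ hk'0).1 ((min_le_right _ _).trans (min_le_left _ _))
  have hrr4 : r * (3 * k' * D) ≤ 1 := (le_div_iff₀ (by positivity)).1 ((min_le_right _ _).trans (min_le_right _ _))
  have hUr : ball ζ0.1 r ⊆ U := (ball_subset_ball hrr2).trans hsub2
  have hlip : ∀ ζ ∈ B, ζ ∈ ball ζ0.1 r → ∀ z ∈ U, ‖z - ζ‖ * k' < 1 → ‖f z - f ζ‖ ≤ k' * ‖z - ζ‖ := by
    intro ζ hζ hζr
    exact hsub1 (show (⟨ζ, hζ⟩ : B) ∈ ball ζ0 r1 from ball_subset_ball hrr1 hζr)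
  apply ζ0.2.2
  refine ⟨max (6 * D * k') (C * k'), r/4, by positivity, fun ζ hζ => ?_⟩
  have hζ' : ‖ζ - ζ0.1‖ < r / 4 := by simpa [dist_eq_norm] using hζ
  have hζU : ζ ∈ U := hUr (ball_subset_ball (by linarith) hζ)
  by_cases hζB : ζ ∈ B
  · refine le_trans ?_ (le_max_right _ _)
    have h1 : ‖fderiv ℝ f ζ‖ ≤ k' := by
      refine (hf ζ hζU).differentiableAt.hasFDerivAt.le_of_lip' hk'0.le ?_
      have : ball ζ (1 / k') ∈ 𝓝 ζ := ball_mem_nhds _ (by positivity)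
      filter_upwards [this, hU.mem_nhds hζU] with z hz hzU
      refine hlip ζ hζB (ball_subset_ball (by linarith) hζ) z hzU ?_
      rw [mem_ball, dist_eq_norm, lt_div_iff₀ hk'0] at hz
      exact hz
    rw [hf.W_eq h hζU (hfm ζ hζU)]
    refine (ContinuousLinearMap.le_opNorm _ _).trans (mul_le_mul (h.bQ _ (hfm _ hζU)) ?_ (norm_nonneg _) hC0)
    refine (ContinuousLinearMap.le_opNorm _ _).trans ?_
    simpa using h1
  · refine le_trans ?_ (le_max_left _ _)
    have hnb : BddNear W ζ := by
      by_contra hc; exact hζB ⟨hζU, hc⟩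
    set d := infDist ζ B with hd
    have hBne : B.Nonempty := ⟨_, ζ0.2⟩
    have hdr : d < r / 4 := (infDist_le_dist_of_mem ζ0.2).trans_lt (by simpa using hζ)
    have hd0 : 0 < d := by
      obtain ⟨M, ρ, hρ, hb⟩ := hnb
      have : ρ ≤ d := by
        refine (le_infDist hBne).2 fun y hy => ?_
        by_contra hc
        push Not at hc
        have : y ∈ ball ζ ρ := by rwa [mem_ball, dist_comm]
        refine hy.2 ⟨M, ρ - dist y ζ, by rw [mem_ball] at this; linarith, fun x hx => hb x ?_⟩
        rw [mem_ball] at *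
        linarith [dist_triangle x y ζ]
      linarith
    obtain ⟨ζ1, hζoneB, hζ1⟩ := (infDist_lt_iff hBne).1 (show infDist ζ B < 2 * d by linarith)
    have hζoner : ζ1 ∈ ball ζ0.1 r := by
      rw [mem_ball]
      have := dist_triangle ζ1 ζ ζ0.1
      rw [dist_comm ζ1 ζ] at this
      rw [mem_ball] at hζ
      linarith
    have hbU : closedBall ζ (d/2) ⊆ U := by
      refine Subset.trans ?_ hUr
      intro z hz
      rw [mem_closedBall] at hz
      rw [mem_ball] at hζ ⊢
      linarith [dist_triangle z ζ ζ0.1]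
    have hbG : ∀ z ∈ closedBall ζ (d/2), BddNear W z := by
      intro z hz
      by_contra hc
      have := infDist_le_dist_of_mem (x := ζ) (show z ∈ B from ⟨hbU hz, hc⟩)
      rw [mem_closedBall, dist_comm] at hz
      linarith
    obtain ⟨M, hM⟩ := bdd_compact (isCompact_closedBall ζ (d/2)) hbG
    have hf' := (hf.mono (ball_subset_closedBall.trans hbU)).scale (by positivity) le_rfl
    have hmem : ∀ z ∈ ball (0:ℂ) 1, ζ + ((d/2 : ℝ):ℂ) * z ∈ ball ζ (d/2) := fun z hz =>
      aff_mem (by positivity) le_rfl hz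
    have h1 := hK p δ C P Q h _ _ hf' (fun z hz => hfm _ (hbU (ball_subset_closedBall (hmem z hz)))) (d/2 * M)
      (fun z hz => by
        rw [norm_smul, norm_real, Real.norm_of_nonneg (by positivity)]
        exact mul_le_mul_of_nonneg_left (hM _ (ball_subset_closedBall (hmem z hz))) (by positivity)) (f ζ1) (3 * k' * d)
      (fun z hz => by
        have h2 := hmem z hz
        have h2U := hbU (ball_subset_closedBall h2)
        set y := ζ + ((d/2 : ℝ):ℂ) * z
        have h3 : ‖y - ζ1‖ < 3 * d := by
          rw [← dist_eq_norm]
          rw [mem_ball] at h2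
          linarith [dist_triangle y ζ ζ1]
        refine (hlip ζ1 hζoneB hζoner y h2U (by nlinarith)).trans ?_
        nlinarith) (by rw [← hD]; nlinarith [mul_pos hk'0 hD0])
    simp only [mul_zero, add_zero] at h1
    rw [norm_smul, norm_real, Real.norm_of_nonneg (by positivity), ← hD] at h1
    have : d / 2 * ‖W ζ‖ ≤ d / 2 * (6 * D * k') := by linarith
    exact le_of_mul_le_mul_left this (by positivity)

lemma PHol.continuousOn [CompleteSpace V] (h : IsChart p δ C P Q) {f W : ℂ → V} {U : Set ℂ} (hU : IsOpen U) (hf : PHol P f W U)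
    (hfm : ∀ z ∈ U, f z ∈ ball p δ) : ContinuousOn W U := by
  intro z hz
  obtain ⟨M, r, hr, hM⟩ := hf.bddNear h hU hfm z hz
  obtain ⟨r2, hr2, hsub2⟩ := Metric.isOpen_iff.1 hU z hz
  have h1 : ball z (min r r2) ⊆ U := (ball_subset_ball (min_le_right _ _)).trans hsub2
  exact (PHol.cont h (lt_min hr hr2) (hf.mono h1) (fun y hy => hfm y (h1 hy))
    (fun y hy => hM y (ball_subset_ball (min_le_left _ _) hy))).continuousWithinAt
end Reg
end RH

open scoped ContDiff
namespace RH
section Line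
variable {V : Type*} [NormedAddCommGroup V] [NormedSpace ℝ V] [CompleteSpace V]

/-- line integral from the origin -/
noncomputable def LI (A : ℂ → ℂ →L[ℝ] V) (ζ : ℂ) : V := ∫ s in (0:ℝ)..1, A (s • ζ) ζ

noncomputable def LId (A : ℂ → ℂ →L[ℝ] V) (ζ : ℂ) (s : ℝ) : ℂ →L[ℝ] V :=
  A (s • ζ) + s • (fderiv ℝ A (s • ζ)).flip ζ

lemma LId_cont {A : ℂ → ℂ →L[ℝ] V} (hA : ContDiff ℝ 1 A) : Continuous (Function.uncurry (LId A)) := by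
  have h1 := hA.continuous
  have h2 := hA.continuous_fderiv one_ne_zero
  have h3 : Continuous fun x : ℂ × ℝ => (fderiv ℝ A (x.2 • x.1)).flip :=
    (ContinuousLinearMap.flipₗᵢ ℝ ℂ ℂ V).continuous.comp (h2.comp (by fun_prop))
  unfold LId Function.uncurry
  refine (h1.comp (by fun_prop)).add (continuous_snd.smul ?_)
  exact h3.clm_apply continuous_fst

lemma LI_hasFDerivAt {A : ℂ → ℂ →L[ℝ] V} (hA : ContDiff ℝ 1 A) (ζ : ℂ) :
    HasFDerivAt (LI A) (∫ s in (0:ℝ)..1, LId A ζ s) ζ := by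
  have hc := LId_cont hA
  obtain ⟨M, hM⟩ : ∃ M, ∀ x ∈ closedBall ζ 1 ×ˢ Icc (0:ℝ) 1, ‖Function.uncurry (LId A) x‖ ≤ M :=
    ((isCompact_closedBall ζ 1).prod isCompact_Icc).exists_bound_of_continuousOn hc.continuousOn
  have hcs : ∀ z : ℂ, Continuous fun s : ℝ => A (s • z) z := fun z =>
    (hA.continuous.comp (by fun_prop : Continuous fun s : ℝ => s • z)).clm_apply continuous_const
  refine (intervalIntegral.hasFDerivAt_integral_of_dominated_of_fderiv_le (F := fun z s => A (s • z) z)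
    (F' := LId A) (bound := fun _ => M) (s := closedBall ζ 1) (closedBall_mem_nhds ζ one_pos) ?_ ?_ ?_ ?_ ?_ ?_)
  · exact Eventually.of_forall fun z => (hcs z).aestronglyMeasurable
  · exact (hcs ζ).intervalIntegrable _ _
  · exact (hc.comp (by fun_prop : Continuous fun s : ℝ => (ζ, s))).aestronglyMeasurable
  · refine ae_of_all _ fun s hs x hx => hM (x, s) ⟨hx, ?_⟩
    rw [uIoc_of_le zero_le_one] at hs
    exact ⟨hs.1.le, hs.2⟩
  · exact intervalIntegrable_const
  · refine ae_of_all _ fun s hs x hx => ?_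
    have h1 : HasFDerivAt (fun x : ℂ => A (s • x)) ((fderiv ℝ A (s • x)).comp (s • ContinuousLinearMap.id ℝ ℂ)) x :=
      ((hA.differentiable one_ne_zero _).hasFDerivAt).comp x ((hasFDerivAt_id (𝕜 := ℝ) x).const_smul s)
    refine (h1.clm_apply (hasFDerivAt_id (𝕜 := ℝ) x)).congr_fderiv ?_
    ext h
    simp [LId]

lemma LI_contDiff {A : ℂ → ℂ →L[ℝ] V} (hA : ContDiff ℝ 1 A) : ContDiff ℝ 1 (LI A) := by
  rw [contDiff_one_iff_fderiv]
  refine ⟨fun ζ => (LI_hasFDerivAt hA ζ).differentiableAt, ?_⟩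
  have : fderiv ℝ (LI A) = fun ζ => ∫ s in (0:ℝ)..1, LId A ζ s := by
    ext1 ζ; exact (LI_hasFDerivAt hA ζ).fderiv
  rw [this]
  exact intervalIntegral.continuous_parametric_intervalIntegral_of_continuous' (LId_cont hA) 0 1

lemma LI_deriv_le {A : ℂ → ℂ →L[ℝ] V} (hA : ContDiff ℝ 1 A) {m m' : ℝ} (hm : ∀ w, ‖A w‖ ≤ m)
    (hm' : ∀ w, ‖fderiv ℝ A w‖ ≤ m') (ζ : ℂ) : ‖fderiv ℝ (LI A) ζ‖ ≤ m + ‖ζ‖ * m' := by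
  rw [(LI_hasFDerivAt hA ζ).fderiv]
  have := intervalIntegral.norm_integral_le_of_norm_le_const (a := (0:ℝ)) (b := 1) (f := LId A ζ) (C := m + ‖ζ‖ * m') ?_
  · simpa using this
  · intro s hs
    rw [uIoc_of_le zero_le_one] at hs
    refine (norm_add_le _ _).trans (add_le_add (hm _) ?_)
    rw [norm_smul, Real.norm_of_nonneg hs.1.le]
    refine (mul_le_of_le_one_left (norm_nonneg _) hs.2).trans ?_
    refine (ContinuousLinearMap.le_opNorm _ _).trans ?_
    rw [ContinuousLinearMap.opNorm_flip, mul_comm]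
    exact mul_le_mul_of_nonneg_left (hm' _) (norm_nonneg _)

lemma LI_le {A : ℂ → ℂ →L[ℝ] V} {r m : ℝ} (hm : ∀ w ∈ ball (0:ℂ) r, ‖A w‖ ≤ m) {ζ : ℂ} (hζ : ζ ∈ ball (0:ℂ) r) :
    ‖LI A ζ‖ ≤ ‖ζ‖ * m := by
  have := intervalIntegral.norm_integral_le_of_norm_le_const (a := (0:ℝ)) (b := 1) (f := fun s => A (s • ζ) ζ) (C := ‖ζ‖ * m) ?_
  · simpa [LI] using this
  · intro s hs
    rw [uIoc_of_le zero_le_one] at hs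
    refine (ContinuousLinearMap.le_opNorm _ _).trans ?_
    rw [mul_comm]
    refine mul_le_mul_of_nonneg_left (hm _ ?_) (norm_nonneg _)
    simp only [mem_ball, dist_zero_right, norm_smul, Real.norm_of_nonneg hs.1.le] at *
    exact (mul_le_of_le_one_left (norm_nonneg _) hs.2).trans_lt hζ

lemma LI_radial {A : ℂ → ℂ →L[ℝ] V} (hA : ContDiff ℝ 1 A) (ζ : ℂ) :
    ∫ s in (0:ℝ)..1, (A (s • ζ) + s • fderiv ℝ A (s • ζ) ζ) = A ζ := by
  have h1 : ∀ s : ℝ, HasDerivAt (fun s : ℝ => s • A (s • ζ)) (A (s • ζ) + s • fderiv ℝ A (s • ζ) ζ) s := by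
    intro s
    have h2 : HasDerivAt (fun s : ℝ => s • ζ) ζ s := by simpa using (hasDerivAt_id s).smul_const ζ
    have h3 : HasDerivAt (fun s : ℝ => A (s • ζ)) (fderiv ℝ A (s • ζ) ζ) s :=
      ((hA.differentiable one_ne_zero _).hasFDerivAt).comp_hasDerivAt s h2
    have := (hasDerivAt_id s).smul h3
    refine this.congr_deriv ?_
    simp [add_comm]
  rw [intervalIntegral.integral_eq_sub_of_hasDerivAt (f := fun s : ℝ => s • A (s • ζ)) (fun s _ => h1 s)]
  · simp
  · refine Continuous.intervalIntegrable ?_ _ _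
    have h2 := hA.continuous_fderiv one_ne_zero
    exact (hA.continuous.comp (by fun_prop)).add (continuous_id.smul
      ((h2.comp (by fun_prop : Continuous fun s : ℝ => s • ζ)).clm_apply continuous_const))

lemma antisym_bound (T : ℂ →L[ℝ] ℂ →L[ℝ] V) (h k : ℂ) :
    ‖T h k - T k h‖ ≤ ‖h‖ * ‖k‖ * ‖T 1 I - T I 1‖ := by
  have e : ∀ h : ℂ, h = h.re • (1:ℂ) + h.im • I := fun h => by
    simp [Complex.re_add_im]
  have : T h k - T k h = (h.re * k.im - h.im * k.re) • (T 1 I - T I 1) := by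
    conv_lhs => rw [e h, e k]
    simp only [map_add, map_smul, add_apply, smul_apply]
    module
  rw [this, norm_smul]
  refine mul_le_mul_of_nonneg_right ?_ (norm_nonneg _)
  have h1 : h.re * k.im - h.im * k.re = ((starRingEnd ℂ) h * k).im := by
    simp [mul_im]; ring
  rw [h1, Real.norm_eq_abs]
  refine (abs_im_le_norm _).trans ?_
  simp

lemma LI_err {A : ℂ → ℂ →L[ℝ] V} (hA : ContDiff ℝ 1 A) {r m : ℝ}
    (hm : ∀ w ∈ ball (0:ℂ) r, ‖fderiv ℝ A w 1 I - fderiv ℝ A w I 1‖ ≤ m) {ζ : ℂ} (hζ : ζ ∈ ball (0:ℂ) r) :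
    ‖fderiv ℝ (LI A) ζ - A ζ‖ ≤ ‖ζ‖ * m := by
  rw [(LI_hasFDerivAt hA ζ).fderiv, ← LI_radial hA ζ]
  have h2 := hA.continuous_fderiv one_ne_zero
  rw [← intervalIntegral.integral_sub]
  · have hm0 : 0 ≤ m := (norm_nonneg _).trans (hm 0 (by
      simp only [mem_ball, dist_zero_right, dist_self] at *; exact (norm_nonneg _).trans_lt hζ))
    have := intervalIntegral.norm_integral_le_of_norm_le_const (a := (0:ℝ)) (b := 1)
      (f := fun s => LId A ζ s - (A (s • ζ) + s • fderiv ℝ A (s • ζ) ζ)) (C := ‖ζ‖ * m) ?_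
    · simpa using this
    · intro s hs
      rw [uIoc_of_le zero_le_one] at hs
      refine ContinuousLinearMap.opNorm_le_bound _ (by positivity) fun h => ?_
      have e : (LId A ζ s - (A (s • ζ) + s • fderiv ℝ A (s • ζ) ζ)) h =
          s • (fderiv ℝ A (s • ζ) h ζ - fderiv ℝ A (s • ζ) ζ h) := by
        simp only [LId, sub_apply, add_apply, smul_apply, ContinuousLinearMap.flip_apply]
        module
      rw [e, norm_smul, Real.norm_of_nonneg hs.1.le]
      refine (mul_le_of_le_one_left (norm_nonneg _) hs.2).trans ((antisym_bound _ _ _).trans ?_)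
      have : s • ζ ∈ ball (0:ℂ) r := by
        simp only [mem_ball, dist_zero_right, norm_smul, Real.norm_of_nonneg hs.1.le] at *
        exact (mul_le_of_le_one_left (norm_nonneg _) hs.2).trans_lt hζ
      have h5 := mul_le_mul_of_nonneg_left (hm _ this) (mul_nonneg (norm_nonneg h) (norm_nonneg ζ))
      linarith
  · exact ((LId_cont hA).comp (by fun_prop : Continuous fun s : ℝ => (ζ, s))).intervalIntegrable _ _
  · refine Continuous.intervalIntegrable ?_ _ _
    exact (hA.continuous.comp (by fun_prop)).add (continuous_id.smul
      ((h2.comp (by fun_prop : Continuous fun s : ℝ => s • ζ)).clm_apply continuous_const))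

end Line
end RH

open scoped ContDiff
namespace RH
section Fix
variable {E1 E2 : Type*} [NormedAddCommGroup E1] [NormedSpace ℝ E1] [CompleteSpace E1]
  [NormedAddCommGroup E2] [NormedSpace ℝ E2]

/-- small smooth nonlinearities -/
structure SmallNL (B : E1 → E2) (κ η Λ : ℝ) : Prop where
  κpos : 0 < κ
  ηnn : 0 ≤ η
  Λnn : 0 ≤ Λ
  zero : B 0 = 0
  sm : ContDiffOn ℝ 1 B (ball 0 κ)
  b1 : ∀ x ∈ ball (0:E1) κ, ‖fderiv ℝ B x‖ ≤ η
  b2 : ∀ x ∈ ball (0:E1) κ, ∀ y ∈ ball (0:E1) κ, ‖fderiv ℝ B x - fderiv ℝ B y‖ ≤ Λ * ‖x - y‖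

variable {B : E1 → E2} {κ η Λ : ℝ}

lemma SmallNL.has (h : SmallNL B κ η Λ) {x : E1} (hx : x ∈ ball (0:E1) κ) : HasFDerivAt B (fderiv ℝ B x) x :=
  ((h.sm.contDiffAt (isOpen_ball.mem_nhds hx)).differentiableAt one_ne_zero).hasFDerivAt

lemma SmallNL.lip (h : SmallNL B κ η Λ) {x y : E1} (hx : x ∈ ball (0:E1) κ) (hy : y ∈ ball (0:E1) κ) :
    ‖B x - B y‖ ≤ η * ‖x - y‖ :=
  (convex_ball (0:E1) κ).norm_image_sub_le_of_norm_fderiv_le (𝕜 := ℝ) (fun z hz => (h.has hz).differentiableAt) h.b1 hy hx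

lemma SmallNL.le (h : SmallNL B κ η Λ) {x : E1} (hx : x ∈ ball (0:E1) κ) : ‖B x‖ ≤ η * ‖x‖ := by
  have := h.lip hx (mem_ball_self h.κpos)
  simpa [h.zero] using this

lemma SmallNL.comp_cd (h : SmallNL B κ η Λ) {z : ℂ → E1} (hz : ContDiff ℝ 1 z) (hm : ∀ w, z w ∈ ball (0:E1) κ) :
    ContDiff ℝ 1 fun w => B (z w) :=
  h.sm.comp_contDiff hz hm

lemma SmallNL.comp_fd (h : SmallNL B κ η Λ) {z : ℂ → E1} (hz : ContDiff ℝ 1 z) (hm : ∀ w, z w ∈ ball (0:E1) κ) (w : ℂ) :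
    fderiv ℝ (fun w => B (z w)) w = (fderiv ℝ B (z w)).comp (fderiv ℝ z w) :=
  ((h.has (hm w)).comp w (hz.differentiable one_ne_zero w).hasFDerivAt).fderiv

lemma SmallNL.comp_fd_le (h : SmallNL B κ η Λ) {z : ℂ → E1} (hz : ContDiff ℝ 1 z) (hm : ∀ w, z w ∈ ball (0:E1) κ) (w : ℂ) :
    ‖fderiv ℝ (fun w => B (z w)) w‖ ≤ η * ‖fderiv ℝ z w‖ := by
  rw [h.comp_fd hz hm]
  exact (ContinuousLinearMap.opNorm_comp_le _ _).trans (mul_le_mul_of_nonneg_right (h.b1 _ (hm w)) (norm_nonneg _))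

theorem fix {Lo : (ℂ → E2) → ℂ → E1} {c : ℝ} (hc : 0 ≤ c)
    (hLs : ∀ b1 b2, ContDiff ℝ 1 b1 → ContDiff ℝ 1 b2 → ∀ ζ, Lo b1 ζ - Lo b2 ζ = Lo (fun w => b1 w - b2 w) ζ)
    (hL : ∀ b m m', ContDiff ℝ 1 b → (∀ w, ‖b w‖ ≤ m) → (∀ w, ‖fderiv ℝ b w‖ ≤ m') →
      ContDiff ℝ 1 (Lo b) ∧ (∀ ζ, ‖Lo b ζ‖ ≤ c * m) ∧ ∀ ζ, ‖fderiv ℝ (Lo b) ζ‖ ≤ c * (m + m'))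
    (h : SmallNL B κ η Λ) (hcη : c * η ≤ 1/4) {d : ℂ → E1} (hd : ContDiff ℝ 1 d) (hd1 : ∀ w, ‖d w‖ ≤ κ/2)
    {D0 : ℝ} (hd2 : ∀ w, ‖fderiv ℝ d w‖ ≤ D0) :
    ∃ z : ℂ → E1, ContDiff ℝ 1 z ∧ (∀ ζ, z ζ ∈ ball (0:E1) κ) ∧ ∀ ζ, z ζ = d ζ + Lo (fun w => B (z w)) ζ := by
  have hκ := h.κpos
  have hη := h.ηnn
  have hΛ := h.Λnn
  have hD0 : 0 ≤ D0 := (norm_nonneg _).trans (hd2 0)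
  obtain ⟨z, hz0, hzs⟩ : ∃ z : ℕ → ℂ → E1, z 0 = d ∧ ∀ m ζ, z (m+1) ζ = d ζ + Lo (fun w => B (z m w)) ζ :=
    ⟨fun m => Nat.rec d (fun _ y ζ => d ζ + Lo (fun w => B (y w)) ζ) m, rfl, fun m ζ => rfl⟩
  have hzs' : ∀ m, z (m+1) = fun ζ => d ζ + Lo (fun w => B (z m w)) ζ := fun m => funext (hzs m)
  set D1 := 2 * (D0 + κ) with hD1
  have inv : ∀ m, ContDiff ℝ 1 (z m) ∧ (∀ w, ‖z m w‖ ≤ 2/3 * κ) ∧ ∀ w, ‖fderiv ℝ (z m) w‖ ≤ D1 := by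
    intro m
    induction m with
    | zero => rw [hz0]; exact ⟨hd, fun w => (hd1 w).trans (by linarith), fun w => (hd2 w).trans (by linarith)⟩
    | succ m ih =>
      obtain ⟨i1, i2, i3⟩ := ih
      have hm : ∀ w, z m w ∈ ball (0:E1) κ := fun w => by
        rw [mem_ball_zero_iff]; exact (i2 w).trans_lt (by linarith)
      obtain ⟨l1, l2, l3⟩ := hL (fun w => B (z m w)) (η * (2/3 * κ)) (η * D1) (h.comp_cd i1 hm)
        (fun w => (h.le (hm w)).trans (mul_le_mul_of_nonneg_left (i2 w) hη))
        (fun w => (h.comp_fd_le i1 hm w).trans (mul_le_mul_of_nonneg_left (i3 w) hη))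
      refine ⟨by rw [hzs']; exact hd.add l1, fun w => ?_, fun w => ?_⟩
      · rw [hzs]
        refine (norm_add_le _ _).trans ?_
        have := l2 w; have := hd1 w
        nlinarith
      · have e : fderiv ℝ (z (m+1)) w = fderiv ℝ d w + fderiv ℝ (Lo fun w => B (z m w)) w := by
          rw [hzs']; exact fderiv_add (hd.differentiable one_ne_zero w) (l1.differentiable one_ne_zero w)
        rw [e]
        refine (norm_add_le _ _).trans ?_
        have := l3 w; have := hd2 w
        nlinarith
  have hm : ∀ m w, z m w ∈ ball (0:E1) κ := fun m w => by
    rw [mem_ball_zero_iff]; exact ((inv m).2.1 w).trans_lt (by linarith)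
  let y : ℕ → ℂ → E1 := fun m w => z (m+1) w - z m w
  have ycd : ∀ m, ContDiff ℝ 1 (y m) := fun m => (inv (m+1)).1.sub (inv m).1
  have yfd : ∀ m w, fderiv ℝ (y m) w = fderiv ℝ (z (m+1)) w - fderiv ℝ (z m) w := fun m w =>
    fderiv_sub ((inv (m+1)).1.differentiable one_ne_zero w) ((inv m).1.differentiable one_ne_zero w)
  set S := 4 * (κ + c * Λ * D1 * κ) + 2 * D1 with hS
  have hD1n : 0 ≤ D1 := by positivity
  have hX : 0 ≤ c * Λ * D1 * κ := by positivity
  have diff : ∀ m, (∀ w, ‖y m w‖ ≤ κ * (1/4)^m) ∧ ∀ w, ‖fderiv ℝ (y m) w‖ ≤ S * (1/2)^m := by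
    intro m
    induction m with
    | zero =>
      obtain ⟨l1, l2, l3⟩ := hL (fun w => B (z 0 w)) (η * (2/3 * κ)) (η * D1) (h.comp_cd (inv 0).1 (hm 0))
        (fun w => (h.le (hm 0 w)).trans (mul_le_mul_of_nonneg_left ((inv 0).2.1 w) hη))
        (fun w => (h.comp_fd_le (inv 0).1 (hm 0) w).trans (mul_le_mul_of_nonneg_left ((inv 0).2.2 w) hη))
      refine ⟨fun w => ?_, fun w => ?_⟩
      · have e : y 0 w = Lo (fun w => B (z 0 w)) w := by simp only [y]; rw [hzs, hz0]; simp
        rw [e]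
        have := l2 w
        rw [pow_zero]
        nlinarith
      · rw [yfd, pow_zero]
        refine (norm_sub_le _ _).trans ?_
        have := (inv (0+1)).2.2 w; have := (inv 0).2.2 w
        rw [hS]; nlinarith
    | succ m ih =>
      obtain ⟨i1, i2⟩ := ih
      have hcd := (h.comp_cd (inv (m+1)).1 (hm (m+1))).sub (h.comp_cd (inv m).1 (hm m))
      have hy : y (m+1) = Lo (fun w => B (z (m+1) w) - B (z m w)) := by
        ext ζ
        rw [← hLs _ _ (h.comp_cd (inv (m+1)).1 (hm (m+1))) (h.comp_cd (inv m).1 (hm m))]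
        simp only [y]
        rw [hzs (m+1), hzs m, add_sub_add_left_eq_sub]
      obtain ⟨l1, l2, l3⟩ := hL (fun w => B (z (m+1) w) - B (z m w)) (η * (κ * (1/4)^m))
        (η * (S * (1/2)^m) + Λ * (κ * (1/4)^m) * D1) hcd
        (fun w => (h.lip (hm (m+1) w) (hm m w)).trans (mul_le_mul_of_nonneg_left (i1 w) hη))
        (fun w => by
          have e : fderiv ℝ (fun w => B (z (m+1) w) - B (z m w)) w =
            (fderiv ℝ B (z (m+1) w)).comp (fderiv ℝ (y m) w) +
              (fderiv ℝ B (z (m+1) w) - fderiv ℝ B (z m w)).comp (fderiv ℝ (z m) w) := by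
            have e1 := fderiv_fun_sub ((h.comp_cd (inv (m+1)).1 (hm (m+1))).differentiable one_ne_zero w)
              ((h.comp_cd (inv m).1 (hm m)).differentiable one_ne_zero w)
            rw [e1, h.comp_fd (inv (m+1)).1 (hm (m+1)), h.comp_fd (inv m).1 (hm m), yfd]
            ext u
            simp
          rw [e]
          refine (norm_add_le _ _).trans (add_le_add ?_ ?_)
          · exact (ContinuousLinearMap.opNorm_comp_le _ _).trans
              (mul_le_mul (h.b1 _ (hm (m+1) w)) (i2 w) (norm_nonneg _) hη)
          · refine (ContinuousLinearMap.opNorm_comp_le _ _).trans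
              (mul_le_mul ((h.b2 _ (hm (m+1) w) _ (hm m w)).trans ?_) ((inv m).2.2 w) (norm_nonneg _) (by positivity))
            exact mul_le_mul_of_nonneg_left (i1 w) hΛ)
      rw [hy]
      refine ⟨fun w => (l2 w).trans ?_, fun w => (l3 w).trans ?_⟩
      · rw [pow_succ]
        have : 0 < κ * (1/4:ℝ)^m := by positivity
        nlinarith
      · have hq : (1/4:ℝ)^m ≤ (1/2)^m := pow_le_pow_left₀ (by norm_num) (by norm_num) m
        have hq0 : (0:ℝ) < (1/4)^m := by positivity
        have hq1 : (0:ℝ) < (1/2)^m := by positivity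
        have hS0 : 0 ≤ S := by rw [hS]; positivity
        rw [pow_succ]
        have t1 : c * η * (κ * (1/4)^m) ≤ 1/4 * (κ * (1/2)^m) :=
          mul_le_mul hcη (mul_le_mul_of_nonneg_left hq hκ.le) (by positivity) (by norm_num)
        have t2 : c * η * (S * (1/2)^m) ≤ 1/4 * (S * (1/2)^m) := mul_le_mul_of_nonneg_right hcη (by positivity)
        have t3 : c * Λ * D1 * κ * (1/4)^m ≤ c * Λ * D1 * κ * (1/2)^m := mul_le_mul_of_nonneg_left hq hX
        have t4 : (4 * (κ + c * Λ * D1 * κ)) * (1/2)^m ≤ S * (1/2)^m :=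
          mul_le_mul_of_nonneg_right (by rw [hS]; linarith) hq1.le
        have t5 : 0 ≤ κ * (1/2:ℝ)^m := by positivity
        have t6 : 0 ≤ c * Λ * D1 * κ * (1/2:ℝ)^m := by positivity
        nlinarith
  have hsum1 : Summable fun m : ℕ => κ * (1/4:ℝ)^m :=
    (summable_geometric_of_lt_one (by norm_num) (by norm_num)).mul_left _
  have hsum2 : Summable fun m : ℕ => S * (1/2:ℝ)^m :=
    (summable_geometric_of_lt_one (by norm_num) (by norm_num)).mul_left _
  have hsy : ∀ w, Summable fun m => y m w := fun w => Summable.of_norm_bounded hsum1 fun m => (diff m).1 w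
  let Z : ℂ → E1 := fun w => d w + ∑' m, y m w
  have hfd : ∀ w, HasFDerivAt (fun w => ∑' m, y m w) (∑' m, fderiv ℝ (y m) w) w := fun w =>
    hasFDerivAt_tsum (x₀ := (0:ℂ)) hsum2 (fun m w => ((ycd m).differentiable one_ne_zero w).hasFDerivAt) (fun m w => (diff m).2 w) (hsy 0) w
  have hfc : Continuous fun w => ∑' m, fderiv ℝ (y m) w :=
    continuous_tsum (fun m => (ycd m).continuous_fderiv one_ne_zero) hsum2 (fun m w => (diff m).2 w)
  have hZcd : ContDiff ℝ 1 Z := by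
    refine hd.add ?_
    rw [contDiff_one_iff_fderiv]
    refine ⟨fun w => (hfd w).differentiableAt, ?_⟩
    rw [show fderiv ℝ (fun w => ∑' m, y m w) = fun w => ∑' m, fderiv ℝ (y m) w from funext fun w => (hfd w).fderiv]
    exact hfc
  have hlim : ∀ w, Tendsto (fun m => z m w) atTop (𝓝 (Z w)) := by
    intro w
    have h1 := (hsy w).hasSum.tendsto_sum_nat.const_add (d w)
    refine h1.congr fun m => ?_
    simp only [y]
    rw [Finset.sum_range_sub (fun m => z m w)]
    simp [hz0]
  have hZm : ∀ w, Z w ∈ ball (0:E1) κ := fun w => by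
    rw [mem_ball_zero_iff]
    exact (le_of_tendsto' (hlim w).norm fun m => (inv m).2.1 w).trans_lt (by linarith)
  have hZd : ∃ D, ∀ w, ‖fderiv ℝ Z w‖ ≤ D := by
    refine ⟨D0 + ∑' m : ℕ, S * (1/2:ℝ)^m, fun w => ?_⟩
    have e : fderiv ℝ Z w = fderiv ℝ d w + ∑' m, fderiv ℝ (y m) w :=
      ((hd.differentiable one_ne_zero w).hasFDerivAt.add (hfd w)).fderiv
    rw [e]
    exact (norm_add_le _ _).trans (add_le_add (hd2 w) (tsum_of_norm_bounded hsum2.hasSum fun m => (diff m).2 w))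
  obtain ⟨DZ, hDZ⟩ := hZd
  have hdist : ∀ m w, ‖z m w - Z w‖ ≤ κ * (1/4)^m / (1 - 1/4) := by
    intro m w
    rw [← dist_eq_norm]
    refine dist_le_of_le_geometric_of_tendsto (1/4) κ (by norm_num) (fun n => ?_) (hlim w) m
    rw [dist_comm, dist_eq_norm]
    exact (diff n).1 w
  refine ⟨Z, hZcd, hZm, fun ζ => ?_⟩
  refine tendsto_nhds_unique ((hlim ζ).comp (tendsto_add_atTop_nat 1)) ?_
  have hconv : Tendsto (fun m => Lo (fun w => B (z m w)) ζ) atTop (𝓝 (Lo (fun w => B (Z w)) ζ)) := by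
    rw [tendsto_iff_norm_sub_tendsto_zero]
    have hb : ∀ m, ‖Lo (fun w => B (z m w)) ζ - Lo (fun w => B (Z w)) ζ‖ ≤ c * (η * (κ * (1/4)^m / (1 - 1/4))) := by
      intro m
      have c1 := h.comp_cd (inv m).1 (hm m)
      have c2 := h.comp_cd hZcd hZm
      rw [hLs _ _ c1 c2]
      refine (hL _ _ (η * D1 + η * DZ) (c1.sub c2) (fun w => ?_) (fun w => ?_)).2.1 ζ
      · exact (h.lip (hm m w) (hZm w)).trans (mul_le_mul_of_nonneg_left (hdist m w) hη)
      · rw [fderiv_fun_sub (c1.differentiable one_ne_zero w) (c2.differentiable one_ne_zero w)]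
        refine (norm_sub_le _ _).trans (add_le_add ?_ ?_)
        · exact (h.comp_fd_le (inv m).1 (hm m) w).trans (mul_le_mul_of_nonneg_left ((inv m).2.2 w) hη)
        · exact (h.comp_fd_le hZcd hZm w).trans (mul_le_mul_of_nonneg_left (hDZ w) hη)
    refine squeeze_zero (fun m => norm_nonneg _) hb ?_
    have : Tendsto (fun m : ℕ => c * (η * (κ * (1/4:ℝ)^m / (1 - 1/4)))) atTop (𝓝 (c * (η * (κ * 0 / (1 - 1/4))))) :=
      (((_root_.tendsto_pow_atTop_nhds_zero_of_lt_one (by norm_num) (by norm_num)).const_mul κ).div_const _ |>.const_mul η).const_mul c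
    simpa using this
  refine (hconv.const_add (d ζ)).congr fun m => (hzs m ζ).symm

end Fix
end RH

open scoped ContDiff
namespace RH
section Lop

noncomputable def chi2 (w : ℂ) : ℂ := chi (2 * w)
noncomputable def bet (w : ℂ) : ℂ := chi w * w

lemma norm_two_mul (w : ℂ) : ‖2 * w‖ = 2 * ‖w‖ := by simp
lemma chi2_contDiff : ContDiff ℝ 1 chi2 := chi_contDiff.comp (by fun_prop)
lemma chi2_one {w : ℂ} (hw : ‖w‖ ≤ 1/4) : chi2 w = 1 := chi_one (by rw [norm_two_mul]; linarith)
lemma chi2_zero {w : ℂ} (hw : 3/8 ≤ ‖w‖) : chi2 w = 0 := chi_zero (by rw [norm_two_mul]; linarith)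
lemma chi2_le (w : ℂ) : ‖chi2 w‖ ≤ 1 := chi_le _
lemma bet_contDiff : ContDiff ℝ 1 bet := chi_contDiff.mul contDiff_id
lemma bet_id {w : ℂ} (hw : ‖w‖ ≤ 1/2) : bet w = w := by rw [bet, chi_one hw, one_mul]
lemma bet_le (w : ℂ) : ‖bet w‖ ≤ 3/4 := by
  rcases lt_or_ge ‖w‖ (3/4) with h | h
  · rw [bet, norm_mul]
    exact (mul_le_of_le_one_left (norm_nonneg _) (chi_le w)).trans h.le
  · rw [bet, chi_zero h]; norm_num
lemma bet_mem (w : ℂ) : bet w ∈ ball (0:ℂ) 1 := by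
  rw [mem_ball_zero_iff]; linarith [bet_le w]

lemma bet_chi2_K : ∃ K, 1 ≤ K ∧ (∀ w, ‖fderiv ℝ bet w‖ ≤ K) ∧ ∀ w, ‖fderiv ℝ chi2 w‖ ≤ K := by
  have h1 : HasCompactSupport bet := hcs_of_zero fun w hw => by rw [bet, chi_zero (by linarith), zero_mul]
  have h2 : HasCompactSupport chi2 := hcs_of_zero fun w hw => chi2_zero (by linarith)
  obtain ⟨K1, hK1⟩ : ∃ K, ∀ w, ‖fderiv ℝ bet w‖ ≤ K :=
    (h1.fderiv ℝ).exists_bound_of_continuous (bet_contDiff.continuous_fderiv one_ne_zero)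
  obtain ⟨K2, hK2⟩ : ∃ K, ∀ w, ‖fderiv ℝ chi2 w‖ ≤ K :=
    (h2.fderiv ℝ).exists_bound_of_continuous (chi2_contDiff.continuous_fderiv one_ne_zero)
  exact ⟨max 1 (max K1 K2), le_max_left _ _, fun w => (hK1 w).trans ((le_max_left _ _).trans (le_max_right _ _)),
    fun w => (hK2 w).trans ((le_max_right _ _).trans (le_max_right _ _))⟩

noncomputable def Kbc : ℝ := bet_chi2_K.choose
lemma Kbc_one : 1 ≤ Kbc := bet_chi2_K.choose_spec.1
lemma bet_fd (w : ℂ) : ‖fderiv ℝ bet w‖ ≤ Kbc := bet_chi2_K.choose_spec.2.1 w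
lemma chi2_fd (w : ℂ) : ‖fderiv ℝ chi2 w‖ ≤ Kbc := bet_chi2_K.choose_spec.2.2 w

/-- the universal constant of `Lop` -/
noncomputable def cL : ℝ := 1 + Kbc + cT * (1 + Kbc)
lemma cL_pos : 1 ≤ cL := by
  have := cT_pos; have := Kbc_one
  unfold cL; nlinarith

variable {V : Type*} [NormedAddCommGroup V] [NormedSpace ℂ V] [NormedSpace ℝ V] [IsScalarTower ℝ ℂ V]

noncomputable def Lop (b : ℂ → (ℂ →L[ℝ] V) × V) (ζ : ℂ) : V × V :=
  (LI (fun w => (b w).1) (bet ζ), CT (fun w => chi2 w • (b w).2) ζ)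

lemma chi2_cont {g : ℂ → V} (hg : ContinuousOn g (ball 0 (1/2))) : Continuous fun w => chi2 w • g w := by
  rw [continuous_iff_continuousAt]
  intro w
  rcases lt_or_ge ‖w‖ (1/2) with h | h
  · exact chi2_contDiff.continuous.continuousAt.smul (hg.continuousAt (isOpen_ball.mem_nhds (by simpa using h)))
  · have : (fun w => chi2 w • g w) =ᶠ[𝓝 w] fun _ => 0 := by
      filter_upwards [(isOpen_lt continuous_const continuous_norm).mem_nhds (show 3/8 < ‖w‖ by linarith)] with y hy
      rw [chi2_zero (show 3/8 < ‖y‖ from hy).le, zero_smul]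
    exact continuousAt_const.congr this.symm

lemma chi2_adm {g : ℂ → V} (hg : ContinuousOn g (ball 0 (1/2))) {m : ℝ} (hm0 : 0 ≤ m) (hm : ∀ w ∈ ball (0:ℂ) (1/2), ‖g w‖ ≤ m) :
    Adm (fun w => chi2 w • g w) m := by
  refine ⟨(chi2_cont hg).aestronglyMeasurable, fun w => ?_, fun w hw => by
    beta_reduce; rw [chi2_zero (by linarith), zero_smul]⟩
  beta_reduce
  rcases lt_or_ge ‖w‖ (1/2) with h | h
  · rw [norm_smul]
    exact (mul_le_of_le_one_left (norm_nonneg _) (chi2_le w)).trans (hm w (by simpa using h))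
  · rw [chi2_zero (by linarith), zero_smul, norm_zero]; exact hm0

lemma chi2_adm' {g : ℂ → V} (hg : ContinuousOn g (ball 0 (1/2))) : ∃ m, Adm (fun w => chi2 w • g w) m :=
  adm_of_cont (chi2_cont hg) fun w hw => by rw [chi2_zero (by linarith), zero_smul]

lemma CTchi2_sub {g₁ g₂ : ℂ → V} (h1 : ContinuousOn g₁ (ball 0 (1/2))) (h2 : ContinuousOn g₂ (ball 0 (1/2))) (ζ : ℂ) :
    CT (fun w => chi2 w • g₁ w) ζ - CT (fun w => chi2 w • g₂ w) ζ = CT (fun w => chi2 w • (g₁ w - g₂ w)) ζ := by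
  obtain ⟨m1, hm1⟩ := chi2_adm' h1
  obtain ⟨m2, hm2⟩ := chi2_adm' h2
  rw [← CT_sub hm1 hm2]
  simp only [smul_sub]

lemma LI_sub [CompleteSpace V] {A₁ A₂ : ℂ → ℂ →L[ℝ] V} {r : ℝ} (h1 : ContinuousOn A₁ (ball 0 r)) (h2 : ContinuousOn A₂ (ball 0 r))
    {ζ : ℂ} (hζ : ζ ∈ ball (0:ℂ) r) : LI A₁ ζ - LI A₂ ζ = LI (fun w => A₁ w - A₂ w) ζ := by
  have key : ∀ A : ℂ → ℂ →L[ℝ] V, ContinuousOn A (ball 0 r) → IntervalIntegrable (fun s : ℝ => A (s • ζ) ζ) volume 0 1 := by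
    intro A hA
    refine ContinuousOn.intervalIntegrable ?_
    refine ContinuousOn.clm_apply (hA.comp (by fun_prop) ?_) continuousOn_const
    intro s hs
    rw [uIcc_of_le zero_le_one] at hs
    simp only [mem_ball, dist_zero_right, norm_smul, Real.norm_of_nonneg hs.1] at *
    exact (mul_le_of_le_one_left (norm_nonneg _) hs.2).trans_lt hζ
  unfold LI
  rw [← intervalIntegral.integral_sub (key _ h1) (key _ h2)]
  simp only [sub_apply]

lemma Lop_sub_global [CompleteSpace V] {b₁ b₂ : ℂ → (ℂ →L[ℝ] V) × V} (h1 : Continuous b₁) (h2 : Continuous b₂) (ζ : ℂ) :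
    Lop b₁ ζ - Lop b₂ ζ = Lop (fun w => b₁ w - b₂ w) ζ := by
  refine Prod.ext ?_ ?_
  · exact LI_sub (continuous_fst.comp h1).continuousOn (continuous_fst.comp h2).continuousOn (bet_mem ζ)
  · exact CTchi2_sub (continuous_snd.comp h1).continuousOn (continuous_snd.comp h2).continuousOn ζ

lemma Lop_sub [CompleteSpace V] {b₁ b₂ : ℂ → (ℂ →L[ℝ] V) × V} (h1 : ContinuousOn b₁ (ball 0 (1/2)))
    (h2 : ContinuousOn b₂ (ball 0 (1/2))) {ζ : ℂ} (hζ : ζ ∈ ball (0:ℂ) (1/2)) :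
    Lop b₁ ζ - Lop b₂ ζ = Lop (fun w => b₁ w - b₂ w) ζ := by
  have hb : bet ζ = ζ := bet_id (by simp at hζ ⊢; linarith)
  refine Prod.ext ?_ ?_
  · unfold Lop
    rw [hb]
    exact LI_sub (continuous_fst.comp_continuousOn h1) (continuous_fst.comp_continuousOn h2) hζ
  · exact CTchi2_sub (continuous_snd.comp_continuousOn h1) (continuous_snd.comp_continuousOn h2) ζ

lemma Lop_le [CompleteSpace V] {b : ℂ → (ℂ →L[ℝ] V) × V} (hb : ContinuousOn b (ball 0 (1/2))) {m : ℝ}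
    (hm : ∀ w ∈ ball (0:ℂ) (1/2), ‖b w‖ ≤ m) {ζ : ℂ} (hζ : ζ ∈ ball (0:ℂ) (1/2)) : ‖Lop b ζ‖ ≤ cL * m := by
  have hbe : bet ζ = ζ := bet_id (by simp at hζ ⊢; linarith)
  have hm0 : 0 ≤ m := (norm_nonneg _).trans (hm 0 (by simp))
  have := cT_pos; have := Kbc_one
  have hc1 : 1 ≤ cL := cL_pos
  have hc2 : cT ≤ cL := by unfold cL; nlinarith
  unfold Lop
  rw [Prod.norm_mk, hbe]
  refine max_le ?_ ?_
  · refine (LI_le (m := m) (fun w hw => (norm_fst_le (b w)).trans (hm w hw)) hζ).trans ?_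
    refine mul_le_mul_of_nonneg_right ?_ hm0
    simp at hζ; linarith
  · refine ((chi2_adm (continuous_snd.comp_continuousOn hb) hm0 fun w hw => (norm_snd_le (b w)).trans (hm w hw)).CT_le ζ).trans ?_
    exact mul_le_mul_of_nonneg_right hc2 hm0

lemma Lop_C1 [CompleteSpace V] (b : ℂ → (ℂ →L[ℝ] V) × V) (m m' : ℝ) (hb : ContDiff ℝ 1 b) (hm : ∀ w, ‖b w‖ ≤ m)
    (hm' : ∀ w, ‖fderiv ℝ b w‖ ≤ m') :
    ContDiff ℝ 1 (Lop b) ∧ (∀ ζ, ‖Lop b ζ‖ ≤ cL * m) ∧ ∀ ζ, ‖fderiv ℝ (Lop b) ζ‖ ≤ cL * (m + m') := by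
  have hm0 : 0 ≤ m := (norm_nonneg _).trans (hm 0)
  have hm0' : 0 ≤ m' := (ContinuousLinearMap.opNorm_nonneg _).trans (hm' 0)
  have := cT_pos; have := Kbc_one
  have hc1 : 1 ≤ cL := cL_pos
  have hc2 : cT ≤ cL := by unfold cL; nlinarith
  have hc3 : Kbc ≤ cL := by unfold cL; nlinarith
  have hc4 : cT * (1 + Kbc) ≤ cL := by unfold cL; linarith
  have hA : ContDiff ℝ 1 fun w => (b w).1 := contDiff_fst.comp hb
  have hg : ContDiff ℝ 1 fun w => (b w).2 := contDiff_snd.comp hb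
  have hbd : ∀ w, HasFDerivAt b (fderiv ℝ b w) w := fun w => (hb.differentiable one_ne_zero w).hasFDerivAt
  have hA' : ∀ w, ‖fderiv ℝ (fun w => (b w).1) w‖ ≤ m' := fun w => by
    rw [(hbd w).fst.fderiv]
    refine (ContinuousLinearMap.opNorm_le_bound _ hm0' fun h => ?_)
    exact (norm_fst_le _).trans (((fderiv ℝ b w).le_opNorm h).trans (by gcongr; exact hm' w))
  have hg' : ∀ w, ‖fderiv ℝ (fun w => (b w).2) w‖ ≤ m' := fun w => by
    rw [(hbd w).snd.fderiv]
    refine (ContinuousLinearMap.opNorm_le_bound _ hm0' fun h => ?_)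
    exact (norm_snd_le _).trans (((fderiv ℝ b w).le_opNorm h).trans (by gcongr; exact hm' w))
  have hX : ContDiff ℝ 1 fun w => chi2 w • (b w).2 := by
    have := chi2_contDiff.smul hg
    exact this
  have hX0 : ∀ w, 1 < ‖w‖ → chi2 w • (b w).2 = 0 := fun w hw => by rw [chi2_zero (by linarith), zero_smul]
  have hXd : ∀ w, ‖fderiv ℝ (fun w => chi2 w • (b w).2) w‖ ≤ m' + Kbc * m := by
    intro w
    have e := (HasFDerivAt.fun_smul (𝕜' := ℂ) (chi2_contDiff.differentiable one_ne_zero w).hasFDerivAt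
      (hg.differentiable one_ne_zero w).hasFDerivAt).fderiv
    rw [e]
    refine (norm_add_le _ _).trans (add_le_add ?_ ?_)
    · rw [norm_smul]
      exact (mul_le_of_le_one_left (norm_nonneg _) (chi2_le w)).trans (hg' w)
    · refine ContinuousLinearMap.opNorm_le_bound _ (by positivity) fun h => ?_
      rw [ContinuousLinearMap.smulRight_apply, norm_smul]
      have h1 : ‖fderiv ℝ chi2 w h‖ ≤ Kbc * ‖h‖ := ((fderiv ℝ chi2 w).le_opNorm h).trans (by gcongr; exact chi2_fd w)
      have h2 : ‖(b w).2‖ ≤ m := (norm_snd_le _).trans (hm w)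
      calc _ ≤ (Kbc * ‖h‖) * m := by gcongr
        _ = _ := by ring
  have h1 : ContDiff ℝ 1 fun ζ => LI (fun w => (b w).1) (bet ζ) := (LI_contDiff hA).comp bet_contDiff
  have h2 : ContDiff ℝ 1 (CT (fun w => chi2 w • (b w).2)) := CT_contDiff hX hX0
  refine ⟨h1.prodMk h2, fun ζ => ?_, fun ζ => ?_⟩
  · unfold Lop
    rw [Prod.norm_mk]
    refine max_le ?_ ?_
    · refine (LI_le (m := m) (fun w hw => (norm_fst_le (b w)).trans (hm w)) (bet_mem ζ)).trans ?_
      exact mul_le_mul_of_nonneg_right (by linarith [bet_le ζ]) hm0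
    · refine ((chi2_adm (continuous_snd.comp hb.continuous).continuousOn hm0 fun w hw => (norm_snd_le (b w)).trans (hm w)).CT_le ζ).trans ?_
      exact mul_le_mul_of_nonneg_right hc2 hm0
  · have hd1 := (h1.differentiable one_ne_zero ζ).hasFDerivAt
    have hd2 := (h2.differentiable one_ne_zero ζ).hasFDerivAt
    have e : fderiv ℝ (Lop b) ζ = _ := (hd1.prodMk hd2).fderiv
    rw [e]
    have b1 : ‖fderiv ℝ (fun ζ => LI (fun w => (b w).1) (bet ζ)) ζ‖ ≤ cL * (m + m') := by
      have e1 := (((LI_contDiff hA).differentiable one_ne_zero (bet ζ)).hasFDerivAt.comp ζ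
        (bet_contDiff.differentiable one_ne_zero ζ).hasFDerivAt).fderiv
      have e2 : fderiv ℝ (fun ζ => LI (fun w => (b w).1) (bet ζ)) ζ = _ := e1
      rw [e2]
      refine (ContinuousLinearMap.opNorm_comp_le _ _).trans ?_
      have h3 := LI_deriv_le hA (fun w => (norm_fst_le (b w)).trans (hm w)) hA' (bet ζ)
      calc _ ≤ (m + ‖bet ζ‖ * m') * Kbc := mul_le_mul h3 (bet_fd ζ) (norm_nonneg _) (by positivity)
        _ ≤ (m + m') * Kbc := by
          refine mul_le_mul_of_nonneg_right ?_ (by linarith)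
          have := bet_le ζ
          nlinarith
        _ ≤ _ := by rw [mul_comm]; exact mul_le_mul_of_nonneg_right hc3 (by linarith)
    have b2 : ‖fderiv ℝ (CT (fun w => chi2 w • (b w).2)) ζ‖ ≤ cL * (m + m') := by
      refine (fderiv_CT_le hX hX0 hXd ζ).trans ?_
      calc cT * (m' + Kbc * m) ≤ cT * ((1 + Kbc) * (m + m')) := by gcongr; nlinarith
        _ = (cT * (1 + Kbc)) * (m + m') := by ring
        _ ≤ _ := mul_le_mul_of_nonneg_right hc4 (by linarith)
    refine ContinuousLinearMap.opNorm_le_bound _ ((norm_nonneg _).trans b1) fun h => ?_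
    rw [ContinuousLinearMap.prod_apply, Prod.norm_mk]
    refine max_le ?_ ?_
    · exact (ContinuousLinearMap.le_opNorm _ _).trans (mul_le_mul_of_nonneg_right b1 (norm_nonneg _))
    · exact (ContinuousLinearMap.le_opNorm _ _).trans (mul_le_mul_of_nonneg_right b2 (norm_nonneg _))

/-- solutions of the integral equation -/
def Sol (B : V × V → (ℂ →L[ℝ] V) × V) (κ : ℝ) (d z : ℂ → V × V) : Prop :=
  ContinuousOn z (ball 0 (1/2)) ∧ (∀ ζ ∈ ball (0:ℂ) (1/2), z ζ ∈ ball (0 : V × V) κ) ∧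
    ∀ ζ ∈ ball (0:ℂ) (1/2), z ζ = d ζ + Lop (fun w => B (z w)) ζ

lemma exists_sol [CompleteSpace V] {B : V × V → (ℂ →L[ℝ] V) × V} {κ η Λ : ℝ} (h : SmallNL B κ η Λ) (hη : cL * η ≤ 1/4)
    {d : ℂ → V × V} (hd : ContDiff ℝ 1 d) (hd1 : ∀ w, ‖d w‖ ≤ κ/2) {D0 : ℝ} (hd2 : ∀ w, ‖fderiv ℝ d w‖ ≤ D0) :
    ∃ z, ContDiff ℝ 1 z ∧ (∀ ζ, z ζ ∈ ball (0 : V × V) κ) ∧ Sol B κ d z := by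
  obtain ⟨z, h1, h2, h3⟩ := fix (Lo := Lop (V := V)) (c := cL) (by linarith [cL_pos])
    (fun b1 b2 h1 h2 ζ => Lop_sub_global h1.continuous h2.continuous ζ) Lop_C1 h hη hd hd1 hd2
  exact ⟨z, h1, h2, h1.continuous.continuousOn, fun ζ _ => h2 ζ, fun ζ _ => h3 ζ⟩

/-- stability -/
lemma Sol.stab [CompleteSpace V] {B : V × V → (ℂ →L[ℝ] V) × V} {κ η Λ : ℝ} (h : SmallNL B κ η Λ) (hη : cL * η ≤ 1/4)
    {d1 d2 z1 z2 : ℂ → V × V} (h1 : Sol B κ d1 z1) (h2 : Sol B κ d2 z2) {ε : ℝ}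
    (hε : ∀ w ∈ ball (0:ℂ) (1/2), ‖d1 w - d2 w‖ ≤ ε) :
    ∀ ζ ∈ ball (0:ℂ) (1/2), ‖z1 ζ - z2 ζ‖ ≤ 2 * ε ∧ ‖(z1 ζ - z2 ζ) - (d1 ζ - d2 ζ)‖ ≤ 2 * cL * η * ε := by
  have hcB : ContinuousOn B (ball 0 κ) := h.sm.continuousOn
  have hc1 : ContinuousOn (fun w => B (z1 w)) (ball 0 (1/2)) := hcB.comp h1.1 h1.2.1
  have hc2 : ContinuousOn (fun w => B (z2 w)) (ball 0 (1/2)) := hcB.comp h2.1 h2.2.1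
  have hε0 : 0 ≤ ε := (norm_nonneg _).trans (hε 0 (by simp))
  have hcL := cL_pos
  have hηn := h.ηnn
  have step : ∀ a, (∀ w ∈ ball (0:ℂ) (1/2), ‖z1 w - z2 w‖ ≤ a) → ∀ ζ ∈ ball (0:ℂ) (1/2),
      ‖(z1 ζ - z2 ζ) - (d1 ζ - d2 ζ)‖ ≤ cL * (η * a) := by
    intro a ha ζ hζ
    have e : (z1 ζ - z2 ζ) - (d1 ζ - d2 ζ) = Lop (fun w => B (z1 w) - B (z2 w)) ζ := by
      rw [← Lop_sub hc1 hc2 hζ]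
      conv_lhs => rw [h1.2.2 ζ hζ, h2.2.2 ζ hζ]
      abel
    rw [e]
    exact Lop_le (hc1.sub hc2) (fun w hw => (h.lip (h1.2.1 w hw) (h2.2.1 w hw)).trans
      (mul_le_mul_of_nonneg_left (ha w hw) hηn)) hζ
  have iter : ∀ k : ℕ, ∀ w ∈ ball (0:ℂ) (1/2), ‖z1 w - z2 w‖ ≤ 3/2 * ε + (2 * κ) * (1/4)^k := by
    intro k
    induction k with
    | zero =>
      intro w hw
      have a1 := h1.2.1 w hw
      have a2 := h2.2.1 w hw
      rw [mem_ball_zero_iff] at a1 a2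
      have := norm_sub_le (z1 w) (z2 w)
      simp; linarith
    | succ k ih =>
      intro w hw
      have a1 := step _ ih w hw
      have a2 := hε w hw
      have a3 : ‖z1 w - z2 w‖ ≤ ‖(z1 w - z2 w) - (d1 w - d2 w)‖ + ‖d1 w - d2 w‖ := by
        have := norm_add_le ((z1 w - z2 w) - (d1 w - d2 w)) (d1 w - d2 w)
        rwa [sub_add_cancel] at this
      have hk : 0 ≤ 3/2 * ε + (2 * κ) * (1/4)^k := by have := h.κpos; positivity
      rw [pow_succ]
      nlinarith [mul_le_mul_of_nonneg_right hη hk]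
  have lim : ∀ w ∈ ball (0:ℂ) (1/2), ‖z1 w - z2 w‖ ≤ 2 * ε := by
    intro w hw
    have : Tendsto (fun k : ℕ => 3/2 * ε + (2 * κ) * (1/4:ℝ)^k) atTop (𝓝 (3/2 * ε + (2 * κ) * 0)) :=
      ((_root_.tendsto_pow_atTop_nhds_zero_of_lt_one (by norm_num) (by norm_num)).const_mul _).const_add _
    have := ge_of_tendsto' this fun k => iter k w hw
    linarith
  exact fun ζ hζ => ⟨lim ζ hζ, (step _ lim ζ hζ).trans (by linarith)⟩
end Lop
end RH

open scoped ContDiff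
namespace RH
section BBsec
variable {V : Type*} [NormedAddCommGroup V] [NormedSpace ℂ V] [NormedSpace ℝ V] [IsScalarTower ℝ ℂ V]
variable {p : V} {δ C : ℝ} {P Q : V → V →L[ℝ] V}

/-- the full nonlinearity -/
noncomputable def BB (p : V) (P Q : V → V →L[ℝ] V) (z : V × V) : (ℂ →L[ℝ] V) × V :=
  ((P (p + z.1)).comp (mw z.2), NN P Q (p + z.1) z.2)

lemma add_mem_ball' {x : V} (hx : ‖x‖ < δ) : p + x ∈ ball p δ := by
  rw [mem_ball, dist_eq_norm, add_sub_cancel_left]; exact hx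

lemma mw_zero : mw (0:V) = 0 := by ext; simp

lemma BB_zero : BB p P Q 0 = 0 := by
  refine Prod.ext ?_ ?_
  · simp [BB, mw_zero]
  · simp [BB, NN]

lemma BB_contDiffAt (h : IsChart p δ C P Q) {z : V × V} (hz : ‖z.1‖ < δ) : ContDiffAt ℝ 2 (BB p P Q) z := by
  have hm := isOpen_ball.mem_nhds (add_mem_ball' (p := p) hz)
  have hP0 : ContDiffAt ℝ 2 P (p + z.1) := (h.smP.contDiffAt hm).of_le (WithTop.coe_le_coe.2 (le_top : (2:ℕ∞) ≤ ⊤))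
  have hQ0 : ContDiffAt ℝ 2 (fderiv ℝ Q) (p + z.1) := (h.smQ.contDiffAt hm).fderiv_right (by
    norm_num; exact WithTop.coe_le_coe.2 (le_top : (3:ℕ∞) ≤ ⊤))
  have ha : ContDiffAt ℝ 2 (fun z : V × V => p + z.1) z := contDiffAt_const.add contDiffAt_fst
  have hP : ContDiffAt ℝ 2 (fun z : V × V => P (p + z.1)) z := ContDiffAt.comp z hP0 ha
  have hQ : ContDiffAt ℝ 2 (fun z : V × V => fderiv ℝ Q (p + z.1)) z := ContDiffAt.comp z hQ0 ha
  have hmw : ContDiffAt ℝ 2 (fun z : V × V => mw z.2) z :=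
    (((ContinuousLinearMap.lsmul ℝ ℂ).flip : V →L[ℝ] (ℂ →L[ℝ] V)).contDiff.comp contDiff_snd).contDiffAt
  have hIw : ContDiffAt ℝ 2 (fun z : V × V => (I:ℂ) • z.2) z := contDiffAt_snd.const_smul _
  refine ContDiffAt.prodMk (hP.clm_comp hmw) ?_
  unfold NN
  refine ContDiffAt.const_smul _ ?_
  have hPI : ContDiffAt ℝ 2 (fun z : V × V => P (p + z.1) ((I:ℂ) • z.2)) z := hP.clm_apply hIw
  have hPw : ContDiffAt ℝ 2 (fun z : V × V => P (p + z.1) z.2) z := hP.clm_apply contDiffAt_snd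
  exact ((hQ.clm_apply hPI).clm_apply hPw).sub ((hQ.clm_apply hPw).clm_apply hPI)

lemma BB_deriv0 (h : IsChart p δ C P Q) (X Y : V) : fderiv ℝ (BB p P Q) 0 (X, Y) = ((P p).comp (mw Y), 0) := by
  have hm : p ∈ ball p δ := mem_ball_self h.pos
  have hP : HasFDerivAt (fun z : V × V => P (p + z.1)) ((fderiv ℝ P p).comp (ContinuousLinearMap.fst ℝ V V)) 0 := by
    have h1 : HasFDerivAt P (fderiv ℝ P p) (p + (0:V×V).1) := by simpa using h.hasP hm
    exact h1.comp (0:V×V) ((hasFDerivAt_fst).const_add p)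
  have hmw : HasFDerivAt (fun z : V × V => mw z.2)
      (((ContinuousLinearMap.lsmul ℝ ℂ).flip : V →L[ℝ] (ℂ →L[ℝ] V)).comp (ContinuousLinearMap.snd ℝ V V)) 0 :=
    (((ContinuousLinearMap.lsmul ℝ ℂ).flip : V →L[ℝ] (ℂ →L[ℝ] V)).comp (ContinuousLinearMap.snd ℝ V V)).hasFDerivAt
  have h1 := hP.clm_comp hmw
  have h2 : HasFDerivAt (fun z : V × V => NN P Q (p + z.1) z.2) (0 : V × V →L[ℝ] V) 0 := by
    refine Asymptotics.IsBigO.hasFDerivAt (n := 2) ?_ (by norm_num)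
    refine Asymptotics.IsBigO.of_bound (C^3) ?_
    filter_upwards [ball_mem_nhds (0:V×V) h.pos] with z hz
    rw [mem_ball_zero_iff] at hz
    have := h.NN_le (add_mem_ball' (p := p) ((norm_fst_le z).trans_lt hz)) z.2
    refine this.trans ?_
    have hC : 0 ≤ C := by linarith [h.Cpos]
    simp only [sub_zero, norm_pow, norm_norm]
    gcongr
    exact norm_snd_le z
  have h3 : fderiv ℝ (BB p P Q) 0 = _ := (h1.prodMk h2).fderiv
  rw [h3]
  refine Prod.ext ?_ ?_
  · ext u
    simp [mw_zero]
  · simp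

lemma BB_small (h : IsChart p δ C P Q) {η : ℝ} (hη : 0 < η) (hP : ‖P p‖ ≤ η / 2) :
    ∃ κ0 > 0, ∃ Λ, 0 ≤ Λ ∧ κ0 ≤ δ ∧ ∀ κ, 0 < κ → κ ≤ κ0 → SmallNL (BB p P Q) κ η Λ := by
  have h0 : ContDiffAt ℝ 2 (BB p P Q) 0 := BB_contDiffAt h (by simpa using h.pos)
  have h1 : ContDiffAt ℝ 1 (fderiv ℝ (BB p P Q)) 0 := h0.fderiv_right (by norm_num)
  obtain ⟨K, s, hs, hK⟩ := h1.exists_lipschitzOnWith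
  have hd0 : ‖fderiv ℝ (BB p P Q) 0‖ ≤ η / 2 := by
    refine ContinuousLinearMap.opNorm_le_bound _ (by linarith) fun z => ?_
    have e := BB_deriv0 h z.1 z.2
    rw [Prod.mk.eta] at e
    rw [e, Prod.norm_mk, norm_zero, max_eq_left (norm_nonneg _)]
    refine (ContinuousLinearMap.opNorm_comp_le _ _).trans ?_
    exact mul_le_mul hP ((norm_mw_le _).trans (norm_snd_le z)) (norm_nonneg _) (by linarith)
  obtain ⟨r, hr, hrs⟩ := Metric.mem_nhds_iff.1 hs
  set κ0 := min (min r δ) (η / 2 / (K + 1)) with hκ0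
  have hK0 : (0:ℝ) ≤ K := K.2
  refine ⟨κ0, ?_, K, K.2, (min_le_left _ _).trans (min_le_right _ _), fun κ hκ hκ1 => ?_⟩
  · have := h.pos
    refine lt_min (lt_min hr this) (by positivity)
  have k1 : κ ≤ r := hκ1.trans ((min_le_left _ _).trans (min_le_left _ _))
  have k2 : κ ≤ δ := hκ1.trans ((min_le_left _ _).trans (min_le_right _ _))
  have k3 : κ * (K + 1) ≤ η / 2 := (le_div_iff₀ (by positivity)).1 (hκ1.trans (min_le_right _ _))
  have hl : ∀ x ∈ ball (0:V×V) κ, ∀ y ∈ ball (0:V×V) κ, ‖fderiv ℝ (BB p P Q) x - fderiv ℝ (BB p P Q) y‖ ≤ K * ‖x - y‖ := by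
    intro x hx y hy
    have := hK.dist_le_mul x (hrs (ball_subset_ball k1 hx)) y (hrs (ball_subset_ball k1 hy))
    rwa [dist_eq_norm, dist_eq_norm] at this
  refine ⟨hκ, hη.le, K.2, BB_zero, fun x hx => ?_, fun x hx => ?_, hl⟩
  · rw [mem_ball_zero_iff] at hx
    exact ((BB_contDiffAt h (((norm_fst_le x).trans_lt hx).trans_le k2)).of_le (by norm_num)).contDiffWithinAt
  · have a1 := hl x hx 0 (mem_ball_self hκ)
    rw [mem_ball_zero_iff] at hx
    rw [sub_zero] at a1
    have a2 : ‖fderiv ℝ (BB p P Q) x‖ ≤ ‖fderiv ℝ (BB p P Q) x - fderiv ℝ (BB p P Q) 0‖ + ‖fderiv ℝ (BB p P Q) 0‖ := by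
      have := ContinuousLinearMap.opNorm_add_le (fderiv ℝ (BB p P Q) x - fderiv ℝ (BB p P Q) 0) (fderiv ℝ (BB p P Q) 0)
      rwa [sub_add_cancel] at this
    nlinarith

lemma IsChart.PQ' (h : IsChart p δ C P Q) {x : V} (hx : x ∈ ball p δ) (u v : V) :
    P x (fderiv ℝ Q x u v) = - fderiv ℝ P x u (Q x v) := by
  have h1 := (h.hasP hx).clm_apply ((h.hasQ hx).clm_apply (hasFDerivAt_const v x))
  have h2 : HasFDerivAt (fun y => P y (Q y v)) (0 : V →L[ℝ] V) x := by
    refine (hasFDerivAt_const v x).congr_of_eventuallyEq ?_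
    filter_upwards [isOpen_ball.mem_nhds hx] with y hy
    exact h.PQ y hy v
  have := congrArg (fun L : V →L[ℝ] V => L u) (h1.unique h2)
  simp at this
  exact eq_neg_of_add_eq_zero_left this

/-- solutions are pseudoholomorphic -/
lemma Sol.pHol [CompleteSpace V] (h : IsChart p δ C P Q) {κ : ℝ} (hκ : κ ≤ δ) (hCκ : C * κ ≤ 1) {t : V} {ψ : ℂ → V}
    (hψ : ContDiff ℝ 1 ψ) (hψd : ∀ ζ ∈ ball (0:ℂ) (1/4), dbar ψ ζ = 0) {z : ℂ → V × V} (hz : ContDiff ℝ 1 z)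
    (hzm : ∀ ζ, z ζ ∈ ball (0 : V × V) κ) (hs : Sol (BB p P Q) κ (fun ζ => (t, ψ ζ)) z) :
    PHol P (fun ζ => p + (z ζ).1) (fun ζ => (z ζ).2) (ball 0 (1/4)) := by
  set F : ℂ → V := fun ζ => p + (z ζ).1 with hF
  set W : ℂ → V := fun ζ => (z ζ).2 with hW
  have hzn : ∀ ζ, ‖z ζ‖ < κ := fun ζ => by simpa using hzm ζ
  have hFm : ∀ ζ, F ζ ∈ ball p δ := fun ζ => add_mem_ball' (((norm_fst_le _).trans_lt (hzn ζ)).trans_le hκ)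
  have hWn : ∀ ζ, ‖W ζ‖ ≤ κ := fun ζ => (norm_snd_le _).trans (hzn ζ).le
  have hFc : ContDiff ℝ 1 F := contDiff_const.add (contDiff_fst.comp hz)
  have hWc : ContDiff ℝ 1 W := contDiff_snd.comp hz
  have hb : ContDiff ℝ 1 fun w => BB p P Q (z w) := by
    rw [contDiff_iff_contDiffAt]
    intro w
    exact ((BB_contDiffAt h (((norm_fst_le _).trans_lt (hzn w)).trans_le hκ)).of_le (by norm_num)).comp w hz.contDiffAt
  set A : ℂ → ℂ →L[ℝ] V := fun w => (P (F w)).comp (mw (W w)) with hA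
  have hAc : ContDiff ℝ 1 A := contDiff_fst.comp hb
  have hN : ContDiff ℝ 1 fun w => NN P Q (F w) (W w) := contDiff_snd.comp hb
  have hFe : ∀ ζ ∈ ball (0:ℂ) (1/2), F ζ = (p + t) + LI A ζ := by
    intro ζ hζ
    have e := congrArg Prod.fst (hs.2.2 ζ hζ)
    have hbe : bet ζ = ζ := bet_id (by simp at hζ ⊢; linarith)
    simp only [Lop, hbe, Prod.fst_add] at e
    rw [hF]; beta_reduce; rw [e]
    rw [add_assoc]; rfl
  have hWe : ∀ ζ ∈ ball (0:ℂ) (1/2), W ζ = ψ ζ + CT (fun w => chi2 w • NN P Q (F w) (W w)) ζ := by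
    intro ζ hζ
    exact congrArg Prod.snd (hs.2.2 ζ hζ)
  have hg : ContDiff ℝ 1 fun w => chi2 w • NN P Q (F w) (W w) := by
    have := chi2_contDiff.smul hN
    exact this
  have hg0 : ∀ w, 1 < ‖w‖ → chi2 w • NN P Q (F w) (W w) = 0 := fun w hw => by rw [chi2_zero (by linarith), zero_smul]
  have hdW : ∀ ζ ∈ ball (0:ℂ) (1/4), fderiv ℝ W ζ 1 + I • fderiv ℝ W ζ I = (2:ℂ) • NN P Q (F ζ) (W ζ) := by
    intro ζ hζ
    have hζ2 : ζ ∈ ball (0:ℂ) (1/2) := ball_subset_ball (by norm_num) hζ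
    have e : fderiv ℝ W ζ = fderiv ℝ ψ ζ + fderiv ℝ (CT fun w => chi2 w • NN P Q (F w) (W w)) ζ := by
      have : W =ᶠ[𝓝 ζ] fun ζ => ψ ζ + CT (fun w => chi2 w • NN P Q (F w) (W w)) ζ := by
        filter_upwards [isOpen_ball.mem_nhds hζ2] with y hy using hWe y hy
      rw [this.fderiv_eq]
      exact fderiv_fun_add (hψ.differentiable one_ne_zero ζ) ((CT_contDiff hg hg0).differentiable one_ne_zero ζ)
    have d1 := hψd ζ hζ
    have d2 := dbar_CT hg hg0 ζ
    rw [chi2_one (by simp at hζ; rw [inv_eq_one_div] at hζ; linarith), one_smul] at d2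
    rw [e, ← d2]
    unfold dbar at d1 ⊢
    have d1' := congrArg (fun v => (2:ℂ) • v) d1
    simp only [smul_smul, smul_zero] at d1'
    norm_num at d1'
    simp only [add_apply, smul_add, smul_smul]
    norm_num
    rw [add_add_add_comm, d1', zero_add, show (2 * (1 / 2 * I) : ℂ) = I by ring]
  set e : ℂ → ℂ →L[ℝ] V := fun ζ => fderiv ℝ F ζ - A ζ with he
  have hec : Continuous e := (hFc.continuous_fderiv one_ne_zero).sub hAc.continuous
  have hFd : ∀ ζ ∈ ball (0:ℂ) (1/2), fderiv ℝ F ζ = fderiv ℝ (LI A) ζ := by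
    intro ζ hζ
    have : F =ᶠ[𝓝 ζ] fun ζ => (p + t) + LI A ζ := by
      filter_upwards [isOpen_ball.mem_nhds hζ] with y hy using hFe y hy
    rw [this.fderiv_eq, fderiv_const_add]
  have hC0 : 0 ≤ C := by linarith [h.Cpos]
  have hanti : ∀ w ∈ ball (0:ℂ) (1/4), fderiv ℝ A w 1 I - fderiv ℝ A w I 1 =
      fderiv ℝ P (F w) (e w 1) (I • W w) - fderiv ℝ P (F w) (e w I) (W w) := by
    intro w hw
    have hP : HasFDerivAt (fun w => P (F w)) ((fderiv ℝ P (F w)).comp (fderiv ℝ F w)) w :=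
      (h.hasP (hFm w)).comp w (hFc.differentiable one_ne_zero w).hasFDerivAt
    have hmw : HasFDerivAt (fun w => mw (W w))
      (((ContinuousLinearMap.lsmul ℝ ℂ).flip : V →L[ℝ] (ℂ →L[ℝ] V)).comp (fderiv ℝ W w)) w :=
      ((ContinuousLinearMap.lsmul ℝ ℂ).flip : V →L[ℝ] (ℂ →L[ℝ] V)).hasFDerivAt.comp w
        (hWc.differentiable one_ne_zero w).hasFDerivAt
    have hA' : fderiv ℝ A w = _ := (hP.clm_comp hmw).fderiv
    have key : ∀ a b : ℂ, fderiv ℝ A w a b = fderiv ℝ P (F w) (fderiv ℝ F w a) (b • W w) + P (F w) (b • fderiv ℝ W w a) := by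
      intro a b
      rw [hA']
      simp
      rw [add_comm]
    rw [key, key]
    have hF1 : fderiv ℝ F w 1 = P (F w) (W w) + e w 1 := by simp [he, hA]
    have hFI : fderiv ℝ F w I = P (F w) (I • W w) + e w I := by simp [he, hA]
    rw [hF1, hFI]
    have hN2 : (I:ℂ) • fderiv ℝ W w 1 - fderiv ℝ W w I = (2 * I : ℂ) • NN P Q (F w) (W w) := by
      have := congrArg (fun v => (I:ℂ) • v) (hdW w hw)
      simp only [smul_add, smul_smul, I_mul_I, neg_one_smul] at this
      rw [mul_comm, ← this]; abel
    have hP2 : P (F w) ((I:ℂ) • fderiv ℝ W w 1) - P (F w) (fderiv ℝ W w I) =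
        fderiv ℝ P (F w) (P (F w) (I • W w)) (W w) - fderiv ℝ P (F w) (P (F w) (W w)) (I • W w) := by
      rw [← map_sub, hN2, NN, smul_smul, show (2 * I * (I / 2) : ℂ) = -1 by ring_nf; simp, neg_one_smul, map_neg, map_sub,
        h.PQ' (hFm w), h.PQ' (hFm w), h.QP _ (hFm w), h.QP _ (hFm w)]
      abel
    simp only [one_smul, map_add, add_apply]
    rw [sub_eq_iff_eq_add] at hP2
    rw [hP2]
    abel
  have step : ∀ S, (∀ ζ ∈ ball (0:ℂ) (1/4), ‖e ζ‖ ≤ S) → ∀ ζ ∈ ball (0:ℂ) (1/4), ‖e ζ‖ ≤ S / 2 := by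
    intro S hS ζ hζ
    have hS0 : 0 ≤ S := (norm_nonneg _).trans (hS 0 (by simp))
    have hm : ∀ w ∈ ball (0:ℂ) (1/4), ‖fderiv ℝ A w 1 I - fderiv ℝ A w I 1‖ ≤ 2 * S := by
      intro w hw
      rw [hanti w hw]
      have hu : ∀ (a : ℂ) (v : V), ‖a‖ = 1 → ‖v‖ ≤ κ → ‖fderiv ℝ P (F w) (e w a) v‖ ≤ S := by
        intro a v ha hv
        have b1 := ContinuousLinearMap.le_opNorm (fderiv ℝ P (F w) (e w a)) v
        have b2 := ContinuousLinearMap.le_opNorm (fderiv ℝ P (F w)) (e w a)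
        have b3 := ContinuousLinearMap.le_opNorm (e w) a
        have b4 := h.bP' _ (hFm w)
        have b5 := hS w hw
        rw [ha, mul_one] at b3
        have hκ0 : 0 ≤ κ := (norm_nonneg v).trans hv
        calc _ ≤ _ := b1
          _ ≤ (C * S) * κ := mul_le_mul (b2.trans (mul_le_mul b4 (b3.trans b5) (norm_nonneg _) hC0)) hv (norm_nonneg _)
            (by positivity)
          _ = (C * κ) * S := by ring
          _ ≤ 1 * S := by gcongr
          _ = S := one_mul _
      have c1 := hu 1 (I • W w) (by simp) (by rw [norm_smul]; simpa using hWn w)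
      have c2 := hu I (W w) (by simp) (hWn w)
      refine (norm_sub_le _ _).trans (by linarith)
    have := LI_err hAc hm hζ
    have e1 : e ζ = fderiv ℝ (LI A) ζ - A ζ := by
      rw [he]; beta_reduce; rw [hFd ζ (ball_subset_ball (by norm_num) hζ)]
    rw [e1]
    rw [mem_ball_zero_iff] at hζ
    nlinarith
  obtain ⟨S0, hS0⟩ : ∃ S0, ∀ ζ ∈ closedBall (0:ℂ) (1/4), ‖e ζ‖ ≤ S0 :=
    (isCompact_closedBall _ _).exists_bound_of_continuousOn hec.continuousOn
  have iter : ∀ k : ℕ, ∀ ζ ∈ ball (0:ℂ) (1/4), ‖e ζ‖ ≤ S0 * (1/2)^k := by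
    intro k
    induction k with
    | zero => intro ζ hζ; simpa using hS0 ζ (ball_subset_closedBall hζ)
    | succ k ih =>
      intro ζ hζ
      have := step _ ih ζ hζ
      rw [pow_succ]; linarith
  intro ζ hζ
  have h0 : ‖e ζ‖ ≤ 0 := by
    have : Tendsto (fun k : ℕ => S0 * (1/2:ℝ)^k) atTop (𝓝 (S0 * 0)) :=
      (_root_.tendsto_pow_atTop_nhds_zero_of_lt_one (by norm_num) (by norm_num)).const_mul _
    rw [mul_zero] at this
    exact ge_of_tendsto' this fun k => iter k ζ hζ
  have h1 : e ζ = 0 := norm_le_zero_iff.1 h0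
  have h2 : fderiv ℝ F ζ = A ζ := sub_eq_zero.1 h1
  have h3 := (hFc.differentiable one_ne_zero ζ).hasFDerivAt
  rw [h2] at h3
  exact h3
end BBsec
end RH

open scoped ContDiff
namespace RH
section L0
/-- type synonym carrying another complex structure -/
def VJ (V : Type*) [AddCommGroup V] [Module ℝ V] (j : {j : Module.End ℝ V // j * j = -1}) : Type _ := V

variable {V : Type*} [AddCommGroup V] [Module ℝ V]

instance (j : {j : Module.End ℝ V // j * j = -1}) : AddCommGroup (VJ V j) := inferInstanceAs (AddCommGroup V)
instance (j : {j : Module.End ℝ V // j * j = -1}) : Module ℝ (VJ V j) := inferInstanceAs (Module ℝ V)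
noncomputable instance (j : {j : Module.End ℝ V // j * j = -1}) : Module ℂ (VJ V j) :=
  Module.compHom V (Complex.lift j).toRingHom

lemma VJ_smul (j : {j : Module.End ℝ V // j * j = -1}) (c : ℂ) (v : V) :
    (c • (show VJ V j from v) : VJ V j) = (Complex.lift j c) v := rfl

instance (j : {j : Module.End ℝ V // j * j = -1}) : IsScalarTower ℝ ℂ (VJ V j) := ⟨fun a b v => by
  have h : ∀ (c : ℂ) (w : VJ V j), c • w = (Complex.lift j c) (show V from w) := fun c w => rfl
  rw [h, h, map_smul]; rfl⟩

lemma exists_L0 {V : Type*} [AddCommGroup V] [Module ℂ V] [Module ℝ V] [IsScalarTower ℝ ℂ V] [Module.Finite ℝ V]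
    (j : V →ₗ[ℝ] V) (hj : ∀ v, j (j v) = -v) : ∃ L : V ≃ₗ[ℝ] V, ∀ w, j (L w) = L (I • w) := by
  let jj : {j : Module.End ℝ V // j * j = -1} := ⟨j, by ext v; simp [hj]⟩
  haveI : Module.Finite ℝ (VJ V jj) := inferInstanceAs (Module.Finite ℝ V)
  haveI : Module.Finite ℂ (VJ V jj) := Module.Finite.of_restrictScalars_finite ℝ ℂ _
  haveI : Module.Finite ℂ V := Module.Finite.of_restrictScalars_finite ℝ ℂ _
  have e1 := Module.finrank_mul_finrank ℝ ℂ (VJ V jj)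
  have e2 := Module.finrank_mul_finrank ℝ ℂ V
  have e3 : Module.finrank ℝ (VJ V jj) = Module.finrank ℝ V := rfl
  have e4 : Module.finrank ℂ V = Module.finrank ℂ (VJ V jj) := by
    rw [Complex.finrank_real_complex] at e1 e2; omega
  let L : V ≃ₗ[ℂ] VJ V jj := LinearEquiv.ofFinrankEq _ _ e4
  let L' : V ≃ₗ[ℝ] VJ V jj := L.restrictScalars ℝ
  refine ⟨L', fun w => ?_⟩
  have : L (I • w) = I • L w := map_smul _ _ _
  change j (L w) = L (I • w)
  rw [this]
  have h2 : (I • L w : VJ V jj) = (Complex.lift jj I) (show V from L w) := rfl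
  rw [h2, Complex.lift_apply, Complex.liftAux_apply_I]
end L0

section Charts
variable {V : Type*} [NormedAddCommGroup V] [NormedSpace ℂ V] [NormedSpace ℝ V] [IsScalarTower ℝ ℂ V]

lemma exists_chart [FiniteDimensional ℝ V] {Ω : Set V} (hΩ : IsOpen Ω) {J : V → V →L[ℝ] V} (hJs : ContDiffOn ℝ ∞ J Ω)
    (hJ : ∀ x ∈ Ω, ∀ v, J x (J x v) = -v) {p : V} (hp : p ∈ Ω) {l : ℝ} (hl : 0 < l) :
    ∃ δ C P Q, IsChart p δ C P Q ∧ ball p δ ⊆ Ω ∧ ‖P p‖ ≤ l ∧ ∀ x ∈ ball p δ, ∀ w, J x (P x w) = P x ((I:ℂ) • w) := by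
  haveI : CompleteSpace V := FiniteDimensional.complete ℝ V
  obtain ⟨L0, hL0⟩ := exists_L0 (J p : V →ₗ[ℝ] V) (hJ p hp)
  let L1 : V ≃L[ℝ] V := L0.toContinuousLinearEquiv
  set c : ℝ := l / (‖(L1 : V →L[ℝ] V)‖ + 1) with hc
  have hc0 : 0 < c := by positivity
  let L : V ≃L[ℝ] V := L1.trans (ContinuousLinearEquiv.smulLeft (Units.mk0 c hc0.ne'))
  have hLa : ∀ w, L w = c • L0 w := fun w => rfl
  have hLI : ∀ w, J p (L w) = L ((I:ℂ) • w) := fun w => by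
    rw [hLa, hLa, map_smul]; congr 1; exact hL0 w
  have hLn : ‖(L : V →L[ℝ] V)‖ ≤ l := by
    have e : (L : V →L[ℝ] V) = c • (L1 : V →L[ℝ] V) := by ext w; rfl
    rw [e, norm_smul, Real.norm_of_nonneg hc0.le, hc, div_mul_eq_mul_div, div_le_iff₀ (by positivity)]
    nlinarith [norm_nonneg (L1 : V →L[ℝ] V)]
  let P : V → V →L[ℝ] V := fun x => (1/2 : ℝ) • ((L : V →L[ℝ] V) - (J x).comp ((J p).comp (L : V →L[ℝ] V)))
  have hPa : ∀ x w, P x w = (1/2:ℝ) • (L w - J x (J p (L w))) := fun x w => rfl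
  have hPp : P p = L := by
    ext w
    rw [hPa, hJ p hp, sub_neg_eq_add, ← two_smul ℝ, smul_smul]; norm_num
  have hPJ : ∀ x ∈ Ω, ∀ w, J x (P x w) = P x ((I:ℂ) • w) := by
    intro x hx w
    rw [hPa, hPa, ← hLI, map_smul, map_sub, hJ x hx, hJ p hp, map_neg]
    congr 1; abel
  have hPs : ContDiffOn ℝ ∞ P Ω := by
    refine ContDiffOn.const_smul _ (contDiffOn_const.sub ?_)
    exact hJs.clm_comp contDiffOn_const
  let Q : V → V →L[ℝ] V := fun x => ContinuousLinearMap.inverse (P x)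
  have hpn := hΩ.mem_nhds hp
  have hPc : ContinuousAt P p := (hPs.contDiffAt hpn).continuousAt
  have hinv : ∀ᶠ x in 𝓝 p, P x ∈ range ((↑) : (V ≃L[ℝ] V) → V →L[ℝ] V) := by
    have := ContinuousLinearEquiv.nhds L
    rw [← hPp] at this
    exact hPc this
  have hev : ∀ᶠ x in 𝓝 p, x ∈ Ω ∧ P x ∈ range ((↑) : (V ≃L[ℝ] V) → V →L[ℝ] V) := Filter.Eventually.and hpn hinv
  have hQs : ∀ x ∈ Ω, P x ∈ range ((↑) : (V ≃L[ℝ] V) → V →L[ℝ] V) → ContDiffAt ℝ ∞ Q x := by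
    rintro x hx ⟨e, he⟩
    have h1 : ContDiffAt ℝ ∞ ContinuousLinearMap.inverse (P x) := by rw [← he]; exact contDiffAt_map_inverse e
    exact h1.comp x (hPs.contDiffAt (hΩ.mem_nhds hx))
  have hQp := hQs p hp ⟨L, hPp.symm⟩
  have hPpd := hPs.contDiffAt hpn
  have b1 : ∀ᶠ x in 𝓝 p, ‖P x‖ < ‖P p‖ + 1 := hPc.norm.eventually (gt_mem_nhds (by linarith))
  have b2 : ∀ᶠ x in 𝓝 p, ‖Q x‖ < ‖Q p‖ + 1 := hQp.continuousAt.norm.eventually (gt_mem_nhds (by linarith))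
  have b3 : ∀ᶠ x in 𝓝 p, ‖fderiv ℝ P x‖ < ‖fderiv ℝ P p‖ + 1 :=
    (hPpd.continuousAt_fderiv (by simp)).norm.eventually (gt_mem_nhds (by linarith))
  have b4 : ∀ᶠ x in 𝓝 p, ‖fderiv ℝ Q x‖ < ‖fderiv ℝ Q p‖ + 1 :=
    (hQp.continuousAt_fderiv (by simp)).norm.eventually (gt_mem_nhds (by linarith))
  obtain ⟨δ, hδ, hδb⟩ := Metric.eventually_nhds_iff_ball.1 (hev.and (b1.and (b2.and (b3.and b4))))
  have n1 := ContinuousLinearMap.opNorm_nonneg (P p)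
  have n2 := ContinuousLinearMap.opNorm_nonneg (Q p)
  have n3 := ContinuousLinearMap.opNorm_nonneg (fderiv ℝ P p)
  have n4 := ContinuousLinearMap.opNorm_nonneg (fderiv ℝ Q p)
  refine ⟨δ, ‖P p‖ + ‖Q p‖ + ‖fderiv ℝ P p‖ + ‖fderiv ℝ Q p‖ + 1, P, Q, ⟨hδ, by linarith, ?_, ?_, ?_, ?_, ?_, ?_, ?_, ?_⟩,
    fun x hx => (hδb x hx).1.1, by rw [hPp]; exact hLn, fun x hx => hPJ x (hδb x hx).1.1⟩
  · exact hPs.mono fun x hx => (hδb x hx).1.1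
  · exact fun x hx => (hQs x (hδb x hx).1.1 (hδb x hx).1.2).contDiffWithinAt
  · intro x hx w
    obtain ⟨e, he⟩ := (hδb x hx).1.2
    simp only [Q]; rw [← he, ContinuousLinearMap.inverse_equiv]; exact e.apply_symm_apply w
  · intro x hx w
    obtain ⟨e, he⟩ := (hδb x hx).1.2
    simp only [Q]; rw [← he, ContinuousLinearMap.inverse_equiv]; exact e.symm_apply_apply w
  · intro x hx; have := (hδb x hx).2.1; linarith
  · intro x hx; have := (hδb x hx).2.2.1; linarith
  · intro x hx; have := (hδb x hx).2.2.2.1; linarith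
  · intro x hx; have := (hδb x hx).2.2.2.2; linarith

end Charts

section JH
variable {n : ℕ} {J : Cn n → Cn n →L[ℝ] Cn n} {P Q : Cn n → Cn n →L[ℝ] Cn n} {p : Cn n} {δ C : ℝ}

lemma JstdC_apply (h : ℂ) : JstdC h = I * h := rfl

lemma pHol_of_JHol (h : IsChart p δ C P Q) (hPJ : ∀ x ∈ ball p δ, ∀ w, J x (P x w) = P x ((I:ℂ) • w)) {f : ℂ → Cn n}
    {s : Set ℂ} (hf : JHolOn J f s) (hfm : ∀ ζ ∈ s, f ζ ∈ ball p δ) :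
    PHol P f (fun ζ => Q (f ζ) (fderiv ℝ f ζ 1)) s := by
  intro ζ hζ
  obtain ⟨h1, h2⟩ := hf ζ hζ
  have e : (P (f ζ)).comp (mw (Q (f ζ) (fderiv ℝ f ζ 1))) = fderiv ℝ f ζ := by
    have hI : fderiv ℝ f ζ I = J (f ζ) (fderiv ℝ f ζ 1) := by
      have := congrArg (fun L : ℂ →L[ℝ] Cn n => L 1) h2
      simpa [JstdC_apply] using this
    have e1 : P (f ζ) (Q (f ζ) (fderiv ℝ f ζ 1)) = fderiv ℝ f ζ 1 := h.PQ _ (hfm ζ hζ) _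
    have e2 : P (f ζ) ((I:ℂ) • Q (f ζ) (fderiv ℝ f ζ 1)) = fderiv ℝ f ζ I := by
      rw [← hPJ _ (hfm ζ hζ), e1, hI]
    ext1 a
    have ha : a = a.re • (1:ℂ) + a.im • I := by
      rw [Complex.real_smul, Complex.real_smul, mul_one]; exact (re_add_im a).symm
    simp only [ContinuousLinearMap.comp_apply, mw_apply]
    conv_lhs => rw [ha]
    conv_rhs => rw [ha]
    rw [add_smul, smul_assoc, smul_assoc, one_smul, map_add, map_add, map_smul (P (f ζ)) a.re, map_smul (P (f ζ)) a.im,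
      map_smul (fderiv ℝ f ζ) a.re, map_smul (fderiv ℝ f ζ) a.im, e1, e2]
  rw [e]; exact h1.hasFDerivAt

lemma JHol_of_pHol (hPJ : ∀ x ∈ ball p δ, ∀ w, J x (P x w) = P x ((I:ℂ) • w)) {f W : ℂ → Cn n}
    {s : Set ℂ} (hf : PHol P f W s) (hfm : ∀ ζ ∈ s, f ζ ∈ ball p δ) : JHolOn J f s := by
  intro ζ hζ
  refine ⟨(hf ζ hζ).differentiableAt, ?_⟩
  rw [(hf ζ hζ).fderiv]
  ext1 a
  simp only [ContinuousLinearMap.comp_apply, mw_apply, JstdC_apply]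
  rw [hPJ _ (hfm ζ hζ), smul_smul]
end JH
end RH

open scoped ContDiff
namespace RH
section Fam
variable {V : Type*} [NormedAddCommGroup V] [NormedSpace ℂ V] [NormedSpace ℝ V] [IsScalarTower ℝ ℂ V] [CompleteSpace V]
variable {p : V} {δ C κ η Λ : ℝ} {P Q : V → V →L[ℝ] V}

lemma mkdisc (h : IsChart p δ C P Q) (hκ : κ ≤ δ) (hCκ : C * κ ≤ 1) (hs : SmallNL (BB p P Q) κ η Λ) (hη : cL * η ≤ 1/4)
    {ψ : ℂ → V} (hψ : ContDiff ℝ 1 ψ) (hψb : ∀ w, ‖ψ w‖ ≤ κ/2) {D0 : ℝ} (hψD : ∀ w, ‖fderiv ℝ ψ w‖ ≤ D0)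
    (hψd : ∀ ζ ∈ ball (0:ℂ) (1/4), dbar ψ ζ = 0) {t : V} (ht : ‖t‖ ≤ κ/2) :
    ∃ z : ℂ → V × V, Sol (BB p P Q) κ (fun ζ => (t, ψ ζ)) z ∧
      PHol P (fun ζ => p + (z ζ).1) (fun ζ => (z ζ).2) (ball 0 (1/4)) ∧ (z 0).1 = t ∧
      (∀ ζ, z ζ ∈ ball (0 : V × V) κ) ∧
      ∀ ζ ∈ ball (0:ℂ) (1/4), ∀ ζ' ∈ ball (0:ℂ) (1/4), ‖(z ζ).1 - (z ζ').1‖ ≤ ‖ζ - ζ'‖ := by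
  have hd : ContDiff ℝ 1 fun ζ => (t, ψ ζ) := contDiff_const.prodMk hψ
  have hD0 : 0 ≤ D0 := (norm_nonneg _).trans (hψD 0)
  have hdD : ∀ w, ‖fderiv ℝ (fun ζ => (t, ψ ζ)) w‖ ≤ D0 := by
    intro w
    have e := ((hasFDerivAt_const t w).prodMk (hψ.differentiable one_ne_zero w).hasFDerivAt).fderiv
    rw [e]
    refine ContinuousLinearMap.opNorm_le_bound _ hD0 fun a => ?_
    rw [ContinuousLinearMap.prod_apply, Prod.norm_mk]
    refine max_le ?_ ((ContinuousLinearMap.le_opNorm _ _).trans (mul_le_mul_of_nonneg_right (hψD w) (norm_nonneg _)))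
    simp; positivity
  obtain ⟨z, h1, h2, h3⟩ := exists_sol hs hη hd (fun w => by
    rw [Prod.norm_mk]; exact max_le ht (hψb w)) hdD
  have hp := h3.pHol h hκ hCκ hψ hψd h1 h2
  refine ⟨z, h3, hp, ?_, h2, ?_⟩
  · have e := congrArg Prod.fst (h3.2.2 0 (by simp))
    have hbe : bet 0 = 0 := bet_id (by simp)
    rw [Prod.fst_add] at e
    simp only [Lop, hbe] at e
    rw [e]
    simp [LI]
  · intro ζ hζ ζ' hζ'
    have key := (convex_ball (0:ℂ) (1/4)).norm_image_sub_le_of_norm_hasFDerivWithin_le (C := 1)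
      (fun x hx => (hp x hx).hasFDerivWithinAt) (fun x hx => by
        refine (ContinuousLinearMap.opNorm_comp_le _ _).trans ?_
        have hz := h2 x
        rw [mem_ball_zero_iff] at hz
        have b1 := h.bP (p + (z x).1) (add_mem_ball' (((norm_fst_le _).trans_lt hz).trans_le hκ))
        have b2 : ‖mw (z x).2‖ ≤ κ := (norm_mw_le _).trans ((norm_snd_le _).trans hz.le)
        have hC : 0 ≤ C := by linarith [h.Cpos]
        exact (mul_le_mul b1 b2 (norm_nonneg _) hC).trans hCκ) hζ' hζ
    simpa using key

/-- a pseudoholomorphic disc solves the integral equation -/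
lemma PHol.sol (h : IsChart p δ C P Q) (hκ : κ ≤ δ) {f W : ℂ → V} (hf : PHol P f W (ball 0 1))
    (hfm : ∀ z ∈ ball (0:ℂ) 1, f z ∈ ball p κ) {M : ℝ} (hM : ∀ z ∈ ball (0:ℂ) 1, ‖W z‖ ≤ M) (hMκ : M < κ) (hf0 : f 0 = p) :
    Sol (BB p P Q) κ (fun ζ => (0, CT (fun w => (1 - chi2 w) • g1 P Q f W w) ζ)) (fun ζ => (f ζ - p, W ζ)) := by
  have hfm' : ∀ z ∈ ball (0:ℂ) 1, f z ∈ ball p δ := fun z hz => ball_subset_ball hκ (hfm z hz)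
  have hWc : ContinuousOn W (ball 0 1) := hf.continuousOn h isOpen_ball hfm'
  have hfc : ContinuousOn f (ball 0 1) := fun x hx => (hf x hx).continuousAt.continuousWithinAt
  have hsub : ball (0:ℂ) (1/2) ⊆ ball 0 1 := ball_subset_ball (by norm_num)
  have hA : ContinuousOn (fun w => (P (f w)).comp (mw (W w))) (ball 0 1) := by
    have h1 : ContinuousOn (fun w => P (f w)) (ball 0 1) := h.smP.continuousOn.comp hfc hfm'
    have h2 : ContinuousOn (fun w => mw (W w)) (ball 0 1) :=
      ((ContinuousLinearMap.lsmul ℝ ℂ).flip : V →L[ℝ] (ℂ →L[ℝ] V)).continuous.comp_continuousOn hWc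
    exact h1.clm_comp h2
  refine ⟨((hfc.sub continuousOn_const).prodMk hWc).mono hsub, fun ζ hζ => ?_, fun ζ hζ => ?_⟩
  · rw [mem_ball_zero_iff, Prod.norm_mk]
    refine max_lt ?_ ((hM ζ (hsub hζ)).trans_lt hMκ)
    rw [← dist_eq_norm]; exact hfm ζ (hsub hζ)
  have hbe : bet ζ = ζ := bet_id (by simp at hζ ⊢; linarith)
  refine Prod.ext ?_ ?_
  · simp only [Lop, hbe, Prod.fst_add, zero_add]
    have e1 : (fun w => (BB p P Q (f w - p, W w)).1) = fun w => (P (f w)).comp (mw (W w)) := by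
      ext1 w; simp [BB]
    rw [e1]
    have hmem : ∀ s ∈ uIcc (0:ℝ) 1, s • ζ ∈ ball (0:ℂ) 1 := by
      intro s hs
      rw [uIcc_of_le zero_le_one] at hs
      have hζ' := hsub hζ
      rw [mem_ball_zero_iff] at hζ' ⊢
      rw [norm_smul, Real.norm_of_nonneg hs.1]
      nlinarith [norm_nonneg ζ, hs.2]
    have := intervalIntegral.integral_eq_sub_of_hasDerivAt (a := 0) (b := 1) (f := fun s : ℝ => f (s • ζ))
      (f' := fun s : ℝ => ((P (f (s • ζ))).comp (mw (W (s • ζ)))) ζ) (fun s hs => by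
        have h1 := hf (s • ζ) (hmem s hs)
        have h2 : HasDerivAt (fun s : ℝ => s • ζ) ζ s := by simpa using (hasDerivAt_id s).smul_const ζ
        exact h1.comp_hasDerivAt s h2) (by
        refine ContinuousOn.intervalIntegrable ?_
        exact ContinuousOn.clm_apply (hA.comp (by fun_prop) hmem) continuousOn_const)
    unfold LI
    rw [this]; simp [hf0]
  · simp only [Lop, Prod.snd_add]
    rw [rep h hf hfm' hM ζ hζ]
    have hg := g1_adm h hf hfm' hM
    have e2 : (fun w => chi2 w • (BB p P Q (f w - p, W w)).2) = fun w => chi2 w • g1 P Q f W w := by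
      ext1 w
      rcases lt_or_ge ‖w‖ (3/8) with hw | hw
      · simp only [BB, g1]
        rw [dbar_chi_in (by linarith), chi_one (by linarith)]
        simp
      · rw [chi2_zero hw]; simp
    rw [e2]
    have a1 : Adm (fun w => chi2 w • g1 P Q f W w) (1 * (Kchi * M + C ^ 3 * M ^ 2)) := by
      refine ⟨chi2_contDiff.continuous.aestronglyMeasurable.smul hg.1, fun w => ?_, fun w hw => by
        beta_reduce; rw [hg.2.2 w hw, smul_zero]⟩
      beta_reduce
      rw [norm_smul]; exact mul_le_mul (chi2_le w) (hg.2.1 w) (norm_nonneg _) zero_le_one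
    have a2 : Adm (fun w => (1 - chi2 w) • g1 P Q f W w) (2 * (Kchi * M + C ^ 3 * M ^ 2)) := by
      refine ⟨(continuous_const.sub chi2_contDiff.continuous).aestronglyMeasurable.smul hg.1, fun w => ?_, fun w hw => by
        beta_reduce; rw [hg.2.2 w hw, smul_zero]⟩
      beta_reduce
      rw [norm_smul]; refine mul_le_mul ?_ (hg.2.1 w) (norm_nonneg _) zero_le_two
      refine (norm_sub_le _ _).trans ?_
      have := chi2_le w
      rw [norm_one]; linarith
    rw [← CT_add a2 a1]
    congr 1
    ext1 w
    rw [← add_smul, sub_add_cancel, one_smul]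

lemma g1_cont (h : IsChart p δ C P Q) {f W : ℂ → V} (hf : PHol P f W (ball 0 1))
    (hfm : ∀ z ∈ ball (0:ℂ) 1, f z ∈ ball p δ) : Continuous (g1 P Q f W) := by
  have hWc : ContinuousOn W (ball 0 1) := hf.continuousOn h isOpen_ball hfm
  have hfc : ContinuousOn f (ball 0 1) := fun x hx => (hf x hx).continuousAt.continuousWithinAt
  rw [continuous_iff_continuousAt]
  intro w
  rcases lt_or_ge ‖w‖ 1 with hw | hw
  · have hw1 : w ∈ ball (0:ℂ) 1 := by simpa using hw
    have c1 := hWc.continuousAt (isOpen_ball.mem_nhds hw1)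
    have c2 := hfc.continuousAt (isOpen_ball.mem_nhds hw1)
    have hmem := isOpen_ball.mem_nhds (hfm w hw1)
    have cP : ContinuousAt (fun w => P (f w)) w :=
      ContinuousAt.comp (f := f) (g := P) (h.smP.continuousOn.continuousAt hmem) c2
    have cQ : ContinuousAt (fun w => fderiv ℝ Q (f w)) w :=
      ContinuousAt.comp (f := f) (g := fderiv ℝ Q) ((h.smQ.contDiffAt hmem).continuousAt_fderiv (by simp)) c2
    have cI : ContinuousAt (fun w => (I:ℂ) • W w) w := c1.const_smul _
    have cN : ContinuousAt (fun w => NN P Q (f w) (W w)) w := by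
      unfold NN
      exact (((cQ.clm_apply (cP.clm_apply cI)).clm_apply (cP.clm_apply c1)).sub
        ((cQ.clm_apply (cP.clm_apply c1)).clm_apply (cP.clm_apply cI))).const_smul _
    exact ((dbar_continuous chi_contDiff).continuousAt.smul c1).add (chi_contDiff.continuous.continuousAt.smul cN)
  · have : g1 P Q f W =ᶠ[𝓝 w] fun _ => 0 := by
      filter_upwards [(isOpen_lt continuous_const continuous_norm).mem_nhds (show 3/4 < ‖w‖ by linarith)] with y hy
      exact g1_zero P Q f W hy
    exact continuousAt_const.congr this.symm

/-- perturbation of a disc, in the unit scale -/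
lemma fam_unit (h : IsChart p δ C P Q) (hκ : κ ≤ δ) (hCκ : C * κ ≤ 1) (hs : SmallNL (BB p P Q) κ η Λ) (hη : cL * η ≤ 1/4)
    {f W : ℂ → V} (hf : PHol P f W (ball 0 1))
    (hfm : ∀ z ∈ ball (0:ℂ) 1, f z ∈ ball p κ) {M : ℝ} (hM : ∀ z ∈ ball (0:ℂ) 1, ‖W z‖ ≤ M) (hMκ : M < κ) (hf0 : f 0 = p)
    (hMs : cT * (2 * (Kchi * M + C ^ 3 * M ^ 2)) ≤ κ / 4) {ε : ℝ} (hε : 0 < ε) :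
    ∃ τ > 0, ∃ G : V → ℂ → V, ∃ W' : V → ℂ → V, ∀ t, ‖t‖ < τ → PHol P (G t) (W' t) (ball 0 (1/4)) ∧
      (∀ ζ, G t ζ ∈ ball p κ) ∧ G t 0 = p + t ∧ (∀ ζ ∈ ball (0:ℂ) (1/4), ‖G t ζ - f ζ‖ ≤ ε) ∧
      (∀ ζ ∈ ball (0:ℂ) (1/4), ∀ ζ' ∈ ball (0:ℂ) (1/4), ‖G t ζ - G t ζ'‖ ≤ ‖ζ - ζ'‖) ∧
      ∀ t', ‖t'‖ < τ → ∀ ζ ∈ ball (0:ℂ) (1/4), ‖(G t ζ - G t' ζ) - (t - t')‖ ≤ 1/2 * ‖t - t'‖ := by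
  have hκ0 := hs.κpos
  have hT := cT_pos
  have hfm' : ∀ z ∈ ball (0:ℂ) 1, f z ∈ ball p δ := fun z hz => ball_subset_ball hκ (hfm z hz)
  have hsol := hf.sol h hκ hfm hM hMκ hf0
  have hgc := g1_cont h hf hfm'
  have hgb := g1_bound h hfm' hM
  set m := Kchi * M + C ^ 3 * M ^ 2 with hm
  set ε1 := min (κ / 4) (ε / 2) with hε1
  have hεonep : 0 < ε1 := lt_min (by linarith) (by linarith)
  set ε2 := ε1 / (2 * cT) with hε2
  have hε2p : 0 < ε2 := by positivity
  have hε2e : cT * (2 * ε2) = ε1 := by rw [hε2]; field_simp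
  obtain ⟨g, hg1, hg2, hg3⟩ := hgc.exists_contDiff_approx 1 (ε := fun _ => ε2) continuous_const (fun _ => hε2p)
  have hg0 : ∀ w, 1 < ‖w‖ → g w = 0 := by
    intro w hw
    by_contra hne
    exact (hg3 hne) (g1_zero P Q f W (by linarith))
  have hgn : ∀ w, ‖g w - g1 P Q f W w‖ ≤ ε2 := fun w => by rw [← dist_eq_norm]; exact (hg2 w).le
  have h1c : ∀ w, ‖1 - chi2 w‖ ≤ 2 := fun w => by
    refine (norm_sub_le _ _).trans ?_
    have := chi2_le w
    rw [norm_one]; linarith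
  have hG : ContDiff ℝ 1 fun w => (1 - chi2 w) • g w := by
    have := (contDiff_const (c := (1:ℂ)) |>.sub chi2_contDiff).smul hg1
    exact this
  have hG0 : ∀ w, 1 < ‖w‖ → (1 - chi2 w) • g w = 0 := fun w hw => by rw [hg0 w hw, smul_zero]
  have hGa : Adm (fun w => (1 - chi2 w) • g w) (2 * (m + ε2)) := by
    refine ⟨hG.continuous.aestronglyMeasurable, fun w => ?_, hG0⟩
    beta_reduce
    rw [norm_smul]; refine mul_le_mul (h1c w) ?_ (norm_nonneg _) zero_le_two
    have := norm_add_le (g w - g1 P Q f W w) (g1 P Q f W w)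
    rw [sub_add_cancel] at this
    have := hgn w; have := hgb w; linarith
  have hg1a := g1_adm h hf hfm' hM
  have ha2 : Adm (fun w => (1 - chi2 w) • g1 P Q f W w) (2 * m) := by
    refine ⟨(continuous_const.sub chi2_contDiff.continuous).aestronglyMeasurable.smul hg1a.1, fun w => ?_, fun w hw => by
      beta_reduce; rw [hg1a.2.2 w hw, smul_zero]⟩
    beta_reduce
    rw [norm_smul]; exact mul_le_mul (h1c w) (hg1a.2.1 w) (norm_nonneg _) zero_le_two
  have hda : Adm (fun w => (1 - chi2 w) • (g w - g1 P Q f W w)) (2 * ε2) := by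
    refine ⟨(continuous_const.sub chi2_contDiff.continuous).aestronglyMeasurable.smul
      (hg1.continuous.sub hgc).aestronglyMeasurable, fun w => ?_, fun w hw => by
      beta_reduce; rw [hg1a.2.2 w hw, hg0 w hw, sub_zero, smul_zero]⟩
    beta_reduce
    rw [norm_smul]; exact mul_le_mul (h1c w) (hgn w) (norm_nonneg _) zero_le_two
  set ψ := CT fun w => (1 - chi2 w) • g w with hψ
  have hψc : ContDiff ℝ 1 ψ := CT_contDiff hG hG0
  have hψb : ∀ w, ‖ψ w‖ ≤ κ / 2 := fun w => by
    refine (hGa.CT_le w).trans ?_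
    have : ε1 ≤ κ / 4 := min_le_left _ _
    nlinarith
  obtain ⟨D1, hD1⟩ : ∃ D1, ∀ w, ‖fderiv ℝ (fun w => (1 - chi2 w) • g w) w‖ ≤ D1 :=
    ((hcs_of_zero hG0).fderiv ℝ).exists_bound_of_continuous (hG.continuous_fderiv one_ne_zero)
  have hψD : ∀ w, ‖fderiv ℝ ψ w‖ ≤ cT * D1 := fun w => fderiv_CT_le hG hG0 hD1 w
  have hψd : ∀ ζ ∈ ball (0:ℂ) (1/4), dbar ψ ζ = 0 := fun ζ hζ => by
    rw [hψ, dbar_CT hG hG0, chi2_one (by simpa using (mem_ball_zero_iff.1 hζ).le), sub_self, zero_smul]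
  have hex : ∀ t : V, ‖t‖ < ε1 → _ := fun t ht => mkdisc h hκ hCκ hs hη hψc hψb hψD hψd (t := t) (by
    have : ε1 ≤ κ / 4 := min_le_left _ _
    linarith)
  choose! z hz using hex
  refine ⟨ε1, hεonep, fun t ζ => p + (z t ζ).1, fun t ζ => (z t ζ).2, fun t ht => ?_⟩
  obtain ⟨z1, z2, z3, z4, z5⟩ := hz t ht
  have h4 : ball (0:ℂ) (1/4) ⊆ ball 0 (1/2) := ball_subset_ball (by norm_num)
  refine ⟨z2, fun ζ => add_mem_ball' ((norm_fst_le _).trans_lt (by simpa using z4 ζ)), by beta_reduce; rw [z3], fun ζ hζ => ?_,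
    fun ζ hζ ζ' hζ' => by simpa using z5 ζ hζ ζ' hζ', fun t' ht' ζ hζ => ?_⟩
  · have := (z1.stab hs hη hsol (ε := ε1) (fun w hw => by
      beta_reduce
      rw [Prod.mk_sub_mk, Prod.norm_mk, sub_zero]
      refine max_le ht.le ?_
      rw [hψ, ← CT_sub hGa ha2]
      simp only [← smul_sub]
      rw [← hε2e]
      exact hda.CT_le w) ζ (h4 hζ)).1
    have h5 := (norm_fst_le _).trans this
    have h6 : ε1 ≤ ε / 2 := min_le_right _ _
    have e : p + (z t ζ).1 - f ζ = (z t ζ - (f ζ - p, W ζ)).1 := by simp; abel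
    rw [e]; linarith
  · obtain ⟨y1, -⟩ := hz t' ht'
    have := (z1.stab hs hη y1 (ε := ‖t - t'‖) (fun w hw => by
      beta_reduce
      rw [Prod.mk_sub_mk, Prod.norm_mk, sub_self, norm_zero]
      exact max_le le_rfl (norm_nonneg _)) ζ (h4 hζ)).2
    have h5 := (norm_fst_le _).trans this
    simp only [Prod.fst_sub] at h5
    rw [add_sub_add_left_eq_sub]
    refine h5.trans ?_
    nlinarith [norm_nonneg (t - t')]

/-- the family of small discs through points near p -/
lemma famv_unit (h : IsChart p δ C P Q) (hκ : κ ≤ δ) (hCκ : C * κ ≤ 1) (hs : SmallNL (BB p P Q) κ η Λ) (hη : cL * η ≤ 1/4)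
    (hΛ : 2 * (Λ * κ) * (1 + C * cT) ≤ 1 / (2 * C)) :
    ∃ G : V → V → ℂ → V, ∃ W' : V → V → ℂ → V, ∀ t v, ‖t‖ ≤ κ/2 → ‖v‖ ≤ κ/2 → PHol P (G t v) (W' t v) (ball 0 (1/4)) ∧
      (∀ ζ, G t v ζ ∈ ball p κ) ∧ G t v 0 = p + t ∧ 
      (∀ ζ ∈ ball (0:ℂ) (1/4), ∀ ζ' ∈ ball (0:ℂ) (1/4), ‖G t v ζ - G t v ζ'‖ ≤ ‖ζ - ζ'‖) ∧
      (∀ t', ‖t'‖ ≤ κ/2 → ∀ ζ ∈ ball (0:ℂ) (1/4), ‖(G t v ζ - G t' v ζ) - (t - t')‖ ≤ 1/2 * ‖t - t'‖) ∧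
      ∀ v', ‖v'‖ ≤ κ/2 → ∀ ζ ∈ ball (0:ℂ) (1/4), ‖ζ‖ * (1 / (2 * C)) * ‖v - v'‖ ≤ ‖G t v ζ - G t v' ζ‖ := by
  have hκ0 := hs.κpos
  have hT := cT_pos
  have hC1 := h.Cpos
  have hC0 : 0 < C := by linarith
  have hL0 := hs.Λnn
  have hex : ∀ t v : V, ‖t‖ ≤ κ/2 → ‖v‖ ≤ κ/2 → _ := fun t v ht hv => mkdisc h hκ hCκ hs hη (ψ := fun _ => v) contDiff_const
    (fun _ => hv) (D0 := 0) (fun w => by simp) (fun ζ hζ => by simp [dbar]) (t := t) ht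
  choose! z hz using hex
  refine ⟨fun t v ζ => p + (z t v ζ).1, fun t v ζ => (z t v ζ).2, fun t v ht hv => ?_⟩
  obtain ⟨z1, z2, z3, z4, z5⟩ := hz t v ht hv
  have h4 : ball (0:ℂ) (1/4) ⊆ ball 0 (1/2) := ball_subset_ball (by norm_num)
  refine ⟨z2, fun ζ => add_mem_ball' ((norm_fst_le _).trans_lt (by simpa using z4 ζ)), by beta_reduce; rw [z3],
    fun ζ hζ ζ' hζ' => by simpa using z5 ζ hζ ζ' hζ', fun t' ht' ζ hζ => ?_, fun v' hv' ζ hζ => ?_⟩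
  · obtain ⟨y1, -⟩ := hz t' v ht' hv
    have := (z1.stab hs hη y1 (ε := ‖t - t'‖) (fun w hw => by
      beta_reduce
      rw [Prod.mk_sub_mk, Prod.norm_mk, sub_self, norm_zero]
      exact max_le le_rfl (norm_nonneg _)) ζ (h4 hζ)).2
    have h5 := (norm_fst_le _).trans this
    simp only [Prod.fst_sub] at h5
    rw [add_sub_add_left_eq_sub]
    refine h5.trans ?_
    nlinarith [norm_nonneg (t - t')]
  · obtain ⟨y1, y2, y3, y4, y5⟩ := hz t v' ht hv'
    set z' := z t v'
    set zz := z t v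
    have hzc := z1.1
    have hyc := y1.1
    have hst := fun ζ hζ => (z1.stab hs hη y1 (ε := ‖v - v'‖) (fun w hw => by
      beta_reduce
      rw [Prod.mk_sub_mk, Prod.norm_mk, sub_self, norm_zero]
      exact max_le (norm_nonneg _) le_rfl) ζ hζ).1
    set a := ‖v - v'‖ with ha
    have ha0 : 0 ≤ a := norm_nonneg _
    set μ := Λ * κ * (2 * a) with hμ
    have hμ0 : 0 ≤ μ := by positivity
    set D0 := fderiv ℝ (BB p P Q) 0 with hD0
    have hBd : ∀ w ∈ ball (0:ℂ) (1/2), ‖BB p P Q (zz w) - BB p P Q (z' w) - D0 (zz w - z' w)‖ ≤ μ := by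
      intro w hw
      refine ((convex_ball (0:V×V) κ).norm_image_sub_le_of_norm_fderiv_le' (𝕜 := ℝ) (C := Λ * κ)
        (fun x hx => (hs.has hx).differentiableAt) (fun x hx => ?_) (y4 w) (z4 w)).trans ?_
      · refine (hs.b2 x hx 0 (mem_ball_self hκ0)).trans ?_
        rw [mem_ball_zero_iff] at hx
        rw [sub_zero]; gcongr
      · exact mul_le_mul_of_nonneg_left (hst w hw) (by positivity)
    have hBc1 : ContinuousOn (fun w => BB p P Q (zz w)) (ball 0 (1/2)) := hs.sm.continuousOn.comp hzc fun w _ => z4 w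
    have hBc2 : ContinuousOn (fun w => BB p P Q (z' w)) (ball 0 (1/2)) := hs.sm.continuousOn.comp hyc fun w _ => y4 w
    have e : ∀ ζ ∈ ball (0:ℂ) (1/2), zz ζ - z' ζ = (0, v - v') + Lop (fun w => BB p P Q (zz w) - BB p P Q (z' w)) ζ := by
      intro ζ hζ
      rw [← Lop_sub hBc1 hBc2 hζ]
      conv_lhs => rw [z1.2.2 ζ hζ, y1.2.2 ζ hζ]
      rw [add_sub_add_comm, Prod.mk_sub_mk, sub_self]
    have hNd : ∀ w ∈ ball (0:ℂ) (1/2), ‖(BB p P Q (zz w) - BB p P Q (z' w)).2‖ ≤ μ := by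
      intro w hw
      have h1 := (norm_snd_le _).trans (hBd w hw)
      have h2 : (D0 (zz w - z' w)).2 = 0 := by
        have := BB_deriv0 h (zz w - z' w).1 (zz w - z' w).2
        rw [Prod.mk.eta] at this
        rw [hD0, this]
      rwa [Prod.snd_sub, h2, sub_zero] at h1
    have hWd : ∀ w ∈ ball (0:ℂ) (1/2), ‖(zz w).2 - (z' w).2 - (v - v')‖ ≤ cT * μ := by
      intro w hw
      have e2 := congrArg Prod.snd (e w hw)
      simp only [Prod.snd_sub, Prod.snd_add, Lop] at e2
      rw [e2, add_sub_cancel_left]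
      exact (chi2_adm (continuous_snd.comp_continuousOn (hBc1.sub hBc2)) hμ0 hNd).CT_le w
    have hAd : ∀ w ∈ ball (0:ℂ) (1/2), ‖(BB p P Q (zz w) - BB p P Q (z' w)).1 - (P p).comp (mw (v - v'))‖ ≤ μ * (1 + C * cT) := by
      intro w hw
      have h1 := (norm_fst_le _).trans (hBd w hw)
      have h2 : (D0 (zz w - z' w)).1 = (P p).comp (mw ((zz w).2 - (z' w).2)) := by
        have := BB_deriv0 h (zz w - z' w).1 (zz w - z' w).2
        rw [Prod.mk.eta] at this
        rw [hD0, this]; rfl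
      rw [Prod.fst_sub, h2] at h1
      have h3 : ‖(P p).comp (mw ((zz w).2 - (z' w).2)) - (P p).comp (mw (v - v'))‖ ≤ C * (cT * μ) := by
        have : (P p).comp (mw ((zz w).2 - (z' w).2)) - (P p).comp (mw (v - v')) =
            (P p).comp (mw ((zz w).2 - (z' w).2 - (v - v'))) := by
          ext u
          simp only [sub_apply, ContinuousLinearMap.comp_apply, mw_apply, ← map_sub, ← smul_sub]
        rw [this]
        refine (ContinuousLinearMap.opNorm_comp_le _ _).trans ?_
        exact mul_le_mul (h.bP p (mem_ball_self h.pos)) ((norm_mw_le _).trans (hWd w hw)) (norm_nonneg _) hC0.le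
      have h4 := norm_add_le _ _ |>.trans (add_le_add h1 h3)
      rw [sub_add_sub_cancel] at h4
      linarith
    have hζ2 := h4 hζ
    have hbe : bet ζ = ζ := bet_id (by simp at hζ2 ⊢; linarith)
    have e1 := congrArg Prod.fst (e ζ hζ2)
    simp only [Prod.fst_sub, Prod.fst_add, Lop, hbe, zero_add] at e1
    have hB1 : ContinuousOn (fun w => (BB p P Q (zz w) - BB p P Q (z' w)).1) (ball 0 (1/2)) :=
      continuous_fst.comp_continuousOn (hBc1.sub hBc2)
    have hsub := LI_sub hB1 (continuousOn_const (c := (P p).comp (mw (v - v')))) hζ2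
    have hle := LI_le (fun w hw => hAd w hw) hζ2
    rw [← hsub] at hle
    have hconst : LI (fun _ => (P p).comp (mw (v - v'))) ζ = P p (ζ • (v - v')) := by simp [LI]
    rw [hconst] at hle
    have hQ : ‖ζ‖ * a ≤ C * ‖P p (ζ • (v - v'))‖ := by
      have := (Q p).le_opNorm (P p (ζ • (v - v')))
      rw [h.QP p (mem_ball_self h.pos), norm_smul] at this
      exact this.trans (mul_le_mul_of_nonneg_right (h.bQ p (mem_ball_self h.pos)) (norm_nonneg _))
    have e3 : p + (zz ζ).1 - (p + (z' ζ).1) = LI (fun w => (BB p P Q (zz w) - BB p P Q (z' w)).1) ζ := by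
      rw [add_sub_add_left_eq_sub]; exact e1
    beta_reduce
    rw [e3]
    have h6 := norm_sub_norm_le (P p (ζ • (v - v'))) (P p (ζ • (v - v')) - LI (fun w => (BB p P Q (zz w) - BB p P Q (z' w)).1) ζ)
    rw [_root_.sub_sub_cancel, norm_sub_rev (P p (ζ • (v - v')))] at h6
    have h7 : μ * (1 + C * cT) ≤ 1 / (2 * C) * a := by
      rw [hμ]
      calc _ = 2 * (Λ * κ) * (1 + C * cT) * a := by ring
        _ ≤ _ := mul_le_mul_of_nonneg_right hΛ ha0
    have h8 : ‖ζ‖ * a * (1 / C) ≤ ‖P p (ζ • (v - v'))‖ := by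
      rw [mul_one_div, div_le_iff₀ hC0]; linarith
    have h9 : ‖ζ‖ * (μ * (1 + C * cT)) ≤ ‖ζ‖ * (1 / (2 * C) * a) := mul_le_mul_of_nonneg_left h7 (norm_nonneg _)
    have h10 : ‖ζ‖ * a * (1 / C) = 2 * (‖ζ‖ * (1 / (2 * C)) * a) := by field_simp
    linarith
end Fam
end RH

open scoped ContDiff
namespace RH
section JH2
variable {n : ℕ} {J : Cn n → Cn n →L[ℝ] Cn n}

lemma JHolOn.scale {f : ℂ → Cn n} {b : ℂ} {r R : ℝ} (hr : 0 < r) (hrR : r ≤ R) (hf : JHolOn J f (ball b R)) :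
    JHolOn J (fun ζ => f (b + (r:ℂ) * ζ)) (ball 0 1) := by
  intro ζ hζ
  have h1 : HasFDerivAt (fun ζ : ℂ => b + (r:ℂ) * ζ) (r • ContinuousLinearMap.id ℝ ℂ) ζ := by
    have := ((hasFDerivAt_id (𝕜 := ℝ) ζ).const_mul (r:ℂ)).const_add b
    refine this.congr_fderiv ?_
    ext1 a; simp
  obtain ⟨h2, h3⟩ := hf _ (aff_mem hr hrR hζ)
  have h4 := h2.hasFDerivAt.comp ζ h1
  have h5 : HasFDerivAt (fun ζ => f (b + (r:ℂ) * ζ)) ((fderiv ℝ f (b + (r:ℂ) * ζ)).comp (r • ContinuousLinearMap.id ℝ ℂ)) ζ := h4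
  refine ⟨h5.differentiableAt, ?_⟩
  rw [h5.fderiv]
  ext1 a
  have := congrArg (fun L : ℂ →L[ℝ] Cn n => L (r • a)) h3
  simp only [ContinuousLinearMap.comp_apply, JstdC_apply, smul_apply, ContinuousLinearMap.id_apply] at this ⊢
  rw [← this]
  congr 1
  simp [mul_left_comm]

lemma exists_good_chart {Ω : Set (Cn n)} (hΩ : IsOpen Ω) (hJ : IsACS Ω J) {p : Cn n} (hp : p ∈ Ω) :
    ∃ δ C P Q, IsChart p δ C P Q ∧ ball p δ ⊆ Ω ∧ (∀ x ∈ ball p δ, ∀ w, J x (P x w) = P x ((I:ℂ) • w)) ∧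
      ∃ κ0 > 0, ∃ η Λ, 0 ≤ Λ ∧ cL * η ≤ 1/4 ∧ κ0 ≤ δ ∧ C * κ0 ≤ 1 ∧ ∀ κ, 0 < κ → κ ≤ κ0 → SmallNL (BB p P Q) κ η Λ := by
  have hc := cL_pos
  obtain ⟨δ, C, P, Q, h, hs, hl, hPJ⟩ := exists_chart hΩ hJ.1 (fun x hx v => by
    have := congrArg (fun L : Cn n →L[ℝ] Cn n => L v) (hJ.2 x hx)
    simpa using this) hp (l := 1 / (8 * cL)) (by positivity)
  obtain ⟨κ0, hκ0, Λ, hΛ, hκδ, hκ⟩ := BB_small h (η := 1 / (4 * cL)) (by positivity) (by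
    refine hl.trans (le_of_eq ?_); field_simp; norm_num)
  have hC := h.Cpos
  refine ⟨δ, C, P, Q, h, hs, hPJ, min κ0 (1 / C), lt_min hκ0 (by positivity), 1 / (4 * cL), Λ, hΛ, ?_, (min_le_left _ _).trans hκδ, ?_, 
    fun κ h1 h2 => hκ κ h1 (h2.trans (min_le_left _ _))⟩
  · apply le_of_eq; field_simp
  · calc C * min κ0 (1 / C) ≤ C * (1 / C) := by gcongr; exact min_le_right _ _
      _ = 1 := by field_simp

lemma half_le {V : Type*} [NormedAddCommGroup V] {x t : V} (h : ‖x - t‖ ≤ 1/2 * ‖t‖) : 1/2 * ‖t‖ ≤ ‖x‖ := by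
  have : ‖t‖ ≤ ‖x‖ + ‖x - t‖ := by
    have := norm_sub_le x (x - t); simpa using this
  linarith

theorem FAM {Ω : Set (Cn n)} (hΩ : IsOpen Ω) (hJ : IsACS Ω J) {f : ℂ → Cn n} {b : ℂ} {R : ℝ} (hR : 0 < R)
    (hf : JHolOn J f (ball b R)) (hfm : MapsTo f (ball b R) Ω) :
    ∃ ρ0 > 0, ρ0 ≤ R ∧ ∀ ρ, 0 < ρ → ρ ≤ ρ0 → ∀ ε > 0, ∃ τ > 0, ∃ G : Cn n → ℂ → Cn n, ∀ t, ‖t‖ < τ →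
      JHolOn J (G t) (ball 0 (1/4)) ∧ (∀ ζ, G t ζ ∈ Ω) ∧ G t 0 = f b + t ∧
      (∀ ζ ∈ ball (0:ℂ) (1/4), ‖G t ζ - f (b + (ρ:ℂ) * ζ)‖ ≤ ε) ∧
      (∀ ζ ∈ ball (0:ℂ) (1/4), ∀ ζ' ∈ ball (0:ℂ) (1/4), ‖G t ζ - G t ζ'‖ ≤ ‖ζ - ζ'‖) ∧
      ∀ t', ‖t'‖ < τ → ∀ ζ ∈ ball (0:ℂ) (1/4), 1/2 * ‖t - t'‖ ≤ ‖G t ζ - G t' ζ‖ := by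
  have hbR : b ∈ ball b R := mem_ball_self hR
  obtain ⟨δ, C, P, Q, h, hs, hPJ, κ, hκ, η, Λ, hΛ, hη, hκδ, hCκ, hNL⟩ := exists_good_chart hΩ hJ (hfm hbR)
  have hC := h.Cpos
  have hcont : ContinuousAt f b := (hf b hbR).1.continuousAt
  obtain ⟨R1, hR1, hR1s⟩ := Metric.mem_nhds_iff.1 (hcont.preimage_mem_nhds (ball_mem_nhds _ hκ))
  set R2 := min R R1 with hR2
  have hR2p : 0 < R2 := lt_min hR hR1
  have hm2 : ∀ ζ ∈ ball b R2, f ζ ∈ ball (f b) κ := fun ζ hζ => hR1s (ball_subset_ball (min_le_right _ _) hζ)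
  have hP := pHol_of_JHol h hPJ (s := ball b R2) (fun ζ hζ => hf ζ (ball_subset_ball (min_le_left _ _) hζ))
    (fun ζ hζ => ball_subset_ball hκδ (hm2 ζ hζ))
  set W : ℂ → Cn n := fun ζ => Q (f ζ) (fderiv ℝ f ζ 1) with hW
  obtain ⟨M, r, hr, hM⟩ := hP.bddNear h isOpen_ball (fun ζ hζ => ball_subset_ball hκδ (hm2 ζ hζ)) b (mem_ball_self hR2p)
  have hM0 : 0 ≤ M := (norm_nonneg _).trans (hM b (mem_ball_self hr))
  have hK := Kchi_nonneg
  have hT := cT_pos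
  have ev : ∀ᶠ ρ : ℝ in 𝓝 0, ρ * M < κ ∧ cT * (2 * (Kchi * (ρ * M) + C ^ 3 * (ρ * M) ^ 2)) < κ / 4 := by
    refine Filter.Eventually.and ?_ ?_
    · have : Tendsto (fun ρ : ℝ => ρ * M) (𝓝 0) (𝓝 (0 * M)) := Continuous.tendsto (by fun_prop) 0
      exact this.eventually_lt_const (by simpa using hκ)
    · have : Tendsto (fun ρ : ℝ => cT * (2 * (Kchi * (ρ * M) + C ^ 3 * (ρ * M) ^ 2))) (𝓝 0) (𝓝 (cT * (2 * (Kchi * (0 * M) + C ^ 3 * (0 * M) ^ 2)))) := 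
        Continuous.tendsto (by fun_prop) 0
      exact this.eventually_lt_const (by simp; exact hκ)
  obtain ⟨ρ1, hρ1, hρ1s⟩ := Metric.mem_nhds_iff.1 ev
  refine ⟨min (ρ1/2) (min R2 r), lt_min (by linarith) (lt_min hR2p hr), (min_le_right _ _).trans ((min_le_left _ _).trans (min_le_left _ _)),
    fun ρ hρ hρ0 ε hε => ?_⟩
  have a1 : ρ ≤ ρ1/2 := hρ0.trans (min_le_left _ _)
  have a2 : ρ ≤ R2 := hρ0.trans ((min_le_right _ _).trans (min_le_left _ _))
  have a3 : ρ ≤ r := hρ0.trans ((min_le_right _ _).trans (min_le_right _ _))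
  have hsm := hρ1s (show ρ ∈ ball (0:ℝ) ρ1 by rw [mem_ball, dist_zero_right, Real.norm_of_nonneg hρ.le]; linarith)
  obtain ⟨τ, hτ, G, W', hG⟩ := fam_unit h hκδ hCκ (hNL κ hκ le_rfl) hη (hP.scale hρ a2)
    (fun z hz => hm2 _ (aff_mem hρ a2 hz)) (M := ρ * M) (fun z hz => by
      rw [norm_smul, norm_real, Real.norm_of_nonneg hρ.le]
      exact mul_le_mul_of_nonneg_left (hM _ (aff_mem hρ a3 hz)) hρ.le) hsm.1 (by simp) hsm.2.le hε
  refine ⟨τ, hτ, G, fun t ht => ?_⟩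
  obtain ⟨g1, g2, g3, g4, g5, g6⟩ := hG t ht
  exact ⟨JHol_of_pHol hPJ g1 fun ζ _ => ball_subset_ball hκδ (g2 ζ), fun ζ => hs (ball_subset_ball hκδ (g2 ζ)), g3, g4, g5,
    fun t' ht' ζ hζ => half_le (g6 t' ht' ζ hζ)⟩

theorem FAMv {Ω : Set (Cn n)} (hΩ : IsOpen Ω) (hJ : IsACS Ω J) {p : Cn n} (hp : p ∈ Ω) :
    ∃ τ > 0, ∃ c > 0, ∃ G : Cn n → Cn n → ℂ → Cn n, ∀ t v, ‖t‖ < τ → ‖v‖ < τ →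
      JHolOn J (G t v) (ball 0 (1/4)) ∧ (∀ ζ, G t v ζ ∈ Ω) ∧ G t v 0 = p + t ∧
      (∀ ζ ∈ ball (0:ℂ) (1/4), ∀ ζ' ∈ ball (0:ℂ) (1/4), ‖G t v ζ - G t v ζ'‖ ≤ ‖ζ - ζ'‖) ∧
      (∀ t', ‖t'‖ < τ → ∀ ζ ∈ ball (0:ℂ) (1/4), 1/2 * ‖t - t'‖ ≤ ‖G t v ζ - G t' v ζ‖) ∧
      (∀ t', ‖t'‖ < τ → ∀ ζ ∈ ball (0:ℂ) (1/4), ‖G t v ζ - G t' v ζ‖ ≤ 2 * ‖t - t'‖) ∧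
      (∀ v', ‖v'‖ < τ → ∀ ζ ∈ ball (0:ℂ) (1/4), ‖ζ‖ * c * ‖v - v'‖ ≤ ‖G t v ζ - G t v' ζ‖) := by
  obtain ⟨δ, C, P, Q, h, hs, hPJ, κ0, hκ0, η, Λ, hΛ, hη, hκδ0, hCκ0, hNL⟩ := exists_good_chart hΩ hJ hp
  have hC := h.Cpos
  have hT := cT_pos
  set κ := min κ0 (1 / (2 * C) / (2 * (Λ + 1) * (1 + C * cT))) with hκd
  have hκ : 0 < κ := lt_min hκ0 (by positivity)
  have hκle : κ ≤ κ0 := min_le_left _ _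
  have hCκ : C * κ ≤ 1 := (mul_le_mul_of_nonneg_left hκle (by linarith)).trans hCκ0
  have hsm : 2 * (Λ * κ) * (1 + C * cT) ≤ 1 / (2 * C) := by
    calc 2 * (Λ * κ) * (1 + C * cT) ≤ (2 * (Λ + 1) * (1 + C * cT)) * κ := by
          have : 0 ≤ κ * (1 + C * cT) := by positivity
          nlinarith
      _ ≤ (2 * (Λ + 1) * (1 + C * cT)) * (1 / (2 * C) / (2 * (Λ + 1) * (1 + C * cT))) := by
          gcongr; exact min_le_right _ _
      _ = _ := by field_simp
  obtain ⟨G, W', hG⟩ := famv_unit h (hκle.trans hκδ0) hCκ (hNL κ hκ hκle) hη hsm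
  refine ⟨κ/2, by linarith, 1/(2*C), by positivity, G, fun t v ht hv => ?_⟩
  obtain ⟨g1, g2, g3, g4, g5, g6⟩ := hG t v ht.le hv.le
  have hsub : ball p κ ⊆ ball p δ := ball_subset_ball (hκle.trans hκδ0)
  refine ⟨JHol_of_pHol hPJ g1 fun ζ _ => hsub (g2 ζ), fun ζ => hs (hsub (g2 ζ)), g3, g4, 
    fun t' ht' ζ hζ => half_le (g5 t' ht'.le ζ hζ), fun t' ht' ζ hζ => ?_, fun v' hv' => g6 v' hv'.le⟩
  have h1 := g5 t' ht'.le ζ hζ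
  have h2 := norm_sub_norm_le (G t v ζ - G t' v ζ) (t - t')
  linarith [norm_nonneg (t - t')]
end JH2
end RH

open scoped ContDiff
namespace RH
section Pot

/-- sub mean value property against continuous majorants -/
def SubM (h : ℂ → EReal) (a : ℂ) (r : ℝ) : Prop :=
  ∀ φ : ℂ → ℝ, ContinuousOn φ (sphere a r) → (∀ z ∈ sphere a r, h z < (φ z : EReal)) → h a ≤ ((Real.circleAverage φ a r : ℝ) : EReal)

lemma trig_approx {f : AddCircle (2 * Real.pi) → ℂ} (hf : Continuous f) {ε : ℝ} (hε : 0 < ε) :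
    ∃ F : ℂ → ℂ, Differentiable ℂ F ∧ ∀ θ, |(F (AddCircle.toCircle θ : ℂ)).re - (f θ).re| < ε := by
  haveI : Fact (0 < 2 * Real.pi) := ⟨Real.two_pi_pos⟩
  have h1 : (⟨f, hf⟩ : C(AddCircle (2 * Real.pi), ℂ)) ∈ (Submodule.span ℂ (range <| @fourier (2 * Real.pi))).topologicalClosure := by
    rw [span_fourier_closure_eq_top]; trivial
  rw [← SetLike.mem_coe, Submodule.topologicalClosure_coe] at h1
  obtain ⟨g, hg, hgd⟩ := Metric.mem_closure_iff.1 h1 ε hε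
  have key : ∃ F G : ℂ → ℂ, Differentiable ℂ F ∧ Differentiable ℂ G ∧ ∀ θ, g θ = F (AddCircle.toCircle θ : ℂ) + (starRingEnd ℂ) (G (AddCircle.toCircle θ : ℂ)) := by
    clear hgd
    rw [SetLike.mem_coe] at hg
    induction hg using Submodule.span_induction with
    | mem x hx =>
      obtain ⟨k, rfl⟩ := hx
      obtain ⟨m, rfl | rfl⟩ := k.eq_nat_or_neg
      · refine ⟨fun z => z ^ m, fun _ => 0, by fun_prop, by fun_prop, fun θ => ?_⟩
        simp [fourier_apply, AddCircle.toCircle_nsmul]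
      · refine ⟨fun z => 0, fun z => z ^ m, by fun_prop, by fun_prop, fun θ => ?_⟩
        rw [fourier_neg]
        simp [fourier_apply, AddCircle.toCircle_nsmul]
    | zero => exact ⟨fun _ => 0, fun _ => 0, by fun_prop, by fun_prop, fun θ => by simp⟩
    | add x y _ _ hx hy =>
      obtain ⟨F, G, hF, hG, h⟩ := hx
      obtain ⟨F', G', hF', hG', h'⟩ := hy
      exact ⟨F + F', G + G', hF.add hF', hG.add hG', fun θ => by simp [h, h']; ring⟩
    | smul c x _ hx =>
      obtain ⟨F, G, hF, hG, h⟩ := hx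
      exact ⟨c • F, (starRingEnd ℂ c) • G, hF.const_smul c, hG.const_smul _, fun θ => by simp [h]; ring⟩
  obtain ⟨F, G, hF, hG, h⟩ := key
  refine ⟨F + G, hF.add hG, fun θ => ?_⟩
  have h2 := (ContinuousMap.dist_lt_iff hε).1 hgd θ
  rw [dist_comm, dist_eq_norm] at h2
  have h3 := (abs_re_le_norm (g θ - f θ)).trans_lt h2
  rw [h] at h3
  simpa using h3

lemma harm_approx {φ : ℂ → ℝ} {a : ℂ} {R : ℝ} (hR : 0 < R) (hφ : ContinuousOn φ (sphere a R)) {ε : ℝ} (hε : 0 < ε) :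
    ∃ F : ℂ → ℂ, Differentiable ℂ F ∧ ∀ z ∈ sphere a R, |(F z).re - φ z| < ε := by
  have hc : Continuous fun θ : AddCircle (2 * Real.pi) => ((φ (a + R * (AddCircle.toCircle θ : ℂ)) : ℝ) : ℂ) := by
    refine Complex.continuous_ofReal.comp (hφ.comp_continuous ?_ fun θ => ?_)
    · have : Continuous (AddCircle.toCircle (T := 2 * Real.pi)) := AddCircle.continuous_toCircle
      fun_prop
    · simp [abs_of_pos hR, Circle.norm_coe]
  obtain ⟨F, hF, h⟩ := trig_approx hc hε
  refine ⟨fun z => F ((z - a) / R), by fun_prop, fun z hz => ?_⟩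
  have hR' : (R:ℂ) ≠ 0 := by exact_mod_cast hR.ne'
  have h1 : ‖(z - a) / R‖ = 1 := by
    rw [mem_sphere, dist_eq_norm] at hz
    rw [norm_div, hz, norm_real, Real.norm_of_nonneg hR.le, div_self hR.ne']
  haveI : Fact (0 < 2 * Real.pi) := ⟨Real.two_pi_pos⟩
  obtain ⟨θ, hθ⟩ : ∃ θ : AddCircle (2 * Real.pi), (AddCircle.toCircle θ : ℂ) = (z - a) / R := by
    refine ⟨((arg ((z - a) / R) : ℝ) : AddCircle (2 * Real.pi)), ?_⟩
    rw [AddCircle.toCircle_apply_mk]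
    have := norm_mul_exp_arg_mul_I ((z - a) / R)
    rw [h1] at this
    rw [Circle.coe_exp]
    have hp : (2 * Real.pi) / (2 * Real.pi) = 1 := div_self Real.two_pi_pos.ne'
    rw [hp, one_mul]; simpa using this
  have := h θ
  rw [hθ] at this
  have e : a + R * ((z - a) / R) = z := by field_simp; ring
  rw [e] at this
  simpa using this
end Pot
end RH

open scoped ContDiff
namespace RH
section Pot2

lemma norm_circle_id (a z0 z : ℂ) : ‖z - a‖ ^ 2 = ‖z0 - a‖ ^ 2 + (2 * (starRingEnd ℂ (z0 - a)) * (z - z0)).re + ‖z - z0‖ ^ 2 := by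
  simp only [Complex.sq_norm, normSq_apply, mul_re, mul_im, conj_re, conj_im, sub_re, sub_im, re_ofNat, im_ofNat]
  ring

lemma max_step {h : ℂ → EReal} {F f : ℂ → ℂ} {a : ℂ} {R ε η c0 : ℝ} (hF : Differentiable ℂ F) (hf : Differentiable ℂ f)
    (husc : UpperSemicontinuousOn h (closedBall a R)) (hT : ∀ z ∈ closedBall a R, h z < ⊤) (hε : 0 < ε) (hη : 0 < η)
    (hsph : ∀ z ∈ sphere a R, f z ≠ 0 → h z < (((F z).re + c0 - ε * ‖z - a‖ ^ 2 - η * Real.log ‖f z‖ : ℝ) : EReal))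
    (hs : ∀ b ∈ ball a R, f b ≠ 0 → ∃ r0 > 0, ∀ r, 0 < r → r < r0 → SubM h b r)
    {a0 : ℂ} (ha0 : a0 ∈ closedBall a R) (hfa : f a0 ≠ 0) :
    h a0 ≤ (((F a0).re + c0 - ε * ‖a0 - a‖ ^ 2 - η * Real.log ‖f a0‖ : ℝ) : EReal) := by
  classical
  by_contra hcon
  push Not at hcon
  set G : ℂ → ℝ := fun z => (F z).re + c0 - ε * ‖z - a‖ ^ 2 - η * Real.log ‖f z‖ with hG
  set w : ℂ → EReal := fun z => if f z = 0 then ⊥ else h z + ((-(G z) : ℝ) : EReal) with hw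
  have hGc : ∀ x, f x ≠ 0 → ContinuousAt G x := by
    intro x hx
    have h1 : ContinuousAt (fun z => Real.log ‖f z‖) x :=
      (hf.continuous.continuousAt.norm).log (by simpa using hx)
    have h2 : ContinuousAt (fun z => (F z).re + c0 - ε * ‖z - a‖ ^ 2) x := by
      have := hF.continuous
      exact Continuous.continuousAt (by fun_prop)
    exact h2.sub (h1.const_mul η)
  have hwu : UpperSemicontinuousOn w (closedBall a R) := by
    intro x hx
    by_cases hfx : f x = 0
    · intro y hy
      have hy' : ⊥ < y := by simpa [hw, hfx] using hy
      obtain ⟨y', -, hy'⟩ := EReal.lt_iff_exists_real_btwn.1 hy'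
      obtain ⟨c, hc, -⟩ := EReal.lt_iff_exists_real_btwn.1 (hT x hx)
      have e1 := husc x hx c hc
      have e2 : ∀ᶠ z in 𝓝[closedBall a R] x, f z ≠ 0 → c - y' < G z := by
        have k1 : ∀ᶠ z in 𝓝 x, (F x).re + c0 - ε * ‖x - a‖ ^ 2 - 1 < (F z).re + c0 - ε * ‖z - a‖ ^ 2 := by
          have := hF.continuous
          have hc : Continuous fun z => (F z).re + c0 - ε * ‖z - a‖ ^ 2 := by fun_prop
          exact (hc.tendsto x).eventually_const_lt (by simp)
        have t1 : Tendsto (fun z : ℂ => -Real.log ‖z‖) (𝓝[≠] 0) atTop :=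
          tendsto_neg_atBot_atTop.comp (Real.tendsto_log_nhdsGT_zero.comp tendsto_norm_nhdsNE_zero)
        have k2 := (t1.const_mul_atTop hη).eventually_gt_atTop (c - y' - ((F x).re + c0 - ε * ‖x - a‖ ^ 2 - 1))
        rw [eventually_nhdsWithin_iff] at k2
        have k3 : ∀ᶠ z in 𝓝 x, f z ∈ ({0}ᶜ : Set ℂ) → c - y' - ((F x).re + c0 - ε * ‖x - a‖ ^ 2 - 1) < η * -Real.log ‖f z‖ := by
          have ht : Tendsto f (𝓝 x) (𝓝 0) := by simpa [hfx] using hf.continuous.tendsto x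
          exact ht.eventually k2
        refine Filter.Eventually.filter_mono nhdsWithin_le_nhds ?_
        filter_upwards [k1, k3] with z h1 h2 hz
        have := h2 hz
        simp only [hG]
        linarith
      filter_upwards [e1, e2] with z h1 h2
      simp only [hw]
      split_ifs with hz
      · exact hy'.trans' (EReal.bot_lt_coe _)
      · refine lt_of_le_of_lt ?_ hy'
        calc h z + ((-(G z) : ℝ) : EReal) ≤ (c:EReal) + ((-(G z) : ℝ) : EReal) := by gcongr
          _ ≤ (y' : EReal) := by
            rw [← EReal.coe_add, EReal.coe_le_coe_iff]; linarith [h2 hz]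
    · have h1 : UpperSemicontinuousWithinAt (fun z => h z + ((-(G z) : ℝ) : EReal)) (closedBall a R) x := by
        refine UpperSemicontinuousWithinAt.add' (husc x hx) ?_ (EReal.continuousAt_add (Or.inr (EReal.coe_ne_bot _)) (Or.inr (EReal.coe_ne_top _)))
        refine ContinuousWithinAt.upperSemicontinuousWithinAt ?_
        exact (continuous_coe_real_ereal.continuousAt.comp (hGc x hfx).neg).continuousWithinAt
      intro y hy
      have hy' : h x + ((-(G x) : ℝ) : EReal) < y := by simpa [hw, hfx] using hy
      have e0 : ∀ᶠ z in 𝓝[closedBall a R] x, f z ≠ 0 := 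
        Filter.Eventually.filter_mono nhdsWithin_le_nhds (hf.continuous.continuousAt.eventually_ne hfx)
      filter_upwards [h1 y hy', e0] with z h1 h2
      simpa [hw, h2] using h1
  obtain ⟨z0, hz0, hmax⟩ := hwu.exists_isMaxOn ⟨a0, ha0⟩ (isCompact_closedBall a R)
  have hpos : 0 < w a0 := by
    simp only [hw, hfa, if_false]
    have hcon' : ((G a0 : ℝ) : EReal) < h a0 := hcon
    have := EReal.add_lt_add_of_lt_of_le hcon' (le_refl ((-(G a0) : ℝ) : EReal)) (EReal.coe_ne_bot _) (EReal.coe_ne_top _)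
    rw [← EReal.coe_add, add_neg_cancel, EReal.coe_zero] at this
    exact this
  have hpos0 : 0 < w z0 := hpos.trans_le (hmax ha0)
  have hfz : f z0 ≠ 0 := by
    intro h0
    simp [hw, h0] at hpos0
  have hwz : w z0 = h z0 + ((-(G z0) : ℝ) : EReal) := by simp [hw, hfz]
  obtain ⟨c, hc⟩ : ∃ c : ℝ, h z0 = c := by
    have h1 := hT z0 hz0
    have h2 : h z0 ≠ ⊥ := by
      intro h0
      rw [hwz, h0] at hpos0
      simp at hpos0
    exact ⟨(h z0).toReal, (EReal.coe_toReal h1.ne h2).symm⟩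
  have hzb : z0 ∈ ball a R := by
    rcases (mem_closedBall.1 hz0).lt_or_eq with h1 | h1
    · exact h1
    · have := hsph z0 h1 hfz
      rw [hwz, hc, ← EReal.coe_add] at hpos0
      rw [hc] at this
      have h3 : (0:ℝ) < c + -(G z0) := by exact_mod_cast hpos0
      have h4 : c < G z0 := by exact_mod_cast this
      linarith
  obtain ⟨r0, hr0, hsub⟩ := hs z0 hzb hfz
  have ev : ∀ᶠ z in 𝓝 z0, z ∈ ball a R ∧ f z ≠ 0 :=
    Filter.Eventually.and (isOpen_ball.mem_nhds hzb) (hf.continuous.continuousAt.eventually_ne hfz)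
  obtain ⟨r1, hr1, hr1s⟩ := Metric.mem_nhds_iff.1 ev
  set r := min r0 r1 / 2 with hr
  have hrp : 0 < r := by have := lt_min hr0 hr1; positivity
  have hrr0 : r < r0 := by have := min_le_left r0 r1; have := lt_min hr0 hr1; rw [hr]; linarith
  have hrr1 : r < r1 := by have := min_le_right r0 r1; have := lt_min hr0 hr1; rw [hr]; linarith
  have hcb : closedBall z0 r ⊆ ball z0 r1 := closedBall_subset_ball hrr1
  set K : ℝ := c - G z0 + c0 - ε * ‖z0 - a‖ ^ 2 - ε * r ^ 2 / 2 with hK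
  set F1 : ℂ → ℂ := fun z => F z - (ε:ℂ) * (2 * (starRingEnd ℂ (z0 - a)) * (z - z0)) with hF1
  have hF1d : Differentiable ℂ F1 := by fun_prop
  set φ : ℂ → ℝ := (fun z => (F1 z).re) + (fun _ => K) - η • (fun z => Real.log ‖f z‖) with hφ
  have hharm : InnerProductSpace.HarmonicOnNhd φ (closedBall z0 |r|) := by
    rw [abs_of_pos hrp]
    refine ((InnerProductSpace.HarmonicOnNhd.add ?_ (InnerProductSpace.harmonicOnNhd_const K))).sub
      (InnerProductSpace.HarmonicOnNhd.const_smul ?_)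
    · exact fun z hz => AnalyticAt.harmonicAt_re (hF1d.analyticAt z)
    · exact fun z hz => AnalyticAt.harmonicAt_log_norm (hf.analyticAt z) (hr1s (hcb hz)).2
  have hφv : ∀ z, φ z = (F z).re - ε * (2 * (starRingEnd ℂ (z0 - a)) * (z - z0)).re + K - η * Real.log ‖f z‖ := by
    intro z
    simp only [hφ, Pi.add_apply, Pi.sub_apply, Pi.smul_apply, smul_eq_mul, hF1, sub_re, re_ofReal_mul]
  have havg := hharm.circleAverage_eq
  have hle := hsub r hrp hrr0 φ (hharm.continuousOn.mono (by rw [abs_of_pos hrp]; exact sphere_subset_closedBall)) (by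
    intro z hz
    obtain ⟨hzB, hzf⟩ := hr1s (hcb (sphere_subset_closedBall hz))
    have h1 : w z ≤ w z0 := hmax (ball_subset_closedBall hzB)
    rw [hwz, hc, ← EReal.coe_add] at h1
    have h2 : w z = h z + ((-(G z) : ℝ) : EReal) := by simp [hw, hzf]
    rw [h2] at h1
    have hid := norm_circle_id a z0 z
    rw [mem_sphere, dist_eq_norm] at hz
    rw [hz] at hid
    have h3 : c + -(G z0) + G z < φ z := by
      rw [hφv z, hK]
      simp only [hG]
      rw [hid]
      have : 0 < ε * r ^ 2 := by positivity
      nlinarith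
    have h4 := hT z (ball_subset_closedBall hzB)
    generalize hhz : h z = x at h1 h4
    induction x with
    | bot => exact EReal.bot_lt_coe _
    | top => simp at h4
    | coe x =>
      rw [← EReal.coe_add, EReal.coe_le_coe_iff] at h1
      rw [EReal.coe_lt_coe_iff]; linarith)
  rw [havg, hc, EReal.coe_le_coe_iff, hφv z0] at hle
  have : 0 < ε * r ^ 2 := by positivity
  simp only [hK, hG, sub_self, mul_zero, zero_re] at hle
  linarith

theorem subM_of_local {h : ℂ → EReal} {a : ℂ} {R : ℝ} (hR : 0 < R)
    (husc : UpperSemicontinuousOn h (closedBall a R)) (hT : ∀ z ∈ closedBall a R, h z < ⊤) {S : Set ℂ} (hS : S.Finite) (haS : a ∉ S)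
    (hs : ∀ b ∈ ball a R, b ∉ S → ∃ r0 > 0, ∀ r, 0 < r → r < r0 → SubM h b r) : SubM h a R := by
  classical
  intro φ hφ hlt
  set f : ℂ → ℂ := fun z => ∏ s ∈ hS.toFinset, (z - s) with hf
  have hfd : Differentiable ℂ f := by rw [hf]; fun_prop
  have hf0 : ∀ z, f z ≠ 0 → z ∉ S := by
    intro z hz hzS
    exact hz (Finset.prod_eq_zero (hS.mem_toFinset.2 hzS) (sub_self z))
  have hfa : f a ≠ 0 := Finset.prod_ne_zero_iff.2 fun s hs' => sub_ne_zero.2 fun h0 => haS (h0 ▸ hS.mem_toFinset.1 hs')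
  obtain ⟨D, hD⟩ := (isCompact_closedBall a R).exists_bound_of_continuousOn hfd.continuous.continuousOn
  have haR : a ∈ closedBall a R := mem_closedBall_self hR.le
  have key : ∀ ε > 0, h a ≤ ((Real.circleAverage φ a R + 4 * ε : ℝ) : EReal) := by
    intro ε hε
    obtain ⟨F, hF, hFφ⟩ := harm_approx hR hφ hε
    set B := Real.log D - Real.log ‖f a‖ with hB
    have hη : 0 < ε / (1 + |B|) := by positivity
    have h1 := max_step (c0 := ε + ε / (R^2) * R^2 + ε / (1 + |B|) * Real.log D) hF hfd husc hT (show 0 < ε / R^2 by positivity) hη (fun z hz hfz => by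
      refine (hlt z hz).trans ?_
      rw [EReal.coe_lt_coe_iff]
      have h2 := (abs_lt.1 (hFφ z hz)).1
      have h3 : Real.log ‖f z‖ ≤ Real.log D := Real.log_le_log (norm_pos_iff.2 hfz) (hD z (sphere_subset_closedBall hz))
      have h4 := mul_le_mul_of_nonneg_left h3 hη.le
      rw [mem_sphere, dist_eq_norm] at hz
      rw [hz]
      linarith) (fun b hb hfb => hs b hb (hf0 b hfb)) haR hfa
    refine h1.trans ?_
    rw [EReal.coe_le_coe_iff]
    have hR2 : ε / R ^ 2 * R ^ 2 = ε := by field_simp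
    have hBB : ε / (1 + |B|) * B ≤ ε := by
      rw [div_mul_eq_mul_div, div_le_iff₀ (by positivity)]
      have := le_abs_self B
      nlinarith
    have hharm : InnerProductSpace.HarmonicOnNhd (fun z => (F z).re) (closedBall a |R|) :=
      fun z hz => AnalyticAt.harmonicAt_re (hF.analyticAt z)
    have hav := hharm.circleAverage_eq
    have hci : CircleIntegrable φ a R := hφ.circleIntegrable hR.le
    have hce : CircleIntegrable (fun _ : ℂ => ε) a R := continuousOn_const.circleIntegrable hR.le
    have hFi : CircleIntegrable (fun z => (F z).re) a R := 
      ContinuousOn.circleIntegrable hR.le (by have := hF.continuous; fun_prop)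
    have hmono := Real.circleAverage_mono hFi (hci.add hce) (fun z hz => by
      rw [abs_of_pos hR] at hz
      have h2 := (abs_lt.1 (hFφ z hz)).2
      simp only [Pi.add_apply]; linarith)
    rw [Real.circleAverage_add hci hce, Real.circleAverage_const, hav] at hmono
    simp only [sub_self, norm_zero]
    have hBB' : ε / (1 + |B|) * B = ε / (1 + |B|) * Real.log D - ε / (1 + |B|) * Real.log ‖f a‖ := by rw [hB]; ring
    nlinarith
  by_contra hcon
  push Not at hcon
  obtain ⟨x, hx1, hx2⟩ := EReal.lt_iff_exists_real_btwn.1 hcon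
  rw [EReal.coe_lt_coe_iff] at hx1
  have := key ((x - Real.circleAverage φ a R) / 4) (by linarith)
  have e : Real.circleAverage φ a R + 4 * ((x - Real.circleAverage φ a R) / 4) = x := by ring
  rw [e] at this
  exact absurd hx2 (not_lt.2 this)
end Pot2
end RH

open scoped ContDiff
namespace RH
section Pot3

lemma erealPos_coe (x : ℝ) : erealPos (x : EReal) = ENNReal.ofReal x := by
  simp [erealPos]

lemma erealIntegral_coe {X : Type} [MeasurableSpace X] {μ : Measure X} {g : X → ℝ} (hg : Integrable g μ) :
    erealIntegral μ (fun x => (g x : EReal)) = ((∫ x, g x ∂μ : ℝ) : EReal) := by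
  have h1 : ∫⁻ x, ENNReal.ofReal (g x) ∂μ ≠ ⊤ := (hg.lintegral_lt_top).ne
  have h2 : ∫⁻ x, ENNReal.ofReal (-(g x)) ∂μ ≠ ⊤ := (hg.neg.lintegral_lt_top).ne
  rw [erealIntegral, integral_eq_lintegral_pos_part_sub_lintegral_neg_part hg, EReal.coe_sub,
    EReal.coe_ennreal_toReal h1, EReal.coe_ennreal_toReal h2]
  simp_rw [← EReal.coe_neg, erealPos_coe]

lemma erealIntegral_congr {X : Type} [MeasurableSpace X] {μ : Measure X} {g g' : X → EReal} (h : g =ᵐ[μ] g') :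
    erealIntegral μ g = erealIntegral μ g' := by
  have e1 : ∫⁻ x, erealPos (g x) ∂μ = ∫⁻ x, erealPos (g' x) ∂μ := lintegral_congr_ae (h.mono fun x hx => by beta_reduce; rw [hx])
  have e2 : ∫⁻ x, erealPos (-(g x)) ∂μ = ∫⁻ x, erealPos (-(g' x)) ∂μ := lintegral_congr_ae (h.mono fun x hx => by beta_reduce; rw [hx])
  rw [erealIntegral, erealIntegral, e1, e2]

lemma circleAverage_eq_restrict (φ : ℂ → ℝ) (a : ℂ) (r : ℝ) : 
    Real.circleAverage φ a r = (2 * Real.pi)⁻¹ * ∫ θ in Ioc (0:ℝ) (2 * Real.pi), φ (a + (r:ℂ) * exp ((θ:ℂ) * I)) := by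
  rw [Real.circleAverage, intervalIntegral.integral_of_le Real.two_pi_pos.le]
  rfl

lemma cmem (a : ℂ) {r : ℝ} (hr : 0 < r) (θ : ℝ) : a + (r:ℂ) * exp ((θ:ℂ) * I) ∈ sphere a r :=
  circleMap_mem_sphere a hr.le θ

lemma integrable_circ {φ : ℂ → ℝ} {a : ℂ} {r : ℝ} (hr : 0 < r) (hφ : ContinuousOn φ (sphere a r)) :
    Integrable (fun θ : ℝ => φ (a + (r:ℂ) * exp ((θ:ℂ) * I))) (volume.restrict (Ioc (0:ℝ) (2 * Real.pi))) := by
  have h1 : Continuous fun θ : ℝ => φ (a + (r:ℂ) * exp ((θ:ℂ) * I)) := hφ.comp_continuous (by fun_prop) (cmem a hr)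
  exact h1.continuousOn.integrableOn_Icc.mono_set Ioc_subset_Icc_self

lemma subM_of_frozen {h : ℂ → EReal} {g : ℂ → ℝ} {a : ℂ} {r : ℝ} (hr : 0 < r) (hg : ContinuousOn g (sphere a r))
    (hh : ∀ z ∈ sphere a r, h z = g z) 
    (hle : h a ≤ (((2 * Real.pi)⁻¹ : ℝ) : EReal) *
      erealIntegral (volume.restrict (Set.Ioc (0 : ℝ) (2 * Real.pi)))
        (fun θ : ℝ => h (a + (r : ℂ) * Complex.exp ((θ : ℂ) * Complex.I)))) : SubM h a r := by
  intro φ hφ hlt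
  refine hle.trans ?_
  have : (fun θ : ℝ => h (a + (r : ℂ) * Complex.exp ((θ : ℂ) * Complex.I))) = fun θ : ℝ => ((g (a + (r : ℂ) * Complex.exp ((θ : ℂ) * Complex.I)) : ℝ) : EReal) :=
    funext fun θ => hh _ (cmem a hr θ)
  rw [this, erealIntegral_coe (integrable_circ hr hg), ← EReal.coe_mul, EReal.coe_le_coe_iff, ← circleAverage_eq_restrict]
  refine Real.circleAverage_mono (hg.circleIntegrable hr.le) (hφ.circleIntegrable hr.le) fun z hz => ?_
  rw [abs_of_pos hr] at hz
  have := hlt z hz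
  rw [hh z hz, EReal.coe_lt_coe_iff] at this
  exact this.le

/-- continuous approximation from above -/
lemma usc_approx {h : ℂ → EReal} {S : Set ℂ} (hS : S.Nonempty) (husc : UpperSemicontinuousOn h S) {C : ℝ} (hC0 : 0 ≤ C)
    (hC : ∀ z ∈ S, h z ≤ C) : ∃ ψ : ℕ → ℂ → ℝ, (∀ j, Continuous (ψ j)) ∧ (∀ j, ∀ z ∈ S, h z < ψ j z) ∧ (∀ j z, ψ j z ≤ C + 1) ∧
      ∀ z ∈ S, ∀ y : ℝ, h z < y → ∀ᶠ j in atTop, ψ j z ≤ y := by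
  have : Nonempty S := hS.to_subtype
  set H : ℕ → ℂ → ℝ := fun j w => (max (h w) ((-(j:ℝ) : ℝ) : EReal)).toReal with hH
  have hHe : ∀ j, ∀ w ∈ S, ((H j w : ℝ) : EReal) = max (h w) ((-(j:ℝ) : ℝ) : EReal) := by
    intro j w hw
    refine EReal.coe_toReal ?_ ?_
    · have : max (h w) ((-(j:ℝ) : ℝ) : EReal) < ⊤ := max_lt ((hC w hw).trans_lt (EReal.coe_lt_top _)) (EReal.coe_lt_top _)
      exact this.ne
    · have : ⊥ < max (h w) ((-(j:ℝ) : ℝ) : EReal) := lt_max_of_lt_right (EReal.bot_lt_coe _)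
      exact this.ne'
  have hHC : ∀ j, ∀ w ∈ S, H j w ≤ C := by
    intro j w hw
    have : ((H j w : ℝ) : EReal) ≤ C := by
      rw [hHe j w hw]
      refine max_le (hC w hw) (EReal.coe_le_coe_iff.2 ?_)
      have : (0:ℝ) ≤ j := j.cast_nonneg
      linarith
    exact_mod_cast this
  have hbd : ∀ (j : ℕ) (z : ℂ), BddAbove (range fun w : S => H j w - j * dist z (w:ℂ)) := by
    intro j z
    refine ⟨C, ?_⟩
    rintro _ ⟨w, rfl⟩
    have := hHC j w w.2
    have : 0 ≤ (j:ℝ) * dist z (w:ℂ) := by positivity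
    simp only; linarith
  refine ⟨fun j z => (⨆ w : S, (H j w - j * dist z (w:ℂ))) + 1 / ((j:ℝ) + 1), fun j => ?_, fun j z hz => ?_, fun j z => ?_, fun z hz y hy => ?_⟩
  · refine Continuous.add ?_ continuous_const
    refine (LipschitzWith.of_le_add_mul (K := (j : NNReal)) ?_).continuous
    intro z z'
    refine ciSup_le fun w => ?_
    have h1 := le_ciSup (hbd j z') w
    have h2 : (j:ℝ) * dist z' w ≤ j * dist z w + j * dist z z' := by
      rw [← mul_add]
      refine mul_le_mul_of_nonneg_left ?_ j.cast_nonneg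
      have := dist_triangle z' z w; rw [dist_comm z' z] at this; linarith
    have e : (((j : NNReal)) : ℝ) = (j:ℝ) := by simp
    rw [e]
    linarith
  · have h1 := le_ciSup (hbd j z) ⟨z, hz⟩
    simp only [dist_self, mul_zero, sub_zero] at h1
    have h2 : h z ≤ ((H j z : ℝ) : EReal) := by rw [hHe j z hz]; exact le_max_left _ _
    refine h2.trans_lt (EReal.coe_lt_coe_iff.2 ?_)
    have : (0:ℝ) < 1 / ((j:ℝ) + 1) := by positivity
    linarith
  · have h1 : (⨆ w : S, (H j w - j * dist z (w:ℂ))) ≤ C := ciSup_le fun w => by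
      have := hHC j w w.2
      have : 0 ≤ (j:ℝ) * dist z (w:ℂ) := by positivity
      linarith
    have h2 : 1 / ((j:ℝ) + 1) ≤ 1 := by
      rw [div_le_one (by positivity)]; have : (0:ℝ) ≤ j := j.cast_nonneg
      linarith
    linarith
  · obtain ⟨y', hy1, hy2⟩ := EReal.lt_iff_exists_real_btwn.1 hy
    rw [EReal.coe_lt_coe_iff] at hy2
    obtain ⟨δ, hδ, hδs⟩ := Metric.mem_nhdsWithin_iff.1 (husc z hz y' hy1)
    have e1 : ∀ᶠ j : ℕ in atTop, (C - y') / δ ≤ j := tendsto_natCast_atTop_atTop.eventually_ge_atTop _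
    have e2 : ∀ᶠ j : ℕ in atTop, -y' ≤ j := tendsto_natCast_atTop_atTop.eventually_ge_atTop _
    have e3 : ∀ᶠ j : ℕ in atTop, 1 / ((j:ℝ) + 1) < y - y' := 
      tendsto_one_div_add_atTop_nhds_zero_nat.eventually_lt_const (by linarith)
    filter_upwards [e1, e2, e3] with j h1 h2 h3
    have : (⨆ w : S, (H j w - j * dist z (w:ℂ))) ≤ y' := ciSup_le fun w => by
      by_cases hw : dist z w < δ
      · have h4 : h w < y' := hδs ⟨by rw [mem_ball, dist_comm]; exact hw, w.2⟩
        have h5 : ((H j w : ℝ) : EReal) ≤ y' := by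
          rw [hHe j w w.2]
          exact max_le h4.le (EReal.coe_le_coe_iff.2 (by linarith))
        rw [EReal.coe_le_coe_iff] at h5
        have : 0 ≤ (j:ℝ) * dist z (w:ℂ) := by positivity
        linarith
      · push Not at hw
        have h4 := hHC j w w.2
        rw [div_le_iff₀ hδ] at h1
        have : (j:ℝ) * δ ≤ j * dist z w := mul_le_mul_of_nonneg_left hw j.cast_nonneg
        linarith
    linarith

theorem frozen_of_subM {h : ℂ → EReal} {a : ℂ} {r : ℝ} (hr : 0 < r) (husc : UpperSemicontinuousOn h (sphere a r))
    (hT : ∀ z ∈ sphere a r, h z < ⊤) (hsub : SubM h a r) :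
    h a ≤ (((2 * Real.pi)⁻¹ : ℝ) : EReal) *
      erealIntegral (volume.restrict (Set.Ioc (0 : ℝ) (2 * Real.pi)))
        (fun θ : ℝ => h (a + (r : ℂ) * Complex.exp ((θ : ℂ) * Complex.I))) := by
  have hne : (sphere a r).Nonempty := ⟨_, cmem a hr 0⟩
  obtain ⟨m, hm, hmax⟩ := husc.exists_isMaxOn hne (isCompact_sphere a r)
  obtain ⟨C0, hC0, -⟩ := EReal.lt_iff_exists_real_btwn.1 (hT m hm)
  set C := max C0 0 with hC
  have hCn : 0 ≤ C := le_max_right _ _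
  have hCb : ∀ z ∈ sphere a r, h z ≤ C := fun z hz => (hmax hz).trans (hC0.le.trans (EReal.coe_le_coe_iff.2 (le_max_left _ _)))
  obtain ⟨ψ, hψ1, hψ2, hψ3, hψ4⟩ := usc_approx hne husc hCn hCb
  induction hha : h a with
  | bot => exact bot_le
  | top =>
    have := hsub (ψ 0) (hψ1 0).continuousOn (hψ2 0)
    rw [hha] at this
    exact absurd this (by simp)
  | coe x =>
  set μ := volume.restrict (Set.Ioc (0 : ℝ) (2 * Real.pi)) with hμ
  set e : ℝ → ℂ := fun θ => a + (r : ℂ) * Complex.exp ((θ : ℂ) * Complex.I) with he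
  have hec : Continuous e := by fun_prop
  have hem : ∀ θ, e θ ∈ sphere a r := cmem a hr
  set k : ℝ → EReal := fun θ => h (e θ) with hk
  have hkusc : UpperSemicontinuous k := by
    intro θ y hy
    have h1 := husc (e θ) (hem θ) y hy
    have h2 : Tendsto e (𝓝 θ) (𝓝[sphere a r] (e θ)) := tendsto_nhdsWithin_iff.2 ⟨hec.tendsto θ, Eventually.of_forall hem⟩
    exact h2.eventually h1
  have hkm : Measurable k := hkusc.measurable
  set A : ℝ → ℝ≥0∞ := fun θ => liminf (fun j => ENNReal.ofReal (C + 1 - ψ j (e θ))) atTop with hA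
  have hAy : ∀ θ, ∀ y : ℝ, k θ < y → ENNReal.ofReal (C + 1 - y) ≤ A θ := by
    intro θ y hy
    refine le_liminf_of_le (by isBoundedDefault) ?_
    filter_upwards [hψ4 (e θ) (hem θ) y hy] with j hj
    exact ENNReal.ofReal_le_ofReal (by linarith)
  have hx : ∀ j, 2 * Real.pi * x ≤ ∫ θ, ψ j (e θ) ∂μ := by
    intro j
    have := hsub (ψ j) (hψ1 j).continuousOn (hψ2 j)
    rw [hha, EReal.coe_le_coe_iff, circleAverage_eq_restrict] at this
    rw [inv_mul_eq_div, le_div_iff₀ Real.two_pi_pos] at this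
    linarith
  have hinteg : ∀ j, Integrable (fun θ => ψ j (e θ)) μ := fun j => integrable_circ hr (hψ1 j).continuousOn
  have hμr : μ.real univ = 2 * Real.pi := by
    rw [hμ, Measure.real, Measure.restrict_apply_univ, Real.volume_Ioc, sub_zero, ENNReal.toReal_ofReal Real.two_pi_pos.le]
  have hfat : ∫⁻ θ, A θ ∂μ ≤ ENNReal.ofReal (2 * Real.pi * (C + 1 - x)) := by
    refine (lintegral_liminf_le (fun j => ?_)).trans ?_
    · have := hψ1 j
      fun_prop
    · refine (liminf_le_liminf (v := fun _ => ENNReal.ofReal (2 * Real.pi * (C + 1 - x))) (Eventually.of_forall fun j => ?_) (by isBoundedDefault) (by isBoundedDefault)).trans (by simp)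
      have hi : Integrable (fun θ => C + 1 - ψ j (e θ)) μ := (integrable_const _).sub (hinteg j)
      rw [← ofReal_integral_eq_lintegral_ofReal hi (Eventually.of_forall fun θ => by
        simp only [Pi.zero_apply]; linarith [hψ3 j (e θ)])]
      refine ENNReal.ofReal_le_ofReal ?_
      rw [integral_sub (integrable_const _) (hinteg j), integral_const, hμr, smul_eq_mul]
      linarith [hx j]
  have hAm : Measurable A := by
    refine Measurable.liminf fun j => ?_
    have := hψ1 j
    fun_prop
  have hAfin : ∀ᵐ θ ∂μ, A θ < ⊤ := ae_lt_top hAm (hfat.trans_lt ENNReal.ofReal_lt_top).ne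
  have hkfin : ∀ᵐ θ ∂μ, k θ = ((k θ).toReal : EReal) := by
    filter_upwards [hAfin] with θ hθ
    refine (EReal.coe_toReal (hT _ (hem θ)).ne ?_).symm
    intro hbot
    refine hθ.ne (ENNReal.eq_top_of_forall_nnreal_le fun q => ?_)
    have := hAy θ (C + 1 - q) ((show k θ = ⊥ from hbot).trans_lt (EReal.bot_lt_coe _))
    simpa using this
  have hkA : ∀ᵐ θ ∂μ, ENNReal.ofReal (C + 1 - (k θ).toReal) ≤ A θ := by
    filter_upwards [hkfin] with θ hθ
    have ht : Tendsto (fun y : ℝ => ENNReal.ofReal (C + 1 - y)) (𝓝[>] (k θ).toReal) (𝓝 (ENNReal.ofReal (C + 1 - (k θ).toReal))) := by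
      refine Tendsto.mono_left ?_ nhdsWithin_le_nhds
      exact (ENNReal.continuous_ofReal.comp (continuous_const.sub continuous_id)).tendsto _
    refine le_of_tendsto ht ?_
    filter_upwards [self_mem_nhdsWithin] with y hy
    exact hAy θ y (by rw [hθ]; exact EReal.coe_lt_coe_iff.2 hy)
  have hgm : Measurable fun θ => (k θ).toReal := hkm.ereal_toReal
  have hle1 : ∫⁻ θ, ENNReal.ofReal (C + 1 - (k θ).toReal) ∂μ ≤ ENNReal.ofReal (2 * Real.pi * (C + 1 - x)) :=
    (lintegral_mono_ae hkA).trans hfat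
  have hnn : 0 ≤ᵐ[μ] fun θ => C + 1 - (k θ).toReal := by
    filter_upwards [hkfin] with θ hθ
    have := hCb _ (hem θ)
    change k θ ≤ _ at this
    rw [hθ, EReal.coe_le_coe_iff] at this
    simp only [Pi.zero_apply]; linarith
  have hI1 : Integrable (fun θ => C + 1 - (k θ).toReal) μ := by
    refine ⟨(measurable_const.sub hgm).aestronglyMeasurable, ?_⟩
    rw [hasFiniteIntegral_iff_ofReal hnn]
    exact hle1.trans_lt ENNReal.ofReal_lt_top
  have hI : Integrable (fun θ => (k θ).toReal) μ := by
    have := (integrable_const (μ := μ) (C + 1)).sub hI1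
    refine this.congr (Eventually.of_forall fun θ => ?_)
    simp
  have hxx : x ≤ C + 1 := by
    have := hsub (ψ 0) (hψ1 0).continuousOn (hψ2 0)
    rw [hha, EReal.coe_le_coe_iff] at this
    refine this.trans (Real.circleAverage_mono_on_of_le_circle ((hψ1 0).continuousOn.circleIntegrable hr.le) fun z _ => hψ3 0 z)
  have hle2 : ∫ θ, (C + 1 - (k θ).toReal) ∂μ ≤ 2 * Real.pi * (C + 1 - x) := by
    rw [integral_eq_lintegral_of_nonneg_ae hnn hI1.1]
    refine ENNReal.toReal_le_of_le_ofReal ?_ hle1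
    have := Real.two_pi_pos
    have : 0 ≤ C + 1 - x := by linarith
    positivity
  rw [integral_sub (integrable_const _) hI, integral_const, hμr, smul_eq_mul] at hle2
  have hfinal : erealIntegral μ k = ((∫ θ, (k θ).toReal ∂μ : ℝ) : EReal) := by
    rw [erealIntegral_congr hkfin, erealIntegral_coe hI]
  rw [hfinal, ← EReal.coe_mul, EReal.coe_le_coe_iff, inv_mul_eq_div, le_div_iff₀ Real.two_pi_pos]
  linarith
end Pot3
end RH

open scoped ContDiff
namespace RH
section Slice

/-- grid points -/
noncomputable def gp (δ : ℝ) (a : ℤ × ℤ) : ℂ := ⟨a.1 * (δ / 2), a.2 * (δ / 2)⟩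

lemma grid_cover {δ : ℝ} (h0 : 0 < δ) (h1 : δ ≤ 1) : ∃ P : Finset (ℤ × ℤ), (P.card : ℝ) ≤ 64 / δ ^ 2 ∧
    ∀ ζ : ℂ, ‖ζ‖ ≤ 1 → ∃ a ∈ P, ‖ζ - gp δ a‖ ≤ δ / 2 := by
  have hh : 0 < δ / 2 := by positivity
  set m : ℕ := ⌈2 / δ + 1 / 2⌉₊ with hm
  have hm1 : 2 / δ + 1 / 2 ≤ m := Nat.le_ceil _
  have hm2 : (m : ℝ) < 2 / δ + 1 / 2 + 1 := Nat.ceil_lt_add_one (by positivity)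
  have key : ∀ x : ℝ, |x| ≤ 1 → round (x / (δ / 2)) ∈ Finset.Icc (-(m:ℤ)) m ∧ |x - round (x / (δ / 2)) * (δ / 2)| ≤ δ / 4 := by
    intro x hx
    have h2 := abs_sub_round (x / (δ / 2))
    have h3 : |x / (δ / 2)| ≤ 2 / δ := by
      rw [abs_div, abs_of_pos hh, div_le_div_iff₀ hh h0]
      nlinarith
    constructor
    · rw [Finset.mem_Icc]
      have h4 : |(round (x / (δ / 2)) : ℝ)| ≤ m := by
        have : (round (x / (δ / 2)) : ℝ) = x / (δ / 2) - (x / (δ / 2) - round (x / (δ / 2))) := by ring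
        rw [this]
        refine (abs_sub _ _).trans ?_
        linarith
      rw [abs_le] at h4
      constructor
      · have := h4.1; exact_mod_cast this
      · have := h4.2; exact_mod_cast this
    · have : x - round (x / (δ / 2)) * (δ / 2) = (x / (δ / 2) - round (x / (δ / 2))) * (δ / 2) := by
        field_simp
      rw [this, abs_mul, abs_of_pos hh]
      nlinarith
  refine ⟨Finset.Icc (-(m:ℤ)) m ×ˢ Finset.Icc (-(m:ℤ)) m, ?_, fun ζ hζ => ?_⟩
  · rw [Finset.card_product, Int.card_Icc]
    have e : ((m:ℤ) + 1 - -(m:ℤ)).toNat = 2 * m + 1 := by omega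
    rw [e]
    push_cast
    have h5 : 2 * (m:ℝ) + 1 ≤ 8 / δ := by
      have : 4 ≤ 4 / δ := by rw [le_div_iff₀ h0]; linarith
      have : 8 / δ = 2 * (2 / δ) + 4 / δ := by ring
      linarith
    have : 64 / δ ^ 2 = (8 / δ) * (8 / δ) := by field_simp; norm_num
    rw [this]
    gcongr
  · have hr := key ζ.re ((abs_re_le_norm ζ).trans hζ)
    have hi := key ζ.im ((abs_im_le_norm ζ).trans hζ)
    refine ⟨(round (ζ.re / (δ / 2)), round (ζ.im / (δ / 2))), Finset.mem_product.2 ⟨hr.1, hi.1⟩, ?_⟩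
    refine (norm_le_abs_re_add_abs_im _).trans ?_
    have e1 := hr.2
    have e2 := hi.2
    simp only [gp, sub_re, sub_im]
    linarith

variable {n : ℕ}

lemma finrank_Cn : Module.finrank ℝ (Cn n) = 2 * n := by
  have := Module.finrank_mul_finrank ℝ ℂ (Cn n)
  rw [Complex.finrank_real_complex] at this
  rw [← this]; simp

lemma slice_count (hn : 1 ≤ n) (μ : Measure (Cn n)) [μ.IsAddHaarMeasure] {E : Set (Cn n)} {G : Cn n → ℂ → Cn n} {T : Set (Cn n)} {K : Set ℂ}
    (hK : ∀ ζ ∈ K, ‖ζ‖ ≤ 1) {c : ℝ} (hc : 0 < c)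
    (hl : ∀ t ∈ T, ∀ t' ∈ T, ∀ ζ ∈ K, c * ‖t - t'‖ ≤ ‖G t ζ - G t' ζ‖)
    (hu : ∀ t ∈ T, ∀ ζ ∈ K, ∀ ζ' ∈ K, ‖G t ζ - G t ζ'‖ ≤ ‖ζ - ζ'‖) 
    (hE : μH[(2 * n : ℝ) - 2] E < ⊤) :
    ∃ C : ℝ≥0∞, C ≠ ⊤ ∧ ∀ η : ℝ≥0∞, η ≠ 0 → ∀ r : ℝ, 0 < r → ∃ N : Cn n → ℝ≥0∞, Measurable N ∧ 
      ∫⁻ t, N t ∂μ ≤ C * (μH[(2 * n : ℝ) - 2] E + η) ∧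
      ∀ t ∈ T, ∀ F : Finset ℂ, (∀ ζ ∈ F, ζ ∈ K ∧ G t ζ ∈ E) → (∀ ζ ∈ F, ∀ ζ' ∈ F, ζ ≠ ζ' → r < ‖ζ - ζ'‖) → (F.card : ℝ≥0∞) ≤ N t := by
  set s : ℝ := (2 * n : ℝ) - 2 with hs
  have hn' : (1:ℝ) ≤ n := by exact_mod_cast hn
  have hs0 : 0 ≤ s := by rw [hs]; linarith
  set C0 : ℝ := 64 * (2 / c) ^ (2 * n) with hC0
  refine ⟨ENNReal.ofReal C0 * μ (ball 0 1), ENNReal.mul_ne_top ENNReal.ofReal_ne_top measure_ball_lt_top.ne, fun η hη r hr => ?_⟩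
  obtain ⟨η', hη'0, hη's⟩ := ENNReal.exists_pos_sum_of_countable' (ENNReal.half_pos hη).ne' ℕ
  set r' : ℝ := min r 1 / 2 with hr'
  have hr'0 : 0 < r' := by positivity
  have hr'1 : 2 * r' ≤ 1 := by rw [hr']; linarith [min_le_right r 1]
  have hr'r : 2 * r' ≤ r := by rw [hr']; linarith [min_le_left r 1]
  -- cover
  obtain ⟨U, hUE, hUd, hUs⟩ : ∃ U : ℕ → Set (Cn n), E ⊆ ⋃ i, U i ∧ (∀ i, ediam (U i) ≤ ENNReal.ofReal r') ∧
      ∑' i, ⨆ (_ : (U i).Nonempty), ediam (U i) ^ s < μH[s] E + η / 2 := by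
    have h1 : (⨅ (t : ℕ → Set (Cn n)) (_ : E ⊆ ⋃ n, t n) (_ : ∀ n, ediam (t n) ≤ ENNReal.ofReal r'),
          ∑' n, ⨆ _ : (t n).Nonempty, ediam (t n) ^ s) ≤ μH[s] E := by
      rw [Measure.hausdorffMeasure_apply]
      exact le_iSup₂_of_le (ENNReal.ofReal r') (ENNReal.ofReal_pos.2 hr'0) le_rfl
    have h2 := h1.trans_lt (ENNReal.lt_add_right hE.ne (ENNReal.half_pos hη).ne')
    simp only [iInf_lt_iff] at h2
    obtain ⟨U, a, b, d⟩ := h2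
    exact ⟨U, a, b, d⟩
  have hdel : ∀ i, ∃ δ : ℝ, (ediam (U i)).toReal < δ ∧ δ < 2 * r' ∧ ENNReal.ofReal (δ ^ s) ≤ ediam (U i) ^ s + η' i := by
    intro i
    set D := (ediam (U i)).toReal with hD
    have hDr : D ≤ r' := ENNReal.toReal_le_of_le_ofReal hr'0.le (hUd i)
    have hDt : ediam (U i) ≠ ⊤ := ((hUd i).trans_lt ENNReal.ofReal_lt_top).ne
    have e : ediam (U i) ^ s = ENNReal.ofReal (D ^ s) := by
      rw [← ENNReal.ofReal_rpow_of_nonneg ENNReal.toReal_nonneg hs0, ENNReal.ofReal_toReal hDt]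
    have ht : Tendsto (fun δ : ℝ => ENNReal.ofReal (δ ^ s)) (𝓝[>] D) (𝓝 (ENNReal.ofReal (D ^ s))) :=
      Tendsto.mono_left (ENNReal.tendsto_ofReal (Real.continuousAt_rpow_const D s (Or.inr hs0))) nhdsWithin_le_nhds
    have h3 : ∀ᶠ δ in 𝓝[>] D, ENNReal.ofReal (δ ^ s) < ENNReal.ofReal (D ^ s) + η' i := 
      ht.eventually_lt_const (ENNReal.lt_add_right ENNReal.ofReal_ne_top (hη'0 i).ne')
    have h4 : ∀ᶠ δ in 𝓝[>] D, δ ∈ Ioo D (2 * r') := Ioo_mem_nhdsGT (by linarith)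
    obtain ⟨δ, h5, h6⟩ := (Filter.Eventually.and h3 h4).exists
    exact ⟨δ, h6.1, h6.2, e ▸ h5.le⟩
  choose δ hδ1 hδ2 hδ3 using hdel
  have hδ0 : ∀ i, 0 < δ i := fun i => ENNReal.toReal_nonneg.trans_lt (hδ1 i)
  choose P hPc hP using fun i => grid_cover (hδ0 i) ((hδ2 i).le.trans hr'1)
  set A : ℕ × (ℤ × ℤ) → Set (Cn n) := fun q => {t | t ∈ T ∧ ∃ ζ ∈ K, ‖ζ - gp (δ q.1) q.2‖ ≤ δ q.1 / 2 ∧ G t ζ ∈ U q.1} with hA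
  have hAb : ∀ q, ∀ t ∈ A q, ∀ t' ∈ A q, ‖t - t'‖ ≤ 2 * δ q.1 / c := by
    rintro q t ⟨ht, ζ, hζ, hζd, hζU⟩ t' ⟨ht', ζ', hζ', hζd', hζU'⟩
    rw [le_div_iff₀ hc, mul_comm]
    refine (hl t ht t' ht' ζ hζ).trans ?_
    have h1 : ‖G t ζ - G t' ζ'‖ ≤ δ q.1 := by
      rw [← dist_eq_norm]
      have hDt : ediam (U q.1) ≠ ⊤ := ((hUd q.1).trans_lt ENNReal.ofReal_lt_top).ne
      have := edist_le_ediam_of_mem hζU hζU'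
      rw [edist_dist, ENNReal.ofReal_le_iff_le_toReal hDt] at this
      exact this.trans (hδ1 q.1).le
    have h2 := hu t' ht' ζ' hζ' ζ hζ
    have h3 : ‖ζ' - ζ‖ ≤ δ q.1 := by
      have : ζ' - ζ = (ζ' - gp (δ q.1) q.2) - (ζ - gp (δ q.1) q.2) := by ring
      rw [this]
      refine (norm_sub_le _ _).trans (by linarith)
    have : G t ζ - G t' ζ = (G t ζ - G t' ζ') + (G t' ζ' - G t' ζ) := by abel
    rw [this]
    refine (norm_add_le _ _).trans (by linarith)
  have hB : ∀ q, ∃ B : Set (Cn n), MeasurableSet B ∧ (q.2 ∈ P q.1 → A q ⊆ B) ∧ (q.2 ∉ P q.1 → B = ∅) ∧ (¬ (U q.1).Nonempty → B = ∅) ∧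
      μ B ≤ ENNReal.ofReal ((2 * δ q.1 / c) ^ (2 * n)) * μ (ball 0 1) := by
    intro q
    by_cases h : q.2 ∈ P q.1 ∧ (A q).Nonempty
    · obtain ⟨h1, t, ht⟩ := h
      refine ⟨closedBall t (2 * δ q.1 / c), measurableSet_closedBall, fun _ t' ht' => ?_, fun h => absurd h1 h, fun h => ?_, ?_⟩
      · rw [mem_closedBall, dist_eq_norm]; exact hAb q t' ht' t ht
      · obtain ⟨_, ζ, _, _, hζU⟩ := ht
        exact absurd ⟨_, hζU⟩ h
      · have := hδ0 q.1
        rw [Measure.addHaar_closedBall _ _ (by positivity), finrank_Cn]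
    · refine ⟨∅, MeasurableSet.empty, fun h1 => ?_, fun _ => rfl, fun _ => rfl, by simp⟩
      intro t ht
      exact absurd ⟨h1, ⟨t, ht⟩⟩ h
  choose B hBm hBA hBP hBU hBμ using hB
  refine ⟨fun t => ∑' q, (B q).indicator 1 t, ?_, ?_, ?_⟩
  · exact Measurable.ennreal_tsum fun q => measurable_one.indicator (hBm q)
  · rw [lintegral_tsum fun q => (measurable_one.indicator (hBm q)).aemeasurable]
    simp_rw [lintegral_indicator_one (hBm _)]
    rw [ENNReal.tsum_prod']
    have hi : ∀ i, ∑' a, μ (B (i, a)) ≤ ENNReal.ofReal C0 * μ (ball 0 1) * ((⨆ (_ : (U i).Nonempty), ediam (U i) ^ s) + η' i) := by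
      intro i
      by_cases hne : (U i).Nonempty
      · rw [tsum_eq_sum (s := P i) fun a ha => by rw [hBP (i, a) ha]; simp]
        rw [iSup_pos hne]
        refine (Finset.sum_le_sum fun a _ => hBμ (i, a)).trans ?_
        simp only [Finset.sum_const, nsmul_eq_mul]
        refine le_trans ?_ (mul_le_mul_right (hδ3 i) _)
        have hd := hδ0 i
        have h1 : ((P i).card : ℝ≥0∞) ≤ ENNReal.ofReal (64 / (δ i) ^ 2) := by
          rw [← ENNReal.ofReal_natCast]; exact ENNReal.ofReal_le_ofReal (hPc i)
        have h2 : ENNReal.ofReal (64 / (δ i) ^ 2) * ENNReal.ofReal ((2 * δ i / c) ^ (2 * n)) = ENNReal.ofReal C0 * ENNReal.ofReal (δ i ^ s) := by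
          rw [← ENNReal.ofReal_mul (by positivity), ← ENNReal.ofReal_mul (by positivity)]
          congr 1
          have e1 : δ i ^ (2 * n) = δ i ^ s * δ i ^ 2 := by
            rw [← Real.rpow_natCast, ← Real.rpow_natCast, ← Real.rpow_add hd, hs]
            congr 1; push_cast; ring
          have : (2 * δ i / c) ^ (2 * n) = (2 / c) ^ (2 * n) * δ i ^ (2 * n) := by rw [← mul_pow]; congr 1; ring
          rw [this, e1, hC0]
          field_simp
        calc _ ≤ ENNReal.ofReal (64 / (δ i) ^ 2) * (ENNReal.ofReal ((2 * δ i / c) ^ (2 * n)) * μ (ball 0 1)) := by gcongr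
          _ = ENNReal.ofReal C0 * ENNReal.ofReal (δ i ^ s) * μ (ball 0 1) := by rw [← mul_assoc, h2]
          _ ≤ _ := by rw [mul_right_comm]
      · have : ∀ a, B (i, a) = ∅ := fun a => hBU (i, a) hne
        simp [this]
    refine (ENNReal.tsum_le_tsum hi).trans ?_
    rw [ENNReal.tsum_mul_left, ENNReal.tsum_add]
    refine mul_le_mul_right ?_ _
    refine (add_le_add hUs.le hη's.le).trans ?_
    rw [add_assoc, ENNReal.add_halves]
  · intro t ht F hF hFd
    have hq : ∀ ζ ∈ F, ∃ q : ℕ × (ℤ × ℤ), t ∈ B q ∧ ‖ζ - gp (δ q.1) q.2‖ ≤ δ q.1 / 2 := by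
      intro ζ hζ
      obtain ⟨hζK, hζE⟩ := hF ζ hζ
      obtain ⟨i, hi⟩ := mem_iUnion.1 (hUE hζE)
      obtain ⟨a, ha, had⟩ := hP i ζ (hK ζ hζK)
      exact ⟨(i, a), hBA (i, a) ha ⟨ht, ζ, hζK, had, hi⟩, had⟩
    choose! q hq1 hq2 using hq
    have hinj : Set.InjOn q F := by
      intro ζ hζ ζ' hζ' he
      by_contra hne
      have h1 := hFd ζ hζ ζ' hζ' hne
      have h2 := hq2 ζ hζ
      have h3 := hq2 ζ' hζ'
      rw [← he] at h3
      have : ζ - ζ' = (ζ - gp (δ (q ζ).1) (q ζ).2) - (ζ' - gp (δ (q ζ).1) (q ζ).2) := by ring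
      rw [this] at h1
      have := norm_sub_le (ζ - gp (δ (q ζ).1) (q ζ).2) (ζ' - gp (δ (q ζ).1) (q ζ).2)
      have := hδ2 (q ζ).1
      linarith
    calc (F.card : ℝ≥0∞) = ∑ ζ ∈ F, (B (q ζ)).indicator 1 t := by
          rw [Finset.sum_congr rfl fun ζ hζ => indicator_of_mem (hq1 ζ hζ) 1]; simp
      _ = ∑ p ∈ F.image q, (B p).indicator 1 t := by rw [Finset.sum_image hinj]
      _ ≤ _ := ENNReal.sum_le_tsum _

lemma slice_zero (hn : 1 ≤ n) (μ : Measure (Cn n)) [μ.IsAddHaarMeasure] {E : Set (Cn n)} {G : Cn n → ℂ → Cn n} {T : Set (Cn n)} {K : Set ℂ}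
    (hK : ∀ ζ ∈ K, ‖ζ‖ ≤ 1) {c : ℝ} (hc : 0 < c)
    (hl : ∀ t ∈ T, ∀ t' ∈ T, ∀ ζ ∈ K, c * ‖t - t'‖ ≤ ‖G t ζ - G t' ζ‖)
    (hu : ∀ t ∈ T, ∀ ζ ∈ K, ∀ ζ' ∈ K, ‖G t ζ - G t ζ'‖ ≤ ‖ζ - ζ'‖) 
    (hE : μH[(2 * n : ℝ) - 2] E = 0) : ∀ᵐ t ∂μ, t ∈ T → ∀ ζ ∈ K, G t ζ ∉ E := by
  obtain ⟨C, hC, h⟩ := slice_count hn μ hK hc hl hu (by rw [hE]; exact ENNReal.zero_lt_top)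
  rw [ae_iff, ← nonpos_iff_eq_zero]
  have hlim : Tendsto (fun η : ℝ≥0∞ => C * η) (𝓝[>] 0) (𝓝 0) := by
    have : Tendsto (fun η : ℝ≥0∞ => C * η) (𝓝 0) (𝓝 (C * 0)) := ENNReal.Tendsto.const_mul tendsto_id (Or.inr hC)
    rw [mul_zero] at this
    exact this.mono_left nhdsWithin_le_nhds
  refine ge_of_tendsto hlim ?_
  filter_upwards [self_mem_nhdsWithin] with η hη
  obtain ⟨N, hNm, hNi, hN⟩ := h η (ne_of_gt hη) 1 one_pos
  rw [hE, zero_add] at hNi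
  refine le_trans ?_ hNi
  have h1 := mul_meas_ge_le_lintegral (μ := μ) hNm 1
  rw [one_mul] at h1
  refine (measure_mono ?_).trans h1
  intro t ht
  simp only [mem_setOf_eq] at ht
  push Not at ht
  obtain ⟨htT, ζ, hζ, hζE⟩ := ht
  have := hN t htT {ζ} (by simp [hζ, hζE]) (by simp)
  simpa using this

lemma infinite_sep {S : Set ℂ} (hS : S.Infinite) (M : ℕ) : ∃ F : Finset ℂ, ↑F ⊆ S ∧ F.card = M ∧ ∃ r > 0, ∀ ζ ∈ F, ∀ ζ' ∈ F, ζ ≠ ζ' → r < ‖ζ - ζ'‖ := by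
  obtain ⟨F, hF, hFc⟩ := hS.exists_subset_card_eq M
  refine ⟨F, hF, hFc, ?_⟩
  have : ∀ p ∈ F.offDiag, ∃ r > 0, r < ‖p.1 - p.2‖ := by
    intro p hp
    rw [Finset.mem_offDiag] at hp
    have : 0 < ‖p.1 - p.2‖ := norm_pos_iff.2 (sub_ne_zero.2 hp.2.2)
    exact ⟨_, half_pos this, half_lt_self this⟩
  have h2 : ∀ᶠ r : ℝ in 𝓝[>] 0, ∀ p ∈ F.offDiag, r < ‖p.1 - p.2‖ := by
    rw [Filter.eventually_all_finset]
    intro p hp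
    rw [Finset.mem_offDiag] at hp
    have : 0 < ‖p.1 - p.2‖ := norm_pos_iff.2 (sub_ne_zero.2 hp.2.2)
    filter_upwards [Ioo_mem_nhdsGT this] with r hr using hr.2
  obtain ⟨r, h3, h4⟩ := (Filter.Eventually.and h2 (self_mem_nhdsWithin)).exists
  exact ⟨r, h4, fun ζ hζ ζ' hζ' hne => h3 (ζ, ζ') (Finset.mem_offDiag.2 ⟨hζ, hζ', hne⟩)⟩

lemma slice_finite (hn : 1 ≤ n) (μ : Measure (Cn n)) [μ.IsAddHaarMeasure] {E : Set (Cn n)} {G : Cn n → ℂ → Cn n} {T : Set (Cn n)} {K : Set ℂ}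
    (hK : ∀ ζ ∈ K, ‖ζ‖ ≤ 1) {c : ℝ} (hc : 0 < c)
    (hl : ∀ t ∈ T, ∀ t' ∈ T, ∀ ζ ∈ K, c * ‖t - t'‖ ≤ ‖G t ζ - G t' ζ‖)
    (hu : ∀ t ∈ T, ∀ ζ ∈ K, ∀ ζ' ∈ K, ‖G t ζ - G t ζ'‖ ≤ ‖ζ - ζ'‖) 
    (hE : μH[(2 * n : ℝ) - 2] E < ⊤) : ∀ᵐ t ∂μ, t ∈ T → {ζ | ζ ∈ K ∧ G t ζ ∈ E}.Finite := by
  obtain ⟨C, hC, h⟩ := slice_count hn μ hK hc hl hu hE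
  choose N hNm hNi hN using fun k : ℕ => h 1 one_ne_zero (1 / ((k:ℝ) + 1)) (by positivity)
  have hfat : ∫⁻ t, liminf (fun k => N k t) atTop ∂μ ≤ C * (μH[(2 * n : ℝ) - 2] E + 1) := by
    refine (lintegral_liminf_le hNm).trans ?_
    refine (liminf_le_liminf (v := fun _ => C * (μH[(2 * n : ℝ) - 2] E + 1)) (Eventually.of_forall hNi) (by isBoundedDefault) (by isBoundedDefault)).trans (by simp)
  have hm : Measurable fun t => liminf (fun k => N k t) atTop := Measurable.liminf hNm
  have := ae_lt_top hm (hfat.trans_lt (ENNReal.mul_lt_top hC.lt_top (ENNReal.add_lt_top.2 ⟨hE, ENNReal.one_lt_top⟩))).ne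
  filter_upwards [this] with t ht htT
  by_contra hinf
  refine ht.ne (ENNReal.eq_top_of_forall_nnreal_le fun q => ?_)
  obtain ⟨M, hM⟩ := exists_nat_ge q
  obtain ⟨F, hF, hFc, r, hr, hFr⟩ := infinite_sep hinf M
  refine le_liminf_of_le (by isBoundedDefault) ?_
  have e3 : ∀ᶠ j : ℕ in atTop, 1 / ((j:ℝ) + 1) < r := 
      tendsto_one_div_add_atTop_nhds_zero_nat.eventually_lt_const hr
  filter_upwards [e3] with k hk
  have h1 := hN k t htT F (fun ζ hζ => hF hζ) (fun ζ hζ ζ' hζ' hne => hk.trans (hFr ζ hζ ζ' hζ' hne))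
  rw [hFc] at h1
  refine le_trans ?_ h1
  exact_mod_cast hM
end Slice
end RH

open scoped ContDiff
namespace RH
section Assembly
variable {n : ℕ} {Ω E : Set (Cn n)} {J : Cn n → Cn n →L[ℝ] Cn n} {u : Cn n → ℝ} {us : Cn n → EReal}

lemma D_open (hΩ : IsOpen Ω) (hEc : closure E ∩ Ω ⊆ E) : IsOpen (Ω \ E) := by
  have : Ω \ E = Ω ∩ (closure E)ᶜ := by
    ext x
    constructor
    · rintro ⟨h1, h2⟩
      exact ⟨h1, fun h => h2 (hEc ⟨h, h1⟩)⟩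
    · rintro ⟨h1, h2⟩
      exact ⟨h1, fun h => h2 (subset_closure h)⟩
  rw [this]
  exact hΩ.inter isClosed_closure.isOpen_compl

lemma us_usc (hΩ : IsOpen Ω) (hD : IsOpen (Ω \ E)) (huc : ContinuousOn u (Ω \ E)) (h1 : ∀ x ∈ Ω \ E, us x = (u x : EReal))
    (h2 : ∀ x ∈ E, us x = Filter.limsup (fun y => ((u y : ℝ) : EReal)) (𝓝[Ω \ E] x)) : UpperSemicontinuousOn us Ω := by
  intro x hx y hy
  refine mem_nhdsWithin_of_mem_nhds ?_
  by_cases hxE : x ∈ E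
  · rw [h2 x hxE] at hy
    obtain ⟨y', hy1, hy2⟩ := exists_between hy
    have h3 := eventually_lt_of_limsup_lt hy1
    rw [eventually_nhdsWithin_iff] at h3
    have h4 := eventually_eventually_nhds.2 h3
    filter_upwards [h4, h3, hΩ.mem_nhds hx] with z hz hz' hzΩ
    by_cases hzE : z ∈ E
    · rw [h2 z hzE]
      refine lt_of_le_of_lt ?_ hy2
      refine limsup_le_of_le (by isBoundedDefault) ?_
      rw [eventually_nhdsWithin_iff]
      filter_upwards [hz] with w hw hwD using (hw hwD).le
    · rw [h1 z ⟨hzΩ, hzE⟩]; exact (hz' ⟨hzΩ, hzE⟩).trans hy2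
  · have hxD : x ∈ Ω \ E := ⟨hx, hxE⟩
    rw [h1 x hxD] at hy
    have h3 : ContinuousAt (fun z => ((u z : ℝ) : EReal)) x := continuous_coe_real_ereal.continuousAt.comp (huc.continuousAt (hD.mem_nhds hxD))
    filter_upwards [h3.eventually_lt_const hy, hD.mem_nhds hxD] with z hz hzD
    rw [h1 z hzD]; exact hz

lemma usc_comp (hus : UpperSemicontinuousOn us Ω) {g : ℂ → Cn n} {S : Set ℂ} (hg : ContinuousOn g S) (hm : MapsTo g S Ω) :
    UpperSemicontinuousOn (fun z => us (g z)) S := by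
  intro z hz y hy
  exact (tendsto_nhdsWithin_iff.2 ⟨hg z hz, eventually_mem_nhdsWithin.mono fun w hw => hm hw⟩ : Tendsto g (𝓝[S] z) (𝓝[Ω] (g z))).eventually (hus (g z) (hm hz) y hy)

lemma JHolOn.contOn {g : ℂ → Cn n} {S : Set ℂ} (hg : JHolOn J g S) : ContinuousOn g S := fun z hz => (hg z hz).1.continuousAt.continuousWithinAt

lemma local_sub (huc : ContinuousOn u (Ω \ E)) (hpsh : JPshOnR J (Ω \ E) u) (h1 : ∀ x ∈ Ω \ E, us x = (u x : EReal))
    {g : ℂ → Cn n} {c : ℂ} {R : ℝ} (hR : 0 < R) (hg : JHolOn J g (ball c R)) (hm : MapsTo g (ball c R) (Ω \ E)) {r : ℝ} (hr : 0 < r) (hrR : r < R) :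
    SubM (fun z => us (g z)) c r := by
  have hsph : ∀ z ∈ sphere c r, z ∈ ball c R := fun z hz => by rw [mem_ball, mem_sphere.1 hz]; exact hrR
  have hd : JDisc J (Ω \ E) (fun ζ => g (c + (R:ℂ) * ζ)) := ⟨fun ζ hζ => hm (aff_mem hR le_rfl hζ), JHolOn.scale hR le_rfl hg⟩
  have h2 := (hpsh.2 _ hd).2 0 (r / R) (by positivity) (by
    intro z hz
    rw [mem_closedBall] at hz
    rw [unitDisc, mem_ball]
    exact hz.trans_lt ((div_lt_one hR).2 hrR))
  have hR' : (R:ℂ) ≠ 0 := by exact_mod_cast hR.ne'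
  have e : ∀ θ : ℝ, c + (R:ℂ) * (0 + ((r / R : ℝ) : ℂ) * exp ((θ:ℂ) * I)) = c + (r:ℂ) * exp ((θ:ℂ) * I) := by
    intro θ
    push_cast
    field_simp
    ring
  simp only [e, mul_zero, add_zero] at h2
  refine subM_of_frozen (g := fun z => u (g z)) hr ?_ ?_ ?_
  · exact huc.comp ((JHolOn.contOn hg).mono fun z hz => hsph z hz) fun z hz => hm (hsph z hz)
  · intro z hz
    exact h1 _ (hm (hsph z hz))
  · have e2 : (fun θ : ℝ => us (g (c + (r : ℂ) * Complex.exp ((θ : ℂ) * Complex.I)))) = fun θ : ℝ => ((u (g (c + (r : ℂ) * Complex.exp ((θ : ℂ) * Complex.I))) : ℝ) : EReal) :=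
      funext fun θ => h1 _ (hm (hsph _ (cmem c hr θ)))
    rw [e2, h1 _ (hm (mem_ball_self hR))]
    exact h2

lemma disc_sub (hD : IsOpen (Ω \ E)) (huc : ContinuousOn u (Ω \ E)) (hpsh : JPshOnR J (Ω \ E) u) (h1 : ∀ x ∈ Ω \ E, us x = (u x : EReal))
    (hus : UpperSemicontinuousOn us Ω) {g : ℂ → Cn n} (hg : JHolOn J g (ball 0 (1/4))) (hm : ∀ ζ, g ζ ∈ Ω)
    (hT : ∀ ζ ∈ closedBall (0:ℂ) (1/8), us (g ζ) < ⊤) (h0 : g 0 ∉ E) (hfin : {ζ | ζ ∈ closedBall (0:ℂ) (1/8) ∧ g ζ ∈ E}.Finite) :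
    SubM (fun z => us (g z)) 0 (1/8) := by
  have hsub : closedBall (0:ℂ) (1/8) ⊆ ball 0 (1/4) := closedBall_subset_ball (by norm_num)
  refine subM_of_local (by norm_num) (usc_comp hus ((JHolOn.contOn hg).mono hsub) fun z _ => hm z) hT hfin (fun h => h0 h.2) ?_
  intro b hb hbS
  have hbE : g b ∈ Ω \ E := ⟨hm b, fun h => hbS ⟨ball_subset_closedBall hb, h⟩⟩
  have hb4 : b ∈ ball (0:ℂ) (1/4) := hsub (ball_subset_closedBall hb)
  have hev : ∀ᶠ z in 𝓝 b, g z ∈ Ω \ E ∧ z ∈ ball (0:ℂ) (1/4) :=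
    Filter.Eventually.and ((hg b hb4).1.continuousAt.eventually (hD.mem_nhds hbE)) (isOpen_ball.mem_nhds hb4)
  obtain ⟨R, hR, hRs⟩ := Metric.eventually_nhds_iff_ball.1 hev
  exact ⟨R, hR, fun r hr hrR => local_sub huc hpsh h1 hR (fun z hz => hg z (hRs z hz).2) (fun z hz => (hRs z hz).1) hr hrR⟩

lemma le_of_ae (hD : IsOpen (Ω \ E)) (huc : ContinuousOn u (Ω \ E)) (μ : Measure (Cn n)) [μ.IsAddHaarMeasure] {p : Cn n} {τ A : ℝ}
    (h : ∀ᵐ t ∂μ, ‖t‖ < τ → p + t ∈ Ω \ E → u (p + t) ≤ A) : ∀ x ∈ Ω \ E, ‖x - p‖ < τ → u x ≤ A := by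
  intro x hx hxp
  by_contra hlt
  push Not at hlt
  have hev : ∀ᶠ y in 𝓝 x, y ∈ Ω \ E ∧ ‖y - p‖ < τ ∧ A < u y := by
    refine Filter.Eventually.and (hD.mem_nhds hx) (Filter.Eventually.and ?_ ?_)
    · exact (show Continuous fun y => ‖y - p‖ by fun_prop).continuousAt.eventually_lt_const hxp
    · exact (huc.continuousAt (hD.mem_nhds hx)).eventually_const_lt hlt
  have hev2 : ∀ᶠ t in 𝓝 (x - p), p + t ∈ Ω \ E ∧ ‖p + t - p‖ < τ ∧ A < u (p + t) := by
    have : Tendsto (fun t => p + t) (𝓝 (x - p)) (𝓝 x) := by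
      have := (show Continuous fun t => p + t by fun_prop).tendsto (x - p)
      simpa using this
    exact this.eventually hev
  have hpos : 0 < μ {t | p + t ∈ Ω \ E ∧ ‖p + t - p‖ < τ ∧ A < u (p + t)} := Measure.measure_pos_of_mem_nhds μ hev2
  refine hpos.ne' (measure_mono_null ?_ (ae_iff.1 h))
  rintro t ⟨h1, h2, h3⟩
  rw [add_sub_cancel_left] at h2
  simp only [mem_ofPred_eq]
  push Not
  exact ⟨h2, h1, h3⟩

lemma avg_aff (φ : ℂ → ℝ) (b : ℂ) (r : ℝ) : Real.circleAverage (fun ζ => φ (b + ((8 * r : ℝ) : ℂ) * ζ)) 0 (1/8) = Real.circleAverage φ b r := by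
  rw [circleAverage_eq_restrict, circleAverage_eq_restrict]
  congr 2
  funext θ
  congr 1
  push_cast
  ring

theorem main_lemma (hn : 1 ≤ n) (hΩ : IsOpen Ω) (hJ : IsACS Ω J) (hD : IsOpen (Ω \ E)) (hE : μH[(2 * n : ℝ) - 2] E < ⊤)
    (huc : ContinuousOn u (Ω \ E)) (hpsh : JPshOnR J (Ω \ E) u) (h1 : ∀ x ∈ Ω \ E, us x = (u x : EReal))
    (h2 : ∀ x ∈ E, us x = Filter.limsup (fun y => ((u y : ℝ) : EReal)) (𝓝[Ω \ E] x)) (hus : UpperSemicontinuousOn us Ω)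
    (hT : ∀ x ∈ Ω, us x < ⊤) : JPshOn J Ω us := by
  refine ⟨hus, fun f hf => ?_⟩
  obtain ⟨hfm, hfh⟩ := hf
  have huf : UpperSemicontinuousOn (fun ζ => us (f ζ)) unitDisc := usc_comp hus (JHolOn.contOn hfh) hfm
  refine ⟨huf, fun a r hr har => ?_⟩
  refine frozen_of_subM (h := fun ζ => us (f ζ)) hr (huf.mono (sphere_subset_closedBall.trans har)) (fun z hz => hT _ (hfm (har (sphere_subset_closedBall hz)))) ?_
  refine subM_of_local hr (huf.mono har) (fun z hz => hT _ (hfm (har hz))) Set.finite_empty (notMem_empty _) ?_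
  intro b hb _
  obtain ⟨R, hR, hRs⟩ : ∃ R > 0, ball b R ⊆ unitDisc := Metric.isOpen_iff.1 isOpen_ball b (har (ball_subset_closedBall hb))
  obtain ⟨ρ0, hρ0, hρR, hfam⟩ := FAM hΩ hJ hR (fun z hz => hfh z (hRs hz)) (fun z hz => hfm (hRs hz))
  refine ⟨ρ0 / 8, by positivity, fun r' hr' hr'0 => ?_⟩
  intro φ hφ hlt
  have hρ : 0 < 8 * r' := by positivity
  have hsm : ∀ ζ ∈ sphere (0:ℂ) (1/8), b + ((8 * r' : ℝ) : ℂ) * ζ ∈ sphere b r' := by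
    intro ζ hζ
    rw [mem_sphere_zero_iff_norm] at hζ
    rw [mem_sphere, dist_eq_norm, add_sub_cancel_left, norm_mul, hζ, norm_real, Real.norm_of_nonneg hρ.le]
    ring
  have hsd : ∀ z ∈ sphere b r', z ∈ unitDisc := by
    intro z hz
    apply hRs
    rw [mem_ball, mem_sphere.1 hz]
    linarith
  have hcpt : ∀ᶠ e in 𝓝 (0 : Cn n), ∀ ζ ∈ sphere (0:ℂ) (1/8), ζ ∈ sphere (0:ℂ) (1/8) → f (b + ((8 * r' : ℝ) : ℂ) * ζ) + e ∈ Ω →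
      us (f (b + ((8 * r' : ℝ) : ℂ) * ζ) + e) < φ (b + ((8 * r' : ℝ) : ℂ) * ζ) := by
    refine IsCompact.eventually_forall_of_forall_eventually (isCompact_sphere _ _) ?_
    intro ζ hζ
    obtain ⟨y, hy1, hy2⟩ := EReal.lt_iff_exists_real_btwn.1 (hlt _ (hsm ζ hζ))
    rw [EReal.coe_lt_coe_iff] at hy2
    have hz := hsd _ (hsm ζ hζ)
    have c1 : ContinuousAt (fun q : Cn n × ℂ => f (b + ((8 * r' : ℝ) : ℂ) * q.2) + q.1) ((0 : Cn n), ζ) := by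
      refine ContinuousAt.add ?_ continuousAt_fst
      exact ContinuousAt.comp (f := fun q : Cn n × ℂ => b + ((8 * r' : ℝ) : ℂ) * q.2) (g := f) (hfh _ hz).1.continuousAt (by fun_prop)
    have c2 := hus _ (hfm hz) y hy1
    rw [eventually_nhdsWithin_iff] at c2
    have c1' : Tendsto (fun q : Cn n × ℂ => f (b + ((8 * r' : ℝ) : ℂ) * q.2) + q.1) (𝓝 ((0 : Cn n), ζ)) (𝓝 (f (b + ((8 * r' : ℝ) : ℂ) * ζ))) := by
      have := c1.tendsto
      simpa using this
    have c3 : ∀ᶠ z in 𝓝 (b + ((8 * r' : ℝ) : ℂ) * ζ), z ∈ sphere b r' → y < φ z := by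
      rw [← eventually_nhdsWithin_iff]
      exact (hφ _ (hsm ζ hζ)).eventually_const_lt hy2
    have c4 : Tendsto (fun q : Cn n × ℂ => b + ((8 * r' : ℝ) : ℂ) * q.2) (𝓝 ((0 : Cn n), ζ)) (𝓝 (b + ((8 * r' : ℝ) : ℂ) * ζ)) :=
      (show Continuous fun q : Cn n × ℂ => b + ((8 * r' : ℝ) : ℂ) * q.2 by fun_prop).tendsto _
    filter_upwards [c1'.eventually c2, c4.eventually c3] with q hq1 hq2 hqs hqΩ
    exact (hq1 hqΩ).trans (EReal.coe_lt_coe_iff.2 (hq2 (hsm _ hqs)))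
  obtain ⟨ε0, hε0, hε⟩ := Metric.eventually_nhds_iff_ball.1 hcpt
  obtain ⟨τ, hτ, G, hG⟩ := hfam (8 * r') hρ (by linarith) (ε0 / 2) (by positivity)
  set μ : Measure (Cn n) := Measure.addHaar with hμ
  have hK : closedBall (0:ℂ) (1/8) ⊆ ball 0 (1/4) := closedBall_subset_ball (by norm_num)
  have hsl := slice_finite hn μ (E := E) (G := G) (T := ball 0 τ) (K := closedBall (0:ℂ) (1/8)) (c := 1/2)
    (fun ζ hζ => by rw [mem_closedBall_zero_iff] at hζ; linarith) (by norm_num)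
    (fun t ht t' ht' ζ hζ => (hG t (mem_ball_zero_iff.1 ht)).2.2.2.2.2 t' (mem_ball_zero_iff.1 ht') ζ (hK hζ))
    (fun t ht ζ hζ ζ' hζ' => (hG t (mem_ball_zero_iff.1 ht)).2.2.2.2.1 ζ (hK hζ) ζ' (hK hζ')) hE
  set A := Real.circleAverage φ b r' with hA
  have hae : ∀ᵐ t ∂μ, ‖t‖ < τ → f b + t ∈ Ω \ E → u (f b + t) ≤ A := by
    filter_upwards [hsl] with t ht htτ htD
    obtain ⟨g1, g2, g3, g4, g5, -⟩ := hG t htτ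
    have hs := disc_sub hD huc hpsh h1 hus g1 g2 (fun ζ _ => hT _ (g2 ζ)) (by rw [g3]; exact htD.2) (ht (mem_ball_zero_iff.2 htτ))
    have := hs (fun ζ => φ (b + ((8 * r' : ℝ) : ℂ) * ζ)) (hφ.comp (by fun_prop) hsm) (by
      intro ζ hζ
      have h5 := hε (G t ζ - f (b + ((8 * r' : ℝ) : ℂ) * ζ)) (by
        rw [mem_ball_zero_iff]
        refine (g4 ζ (hK (sphere_subset_closedBall hζ))).trans_lt (by linarith)) ζ hζ hζ
      rw [add_sub_cancel] at h5
      exact h5 (g2 ζ))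
    rw [avg_aff] at this
    beta_reduce at this
    rw [g3, h1 _ htD, EReal.coe_le_coe_iff] at this
    exact this
  have hall := le_of_ae hD huc μ hae
  have hfb : f b ∈ Ω := hfm (har (ball_subset_closedBall hb))
  by_cases hbE : f b ∈ E
  · show us (f b) ≤ _
    rw [h2 _ hbE]
    refine limsup_le_of_le (by isBoundedDefault) ?_
    have : ∀ᶠ x in 𝓝 (f b), ‖x - f b‖ < τ := by
      have := Metric.ball_mem_nhds (f b) hτ
      filter_upwards [this] with x hx
      rwa [mem_ball, dist_eq_norm] at hx
    filter_upwards [mem_nhdsWithin_of_mem_nhds this, self_mem_nhdsWithin] with x hx hxD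
    exact EReal.coe_le_coe_iff.2 (hall x hxD hx)
  · show us (f b) ≤ _
    rw [h1 _ ⟨hfb, hbE⟩]
    exact EReal.coe_le_coe_iff.2 (hall _ ⟨hfb, hbE⟩ (by simpa using hτ))

theorem bdd_lemma (hn : 1 ≤ n) (hΩ : IsOpen Ω) (hJ : IsACS Ω J) (hD : IsOpen (Ω \ E)) (hE : μH[(2 * n : ℝ) - 2] E = 0)
    (huc : ContinuousOn u (Ω \ E)) (hpsh : JPshOnR J (Ω \ E) u) (h1 : ∀ x ∈ Ω \ E, us x = (u x : EReal))
    (hus : UpperSemicontinuousOn us Ω) {p : Cn n} (hp : p ∈ Ω) :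
    ∃ τ > 0, ∃ A : ℝ, ∀ x ∈ Ω \ E, ‖x - p‖ < τ → u x ≤ A := by
  obtain ⟨τ, hτ, c, hc, G, hG⟩ := FAMv hΩ hJ hp
  set μ : Measure (Cn n) := Measure.addHaar with hμ
  have hK : closedBall (0:ℂ) (1/8) ⊆ ball 0 (1/4) := closedBall_subset_ball (by norm_num)
  have hS : sphere (0:ℂ) (1/8) ⊆ ball 0 (1/4) := sphere_subset_closedBall.trans hK
  have h00 : ‖(0 : Cn n)‖ < τ := by simpa using hτ
  have hs1 := slice_zero hn μ (E := E) (G := fun v => G 0 v) (T := ball 0 τ) (K := sphere (0:ℂ) (1/8)) (c := 1/8 * c)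
    (fun ζ hζ => by rw [mem_sphere_zero_iff_norm] at hζ; linarith) (by positivity)
    (fun v hv v' hv' ζ hζ => by
      have := (hG 0 v h00 (mem_ball_zero_iff.1 hv)).2.2.2.2.2.2 v' (mem_ball_zero_iff.1 hv') ζ (hS hζ)
      rwa [mem_sphere_zero_iff_norm.1 hζ] at this)
    (fun v hv ζ hζ ζ' hζ' => (hG 0 v h00 (mem_ball_zero_iff.1 hv)).2.2.2.1 ζ (hS hζ) ζ' (hS hζ')) hE
  obtain ⟨v, hvτ, hv⟩ : ∃ v ∈ ball (0 : Cn n) τ, ∀ ζ ∈ sphere (0:ℂ) (1/8), G 0 v ζ ∉ E := by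
    by_contra hcon
    push Not at hcon
    refine (measure_ball_pos μ (0 : Cn n) hτ).ne' (measure_mono_null ?_ (ae_iff.1 hs1))
    intro v hv
    simp only [mem_ofPred_eq]
    push Not
    exact ⟨hv, hcon v hv⟩
  have hvτ' := mem_ball_zero_iff.1 hvτ
  have g0 := hG 0 v h00 hvτ'
  have hcpt : IsCompact (G 0 v '' sphere (0:ℂ) (1/8)) := (isCompact_sphere _ _).image_of_continuousOn ((JHolOn.contOn g0.1).mono hS)
  have hcD : G 0 v '' sphere (0:ℂ) (1/8) ⊆ Ω \ E := by
    rintro _ ⟨ζ, hζ, rfl⟩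
    exact ⟨g0.2.1 ζ, hv ζ hζ⟩
  obtain ⟨σ, hσ, hσD⟩ := hcpt.exists_cthickening_subset_open hD hcD
  obtain ⟨M, hM⟩ := (hcpt.cthickening (r := σ)).bddAbove_image (huc.mono hσD)
  have hs2 := slice_zero hn μ (E := E) (G := fun t => G t v) (T := ball 0 τ) (K := closedBall (0:ℂ) (1/8)) (c := 1/2)
    (fun ζ hζ => by rw [mem_closedBall_zero_iff] at hζ; linarith) (by norm_num)
    (fun t ht t' ht' ζ hζ => (hG t v (mem_ball_zero_iff.1 ht) hvτ').2.2.2.2.1 t' (mem_ball_zero_iff.1 ht') ζ (hK hζ))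
    (fun t ht ζ hζ ζ' hζ' => (hG t v (mem_ball_zero_iff.1 ht) hvτ').2.2.2.1 ζ (hK hζ) ζ' (hK hζ')) hE
  refine ⟨min τ (σ / 2), by positivity, M + 1, le_of_ae hD huc μ ?_⟩
  filter_upwards [hs2] with t ht htm htD
  have htτ : ‖t‖ < τ := htm.trans_le (min_le_left _ _)
  have htσ : ‖t‖ < σ / 2 := htm.trans_le (min_le_right _ _)
  have hno := ht (mem_ball_zero_iff.2 htτ)
  obtain ⟨g1, g2, g3, g4, g5, g6, -⟩ := hG t v htτ hvτ'
  have hs := disc_sub hD huc hpsh h1 hus g1 g2 (fun ζ hζ => by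
    rw [h1 _ ⟨g2 ζ, hno ζ hζ⟩]; exact EReal.coe_lt_top _) (by rw [g3]; exact htD.2) (by
      convert Set.finite_empty (α := ℂ)
      ext ζ
      simp only [mem_ofPred_eq, mem_empty_iff_false, iff_false]
      rintro ⟨a, b⟩
      exact hno ζ a b)
  have := hs (fun _ => M + 1) continuousOn_const (by
    intro ζ hζ
    beta_reduce
    rw [h1 _ ⟨g2 ζ, hno ζ (sphere_subset_closedBall hζ)⟩, EReal.coe_lt_coe_iff]
    have h3 := g6 0 h00 ζ (hS hζ)
    rw [sub_zero] at h3
    have h4 : G t v ζ ∈ cthickening σ (G 0 v '' sphere (0:ℂ) (1/8)) := by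
      refine mem_cthickening_of_dist_le _ (G 0 v ζ) σ _ (mem_image_of_mem _ hζ) ?_
      rw [dist_eq_norm]; linarith
    have := hM (mem_image_of_mem u h4)
    linarith)
  beta_reduce at this
  rw [Real.circleAverage_const, g3, h1 _ htD, EReal.coe_le_coe_iff] at this
  exact this

lemma empty_of_neg {s : ℝ} (hs : s < 0) (hE : μH[s] E < ⊤) : E = ∅ := by
  rcases Measure.hausdorffMeasure_zero_or_top hs E with h | h
  · by_contra hne
    obtain ⟨x, hx⟩ := nonempty_iff_ne_empty.2 hne
    have := measure_mono_null (singleton_subset_iff.2 hx) h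
    rw [Measure.hausdorffMeasure_zero_singleton] at this
    exact one_ne_zero this
  · exact absurd h hE.ne

lemma empty_case (hpsh : JPshOnR J Ω u) (h1 : ∀ x ∈ Ω, us x = (u x : EReal)) (hus : UpperSemicontinuousOn us Ω) : JPshOn J Ω us := by
  refine ⟨hus, fun f hf => ⟨usc_comp hus (JHolOn.contOn hf.2) hf.1, fun a r hr har => ?_⟩⟩
  have := (hpsh.2 f hf).2 a r hr har
  have e2 : (fun θ : ℝ => us (f (a + (r : ℂ) * Complex.exp ((θ : ℂ) * Complex.I)))) = fun θ : ℝ => ((u (f (a + (r : ℂ) * Complex.exp ((θ : ℂ) * Complex.I))) : ℝ) : EReal) :=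
    funext fun θ => h1 _ (hf.1 (har (sphere_subset_closedBall (cmem a hr θ))))
  beta_reduce
  rw [e2, h1 _ (hf.1 (har (mem_closedBall_self hr.le)))]
  exact this
end Assembly
end RH

/-- **Removability under Hausdorff measure conditions** (Theorem 1.4.13): a closed subset `E` of
an almost complex manifold `(Ω,J)` of real dimension `2n` is removable (a) for bounded continuous
`J`-plurisubharmonic functions if `H_{2n-2}(E) < ∞`, and (b) for continuous
`J`-plurisubharmonic functions if `H_{2n-3}(E) = 0`. -/
theorem removability_hausdorff_measure {n : ℕ} (Ω : Set (Cn n)) (hΩ : IsOpen Ω)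
    (J : Cn n → Cn n →L[ℝ] Cn n) (hJ : IsACS Ω J)
    (E : Set (Cn n)) (hEΩ : E ⊆ Ω) (hEclosed : closure E ∩ Ω ⊆ E) :
    ((μH[(2 * n : ℝ) - 2] E < ⊤) →
      ∀ u : Cn n → ℝ, ContinuousOn u (Ω \ E) → JPshOnR J (Ω \ E) u →
        (∃ M : ℝ, ∀ x ∈ Ω \ E, |u x| ≤ M) →
        ∀ ustar : Cn n → EReal,
          (∀ x ∈ Ω \ E, ustar x = (u x : EReal)) →
          (∀ x ∈ E, ustar x = Filter.limsup (fun y => ((u y : ℝ) : EReal)) (𝓝[Ω \ E] x)) →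
          JPshOn J Ω ustar) ∧
    ((μH[(2 * n : ℝ) - 3] E = 0) →
      ∀ u : Cn n → ℝ, ContinuousOn u (Ω \ E) → JPshOnR J (Ω \ E) u →
        ∀ ustar : Cn n → EReal,
          (∀ x ∈ Ω \ E, ustar x = (u x : EReal)) →
          (∀ x ∈ E, ustar x = Filter.limsup (fun y => ((u y : ℝ) : EReal)) (𝓝[Ω \ E] x)) →
          JPshOn J Ω ustar) := by
  have hD := RH.D_open hΩ hEclosed
  have key : μH[(2 * n : ℝ) - 2] E < ⊤ → ∀ u : Cn n → ℝ, ContinuousOn u (Ω \ E) → JPshOnR J (Ω \ E) u →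
      ∀ ustar : Cn n → EReal, (∀ x ∈ Ω \ E, ustar x = (u x : EReal)) →
      (∀ x ∈ E, ustar x = Filter.limsup (fun y => ((u y : ℝ) : EReal)) (𝓝[Ω \ E] x)) →
      (1 ≤ n → ∀ p ∈ E, ∃ τ > 0, ∃ A : ℝ, ∀ x ∈ Ω \ E, ‖x - p‖ < τ → u x ≤ A) → JPshOn J Ω ustar := by
    intro hE u huc hpsh ustar h1 h2 hb
    have hus := RH.us_usc hΩ hD huc h1 h2
    rcases Nat.eq_zero_or_pos n with hn | hn
    · have hE0 : E = ∅ := RH.empty_of_neg (by subst hn; norm_num) hE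
      rw [hE0, diff_empty] at hpsh h1
      exact RH.empty_case hpsh h1 hus
    · refine RH.main_lemma hn hΩ hJ hD hE huc hpsh h1 h2 hus fun x hx => ?_
      by_cases hxE : x ∈ E
      · obtain ⟨τ, hτ, A, hA⟩ := hb hn x hxE
        rw [h2 x hxE]
        refine lt_of_le_of_lt (limsup_le_of_le (by isBoundedDefault) ?_) (EReal.coe_lt_top A)
        filter_upwards [mem_nhdsWithin_of_mem_nhds (Metric.ball_mem_nhds x hτ), self_mem_nhdsWithin] with y hy hyD
        rw [Metric.mem_ball, dist_eq_norm] at hy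
        exact EReal.coe_le_coe_iff.2 (hA y hyD hy)
      · rw [h1 x ⟨hx, hxE⟩]; exact EReal.coe_lt_top _
  constructor
  · rintro hE u huc hpsh ⟨M, hM⟩ ustar h1 h2
    exact key hE u huc hpsh ustar h1 h2 fun _ p _ => ⟨1, one_pos, M, fun x hx _ => (le_abs_self _).trans (hM x hx)⟩
  · intro hE u huc hpsh ustar h1 h2
    have hE2 : μH[(2 * n : ℝ) - 2] E = 0 := by
      rw [← nonpos_iff_eq_zero, ← hE]
      exact Measure.hausdorffMeasure_mono (by linarith) E
    exact key (by rw [hE2]; exact ENNReal.zero_lt_top) u huc hpsh ustar h1 h2 fun hn p hp =>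
      RH.bdd_lemma hn hΩ hJ hD hE2 huc hpsh h1 (RH.us_usc hΩ hD huc h1 h2) (hEΩ hp)
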